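/- Let f be a transcendental meromorphic function f : ℂ → Ĉ or a rational map f : Ĉ → Ĉ of degree ≥ 2, and suppose z ∈ J(f) \ P(f). Then z is contained in a simply connected nice open set U_z of arbitrarily small diameter satisfying dist(U_z, P(f)) > 0. -/

import Mathlib

open Metric MeasureTheory Filter Set Function Topology ENNReal NNReal

noncomputable section
attribute [local instance] Classical.propDecidable

/-- An abstract model of the Riemann sphere `Ĉ`: a compact metric space carrying the
spherical (chordal) metric, an open embedding `ι` of `ℂ` whose complement is the single
point `infty`, and the inversion `z ↦ 1/z` as a global homeomorphism. -/
structure SphereModel (𝕊 : Type) [MetricSpace 𝕊] [CompactSpace 𝕊] where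
  ι : ℂ → 𝕊
  infty : 𝕊
  continuous_ι : Continuous ι
  injective_ι : Function.Injective ι
  range_ι : Set.range ι = {infty}ᶜ
  isOpenMap_ι : IsOpenMap ι
  sphereInv : 𝕊 → 𝕊
  continuous_sphereInv : Continuous sphereInv
  sphereInv_invol : ∀ x, sphereInv (sphereInv x) = x
  sphereInv_ι : ∀ z : ℂ, z ≠ 0 → sphereInv (ι z) = ι z⁻¹
  sphereInv_zero : sphereInv (ι 0) = infty
  sphereInv_infty : sphereInv infty = ι 0
  dist_ι : ∀ z w : ℂ,
    dist (ι z) (ι w) = 2 * dist z w / (Real.sqrt (1 + ‖z‖ ^ 2) * Real.sqrt (1 + ‖w‖ ^ 2))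
  dist_infty : ∀ z : ℂ, dist (ι z) infty = 2 / Real.sqrt (1 + ‖z‖ ^ 2)

namespace SphereModel

variable {𝕊 : Type} [MetricSpace 𝕊] [CompactSpace 𝕊]

/-- The partially defined inverse of `ι` (junk value at `infty`). -/
def toC (S : SphereModel 𝕊) : 𝕊 → ℂ := Function.invFun S.ι

/-- The standard chart of the sphere around a point: the identity chart away from
`infty` and the chart `z ↦ 1/z` at `infty`. -/
def chart (S : SphereModel 𝕊) (w : 𝕊) : 𝕊 → ℂ :=
  if w = S.infty then S.toC ∘ S.sphereInv else S.toC

/-- Local inverse of `chart`. -/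
def chartInv (S : SphereModel 𝕊) (w : 𝕊) : ℂ → 𝕊 :=
  if w = S.infty then S.sphereInv ∘ S.ι else S.ι

/-- `f : 𝕊 → 𝕊` is holomorphic at `x`, read through the standard charts. -/
def HolAt (S : SphereModel 𝕊) (f : 𝕊 → 𝕊) (x : 𝕊) : Prop :=
  ContinuousAt f x ∧ AnalyticAt ℂ (S.chart (f x) ∘ f ∘ S.chartInv x) (S.chart x x)

/-- `f` represents a meromorphic function `ℂ → Ĉ`: it is holomorphic (as a sphere-valued
map) at every point of `ℂ`.  (The value of `f` at `infty` is junk.) -/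
def MeromorphicDyn (S : SphereModel 𝕊) (f : 𝕊 → 𝕊) : Prop :=
  ∀ z : ℂ, S.HolAt f (S.ι z)

/-- `f` represents a transcendental meromorphic function: it is meromorphic on `ℂ` and
admits no holomorphic extension at `infty`. -/
def TranscendentalDyn (S : SphereModel 𝕊) (f : 𝕊 → 𝕊) : Prop :=
  S.MeromorphicDyn f ∧
    ¬ ∃ g : 𝕊 → 𝕊, (∀ z : ℂ, g (S.ι z) = f (S.ι z)) ∧ S.HolAt g S.infty

/-- `f` represents a rational map of degree at least `2`: holomorphic on the whole sphere,
non-constant and non-injective. -/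
def RationalDegGe2 (S : SphereModel 𝕊) (f : 𝕊 → 𝕊) : Prop :=
  (∀ x, S.HolAt f x) ∧ (∀ c, f ≠ fun _ => c) ∧ ¬ Function.Injective f

/-- `f` is a transcendental meromorphic function or a rational map of degree `≥ 2`. -/
def MeroOrRat (S : SphereModel 𝕊) (f : 𝕊 → 𝕊) : Prop :=
  S.TranscendentalDyn f ∨ S.RationalDegGe2 f

/-- The domain of holomorphy of `f` (`ℂ` for transcendental maps, `Ĉ` for rational ones). -/
def dom (S : SphereModel 𝕊) (f : 𝕊 → 𝕊) : Set 𝕊 := {x | S.HolAt f x}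

/-- `f^[n] z` is defined (all earlier iterates lie in the domain of `f`). -/
def DefinedUpTo (S : SphereModel 𝕊) (f : 𝕊 → 𝕊) (z : 𝕊) (n : ℕ) : Prop :=
  ∀ i < n, f^[i] z ∈ S.dom f

/-- The (partially defined) forward orbit of a point. -/
def orb (S : SphereModel 𝕊) (f : 𝕊 → 𝕊) (z : 𝕊) : Set 𝕊 :=
  {w | ∃ n, S.DefinedUpTo f z n ∧ f^[n] z = w}

/-- The forward orbit of a set. -/
def orbSet (S : SphereModel 𝕊) (f : 𝕊 → 𝕊) (A : Set 𝕊) : Set 𝕊 :=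
  ⋃ z ∈ A, S.orb f z

/-- The Fatou set: points with a neighbourhood on which all iterates are defined and form
a normal family (equivalently, on the compact sphere, an equicontinuous family). -/
def fatou (S : SphereModel 𝕊) (f : 𝕊 → 𝕊) : Set 𝕊 :=
  {x | ∃ U ∈ 𝓝 x, (∀ y ∈ U, ∀ n, S.DefinedUpTo f y n) ∧
      EquicontinuousOn (fun n : ℕ => f^[n]) U}

/-- The Julia set: the complement of the Fatou set. -/
def julia (S : SphereModel 𝕊) (f : 𝕊 → 𝕊) : Set 𝕊 := (S.fatou f)ᶜ

/-- Singular values: `v` is not singular iff it has an open neighbourhood `W` on which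
all inverse branches of `f` are well-defined univalent maps. -/
def singularValues (S : SphereModel 𝕊) (f : 𝕊 → 𝕊) : Set 𝕊 :=
  {v | ¬ ∃ W : Set 𝕊, IsOpen W ∧ v ∈ W ∧
      ∀ x ∈ S.dom f, f x ∈ W →
        ∃ g : 𝕊 → 𝕊, ContinuousOn g W ∧ Set.InjOn g W ∧ g (f x) = x ∧
          ∀ w ∈ W, g w ∈ S.dom f ∧ f (g w) = w}

/-- The post-singular set `P(f)`. -/
def postSingular (S : SphereModel 𝕊) (f : 𝕊 → 𝕊) : Set 𝕊 :=
  closure (S.orbSet f (S.singularValues f))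

end SphereModel

/-- The ω-limit set of a point under iteration. -/
def omegaLimitSet {α : Type*} [TopologicalSpace α] (f : α → α) (z : α) : Set α :=
  ⋂ n : ℕ, closure {w | ∃ k, n ≤ k ∧ f^[k] z = w}

/-- A nice set: an open set such that no boundary point ever enters the set. -/
def IsNice {α : Type*} [TopologicalSpace α] (f : α → α) (U : Set α) : Prop :=
  IsOpen U ∧ ∀ n : ℕ, 0 < n → f^[n] '' frontier U ∩ U = ∅

/-- The norm of the derivative of `f` at `x` with respect to the underlying metric,
defined as the limsup of difference quotients (possibly `∞`). -/
def ednorm {α : Type*} [MetricSpace α] (f : α → α) (x : α) : ℝ≥0∞ :=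
  Filter.limsup (fun y => edist (f y) (f x) / edist y x) (𝓝[≠] x)

/-- The norm of the derivative with respect to the Euclidean metric, read through `ι`
(`∞` at `infty` and at poles). -/
def ednormEuc {𝕊 : Type} [MetricSpace 𝕊] [CompactSpace 𝕊] (S : SphereModel 𝕊)
    (f : 𝕊 → 𝕊) (x : 𝕊) : ℝ≥0∞ :=
  if x = S.infty ∨ f x = S.infty then ⊤
  else ENNReal.ofReal ‖deriv (fun w => S.toC (f (S.ι w))) (S.toC x)‖

/-- The family `𝒱_n(U, z, R)` of pullbacks of `U` by `f^n` that extend univalently over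
`B(z,R)`. -/
def pullbackFam {α : Type*} [MetricSpace α] (f : α → α) (U : Set α) (z : α) (R : ℝ)
    (n : ℕ) : Set (Set α) :=
  {V | IsOpen V ∧ f^[n] '' V = U ∧
    ∃ V' : Set α, V ⊆ V' ∧ IsConnected V' ∧ Set.InjOn (f^[n]) V' ∧
      f^[n] '' V' = Metric.ball z R}

/-- A `(t,p)`-conformal measure for `f`, with respect to the derivative norm `nd`
(spherical or Euclidean): finite on compact sets disjoint from the post-singular set,
with Jacobian `exp p * nd ^ t` wherever the latter is finite (`0 ^ 0 = 1` by the
`ENNReal.rpow` convention), and `m {x} = 0`, `m {f x}` zero or finite whenever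
`nd x ^ t = ∞`. -/
def IsConformalMeasure {𝕊 : Type} [MetricSpace 𝕊] [CompactSpace 𝕊] [MeasurableSpace 𝕊]
    (S : SphereModel 𝕊) (f : 𝕊 → 𝕊) (t p : ℝ) (nd : 𝕊 → ℝ≥0∞) (m : Measure 𝕊) : Prop :=
  (∀ K : Set 𝕊, IsCompact K → Disjoint K (S.postSingular f) → m K < ⊤) ∧
  (∀ A : Set 𝕊, MeasurableSet A → A ⊆ S.dom f → Set.InjOn f A →
      (∀ x ∈ A, nd x ^ t ≠ ⊤) →
      m (f '' A) = ∫⁻ x in A, ENNReal.ofReal (Real.exp p) * nd x ^ t ∂m) ∧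
  (∀ x, nd x ^ t = ⊤ → m {x} = 0 ∧ (m {f x} = 0 ∨ m {f x} < ⊤))

/-- The set `E` of univalently inaccessible points. -/
def univInaccessible {𝕊 : Type} [MetricSpace 𝕊] [CompactSpace 𝕊] (S : SphereModel 𝕊)
    (f : 𝕊 → 𝕊) : Set 𝕊 :=
  {z | ∃ U : Set 𝕊, IsOpen U ∧ (U ∩ S.julia f).Nonempty ∧
    ¬ ∃ (y : 𝕊) (n k : ℕ), y ∈ U ∧ f^[n] z = f^[k] y ∧
      0 < ednorm (f^[n]) z * ednorm (f^[k]) y ∧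
      ednorm (f^[n]) z * ednorm (f^[k]) y < ⊤}

/-- A holomorphic inverse branch of `f^{-n}` on `W`. -/
def IsInvBranch {𝕊 : Type} [MetricSpace 𝕊] [CompactSpace 𝕊] (S : SphereModel 𝕊)
    (f : 𝕊 → 𝕊) (n : ℕ) (W : Set 𝕊) (g : 𝕊 → 𝕊) : Prop :=
  (∀ w ∈ W, S.HolAt g w) ∧ ∀ w ∈ W, f^[n] (g w) = w

/-- The multiplier of `f^[n]` at a point `z`, computed in the standard chart at `z`. -/
def SphereModel.multiplier {𝕊 : Type} [MetricSpace 𝕊] [CompactSpace 𝕊]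
    (S : SphereModel 𝕊) (f : 𝕊 → 𝕊) (n : ℕ) (z : 𝕊) : ℂ :=
  deriv (S.chart z ∘ f^[n] ∘ S.chartInv z) (S.chart z z)

/-- A parabolic periodic point: a periodic point whose cycle has multiplier a root of
unity. -/
def IsParabolicPeriodic {𝕊 : Type} [MetricSpace 𝕊] [CompactSpace 𝕊] (S : SphereModel 𝕊)
    (f : 𝕊 → 𝕊) (z : 𝕊) : Prop :=
  ∃ n : ℕ, 0 < n ∧ f^[n] z = z ∧ ∃ k : ℕ, 0 < k ∧ S.multiplier f n z ^ k = 1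

/-- `x` returns to `U` under iteration of `f`. -/
def Returns {α : Type*} (f : α → α) (U : Set α) (x : α) : Prop :=
  ∃ k, 1 ≤ k ∧ f^[k] x ∈ U

/-- The first return time to `U` (junk value `0` if the point never returns). -/
def returnTime {α : Type*} (f : α → α) (U : Set α) (x : α) : ℕ :=
  sInf {k | 1 ≤ k ∧ f^[k] x ∈ U}

/-- The first return map to `U` (the identity where undefined). -/
def firstReturn {α : Type*} (f : α → α) (U : Set α) (x : α) : α :=
  f^[returnTime f U x] x

/-- The domain of the first return map. -/
def returnDom {α : Type*} (f : α → α) (U : Set α) : Set α :=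
  {x ∈ U | Returns f U x}

/-- `Λ_U = ⋂_{k ≥ 0} φ_U^{-k}(U)`: points all of whose iterates under the first return
map are defined (and in `U`). -/
def LambdaSet {α : Type*} (f : α → α) (U : Set α) : Set α :=
  {x | ∀ k : ℕ, (firstReturn f U)^[k] x ∈ returnDom f U}

/-- `φ_U^{-k}(A)`, taking definedness of the first return map into account. -/
def phiPreimage {α : Type*} (f : α → α) (U : Set α) (k : ℕ) (A : Set α) : Set α :=
  {x | (∀ i < k, (firstReturn f U)^[i] x ∈ returnDom f U) ∧ (firstReturn f U)^[k] x ∈ A}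

/-- Euclidean distance from a point of the sphere to a subset of `ℂ` (`∞` at `infty`). -/
def SphereModel.eDistToSet {𝕊 : Type} [MetricSpace 𝕊] [CompactSpace 𝕊]
    (S : SphereModel 𝕊) (y : 𝕊) (B : Set ℂ) : ℝ≥0∞ :=
  if y = S.infty then ⊤ else ENNReal.ofReal (Metric.infDist (S.toC y) B)

/-- Euclidean distance `dist (f z, a)` (junk value `1` at poles, where the true distance
is infinite; note `log (1/1) = 0 = log⁺ (1/∞)`). -/
def SphereModel.fDist {𝕊 : Type} [MetricSpace 𝕊] [CompactSpace 𝕊] (S : SphereModel 𝕊)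
    (f : 𝕊 → 𝕊) (a : ℂ) (z : ℂ) : ℝ :=
  if f (S.ι z) = S.infty then 1 else dist (S.toC (f (S.ι z))) a

/-- Euclidean distance `dist (f z, A)` to a set (junk value `1` at poles). -/
def SphereModel.fDistSet {𝕊 : Type} [MetricSpace 𝕊] [CompactSpace 𝕊] (S : SphereModel 𝕊)
    (f : 𝕊 → 𝕊) (A : Set ℂ) (z : ℂ) : ℝ :=
  if f (S.ι z) = S.infty then 1 else Metric.infDist (S.toC (f (S.ι z))) A

/-- A subset of the sphere which is a bounded subset of `ℂ`. -/
def SphereModel.BoundedInC {𝕊 : Type} [MetricSpace 𝕊] [CompactSpace 𝕊]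
    (S : SphereModel 𝕊) (U : Set 𝕊) : Prop :=
  ∃ B : Set ℂ, Bornology.IsBounded B ∧ U = S.ι '' B

end

namespace NiceSet

lemma chain_mid {α : Type*} {E : α → α → Prop} {l l₂ : List α} (h : List.IsChain E l) (hl : l₂ <:+: l) :
    List.IsChain E l₂ := by
  obtain ⟨s, t, rfl⟩ := hl
  exact h.left_of_append.right_of_append

/-! ### Combinatorics of closed lattice walks -/

/-- product of an edge function along a list of vertices -/
def wprod {V Γ : Type*} [Group Γ] (e : V → V → Γ) : List V → Γ
  | [] => 1
  | [_] => 1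
  | u :: v :: t => e u v * wprod e (v :: t)

theorem wprod_append {V Γ : Type*} [Group Γ] (e : V → V → Γ) (l : List V) (v : V) (r : List V) :
    wprod e (l ++ v :: r) = wprod e (l ++ [v]) * wprod e (v :: r) := by
  induction l with
  | nil => simp [wprod]
  | cons a l ih =>
    cases l with
    | nil => simp [wprod]
    | cons b l => simp only [List.cons_append, wprod] at *; rw [ih, mul_assoc]

/-- sum mod 2 of an edge function along a list -/
def wsum {V : Type*} (e : V → V → ZMod 2) : List V → ZMod 2
  | [] => 0
  | [_] => 0
  | u :: v :: t => e u v + wsum e (v :: t)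

theorem wsum_append {V : Type*} (e : V → V → ZMod 2) (l : List V) (v : V) (r : List V) :
    wsum e (l ++ v :: r) = wsum e (l ++ [v]) + wsum e (v :: r) := by
  induction l with
  | nil => simp [wsum]
  | cons a l ih =>
    cases l with
    | nil => simp [wsum]
    | cons b l => simp only [List.cons_append, wsum] at *; rw [ih, add_assoc]

/-- lattice adjacency -/
def LAdj (u v : ℕ × ℕ) : Prop :=
  (u.1 = v.1 ∧ (u.2 + 1 = v.2 ∨ v.2 + 1 = u.2)) ∨ (u.2 = v.2 ∧ (u.1 + 1 = v.1 ∨ v.1 + 1 = u.1))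

/-- crossing number of an edge with the upward ray from the centre of a square -/
def xing (s : ℕ × ℕ) (u v : ℕ × ℕ) : ZMod 2 :=
  if u.2 = v.2 ∧ s.2 < u.2 ∧ ((u.1 = s.1 ∧ v.1 = s.1 + 1) ∨ (v.1 = s.1 ∧ u.1 = s.1 + 1)) then 1
  else 0

/-- weight of a vertex -/
def lwt (v : ℕ × ℕ) : ℕ := v.1 + v.2 + 1

theorem lwt_pos (v : ℕ × ℕ) : 0 < lwt v := by simp [lwt]

theorem wsum_eq_zero {V : Type*} (e : V → V → ZMod 2) (l : List V)
    (h : ∀ u ∈ l, ∀ v ∈ l, e u v = 0) : wsum e l = 0 := by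
  induction l with
  | nil => rfl
  | cons a l ih =>
    cases l with
    | nil => rfl
    | cons b l =>
      simp only [wsum]
      rw [h a (by simp) b (by simp), ih (fun u hu v hv => h u (by simp [hu]) v (by simp [hv]))]
      simp

theorem exists_max_split {V : Type*} (m : V → ℕ) (l : List V) (hl : l ≠ []) :
    ∃ l₁ v l₂, l = l₁ ++ v :: l₂ ∧ ∀ u ∈ l, m u ≤ m v := by
  obtain ⟨v, hv, hmax⟩ : ∃ v ∈ l, ∀ u ∈ l, m u ≤ m v := by
    classical
    obtain ⟨v, hv, h⟩ := Finset.exists_max_image l.toFinset m (by simpa using hl)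
    exact ⟨v, by simpa using hv, fun u hu => h u (by simpa using hu)⟩
  obtain ⟨a, b, rfl⟩ := List.append_of_mem hv
  exact ⟨a, v, b, rfl, hmax⟩

theorem comb_trivial {Γ : Type*} [Group Γ] (e : ℕ × ℕ → ℕ × ℕ → Γ)
    (E : ℕ × ℕ → ℕ × ℕ → Prop) (F : ℕ × ℕ → Prop)
    (hadj : ∀ u v, E u v → LAdj u v)
    (hinv : ∀ u v, E u v → E v u → e u v * e v u = 1)
    (hF : ∀ i j, F (i, j) →
      (E (i, j + 1) (i, j) ∧ E (i, j) (i + 1, j) ∧ E (i + 1, j) (i, j) ∧ E (i, j) (i, j + 1)) ∧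
      e (i, j + 1) (i + 1, j + 1) * e (i + 1, j + 1) (i + 1, j)
        = e (i, j + 1) (i, j) * e (i, j) (i + 1, j) ∧
      e (i + 1, j) (i + 1, j + 1) * e (i + 1, j + 1) (i, j + 1)
        = e (i + 1, j) (i, j) * e (i, j) (i, j + 1))
    (hW : ∀ (c : ℕ × ℕ) (t : List (ℕ × ℕ)), List.IsChain E (c :: (t ++ [c])) →
      ∀ s, wsum (xing s) (c :: (t ++ [c])) ≠ 0 → F s) :
    ∀ (n : ℕ) (c : ℕ × ℕ) (t : List (ℕ × ℕ)), List.IsChain E (c :: (t ++ [c])) →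
      ((c :: t).map lwt).sum = n → wprod e (c :: (t ++ [c])) = 1 := by
  intro n
  induction n using Nat.strong_induction_on with
  | _ n IH =>
  -- main step when base point is a maximum
  have main : ∀ (c : ℕ × ℕ) (t : List (ℕ × ℕ)), List.IsChain E (c :: (t ++ [c])) →
      ((c :: t).map lwt).sum = n →
      (∀ u ∈ t, u.1 + u.2 ≤ c.1 + c.2) → wprod e (c :: (t ++ [c])) = 1 := by
    intro c t hch hn hmax
    by_cases hct : c ∈ t
    · obtain ⟨t₁, t₂, rfl⟩ := List.append_of_mem hct
      have e1 : c :: (t₁ ++ c :: t₂ ++ [c]) = (c :: t₁) ++ c :: (t₂ ++ [c]) := by simp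
      rw [e1] at hch ⊢
      have h1 : List.IsChain E (c :: (t₁ ++ [c])) := by
        apply chain_mid hch
        exact ⟨[], t₂ ++ [c], by simp⟩
      have h2 : List.IsChain E (c :: (t₂ ++ [c])) := by
        apply chain_mid hch
        exact ⟨c :: t₁, [], by simp⟩
      rw [wprod_append]
      simp only [List.map_cons, List.map_append, List.sum_cons, List.sum_append] at hn
      have := IH _ (by simp [-List.sum_map_add]; have := lwt_pos c; omega) c t₁ h1 rfl
      rw [List.cons_append, this, IH _ (by simp [-List.sum_map_add]; have := lwt_pos c; omega) c t₂ h2 rfl, one_mul]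
    -- t is nonempty
    rcases t.eq_nil_or_concat with rfl | ⟨t', b, rfl⟩
    · have := hadj c c (by simpa using hch)
      exfalso; unfold LAdj at this; omega
    cases t' with
    | nil =>
      have h1 : E c b ∧ E b c := by simpa using hch
      simpa [wprod] using hinv c b h1.1 h1.2
    | cons a t' =>
      have hca : E c a := by simp at hch; exact hch.1
      have hbc : E b c := by
        have : List.IsChain E [b, c] := chain_mid hch ⟨c :: a :: t', [], by simp⟩
        simpa using this
      have hin : List.IsChain E (a :: (t' ++ [b])) := chain_mid hch ⟨[c], [c], by simp⟩
      have hma : a.1 + a.2 ≤ c.1 + c.2 := hmax a (by simp)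
      have hmb : b.1 + b.2 ≤ c.1 + c.2 := hmax b (by simp)
      have la := hadj _ _ hca
      have lb := hadj _ _ hbc
      have hP : wprod e (c :: (((a :: t').concat b) ++ [c])) =
          e c a * wprod e (a :: (t' ++ [b])) * e b c := by
        have : c :: (((a :: t').concat b) ++ [c]) = (c :: a :: t') ++ b :: [c] := by simp
        rw [this, wprod_append]
        simp [wprod, mul_assoc]
      rw [hP]
      simp only [List.concat_eq_append, List.map_cons, List.map_append, List.sum_cons, List.sum_append, List.cons_append, List.map_nil, List.sum_nil] at hn
      by_cases hab : a = b
      · subst hab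
        have h1 := IH _ (by simp [-List.sum_map_add]; have := lwt_pos c; omega) a t' hin rfl
        rw [h1, mul_one]
        exact hinv _ _ hca hbc
      -- winding of the corner square
      have key : ∀ s : ℕ × ℕ, c = (s.1 + 1, s.2 + 1) → F s := by
        intro s hs
        apply hW c _ hch
        have hrest : wsum (xing s) (a :: (t' ++ [b])) = 0 := by
          apply wsum_eq_zero
          intro u hu v hv
          have hu' : u ∈ (a :: t').concat b := by simpa using hu
          have hv' : v ∈ (a :: t').concat b := by simpa using hv
          have h1 := hmax u hu'
          have h2 := hmax v hv'
          have n1 : u ≠ c := fun h => hct (h ▸ hu')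
          have n2 : v ≠ c := fun h => hct (h ▸ hv')
          unfold xing
          rw [if_neg]
          rintro ⟨h3, h4, h5⟩
          rw [hs] at h1 h2 n1 n2
          simp only [ne_eq, Prod.ext_iff] at n1 n2 h1 h2
          omega
        have : c :: (((a :: t').concat b) ++ [c]) = (c :: a :: t') ++ b :: [c] := by simp
        rw [this, wsum_append]
        simp only [List.cons_append, wsum, hrest]
        have hab' : ¬ (a.1 = b.1 ∧ a.2 = b.2) := fun h => hab (Prod.ext h.1 h.2)
        unfold LAdj at la lb
        rw [hs] at la lb hma hmb
        simp only at la lb hma hmb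
        unfold xing
        rw [hs]
        by_cases hy : a.2 = s.2 + 1
        · have k1 : ((s.1 + 1, s.2 + 1) : ℕ × ℕ).2 = a.2 ∧ s.2 < ((s.1 + 1, s.2 + 1) : ℕ × ℕ).2 ∧ ((((s.1 + 1, s.2 + 1) : ℕ × ℕ).1 = s.1 ∧ a.1 = s.1 + 1) ∨ (a.1 = s.1 ∧ ((s.1 + 1, s.2 + 1) : ℕ × ℕ).1 = s.1 + 1)) := by dsimp only; omega
          have k2 : ¬ (b.2 = ((s.1 + 1, s.2 + 1) : ℕ × ℕ).2 ∧ s.2 < b.2 ∧ ((b.1 = s.1 ∧ ((s.1 + 1, s.2 + 1) : ℕ × ℕ).1 = s.1 + 1) ∨ (((s.1 + 1, s.2 + 1) : ℕ × ℕ).1 = s.1 ∧ b.1 = s.1 + 1))) := by dsimp only; omega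
          rw [if_pos k1, if_neg k2]; simp
        · have k1 : ¬ (((s.1 + 1, s.2 + 1) : ℕ × ℕ).2 = a.2 ∧ s.2 < ((s.1 + 1, s.2 + 1) : ℕ × ℕ).2 ∧ ((((s.1 + 1, s.2 + 1) : ℕ × ℕ).1 = s.1 ∧ a.1 = s.1 + 1) ∨ (a.1 = s.1 ∧ ((s.1 + 1, s.2 + 1) : ℕ × ℕ).1 = s.1 + 1))) := by dsimp only; omega
          have k2 : (b.2 = ((s.1 + 1, s.2 + 1) : ℕ × ℕ).2 ∧ s.2 < b.2 ∧ ((b.1 = s.1 ∧ ((s.1 + 1, s.2 + 1) : ℕ × ℕ).1 = s.1 + 1) ∨ (((s.1 + 1, s.2 + 1) : ℕ × ℕ).1 = s.1 ∧ b.1 = s.1 + 1))) := by dsimp only; omega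
          rw [if_neg k1, if_pos k2]; simp
      have hab' : ¬ (a.1 = b.1 ∧ a.2 = b.2) := fun h => hab (Prod.ext h.1 h.2)
      unfold LAdj at la lb
      obtain ⟨i, j, hcij⟩ : ∃ i j, c = (i + 1, j + 1) :=
        ⟨c.1 - 1, c.2 - 1, by ext <;> simp only <;> omega⟩
      have hFs := key (i, j) hcij
      obtain ⟨⟨E1, E2, E3, E4⟩, Q1, Q2⟩ := hF i j hFs
      subst hcij
      simp only at la lb hma hmb hn
      -- new walk
      have step : ∀ a b : ℕ × ℕ, List.IsChain E (a :: (t' ++ [b])) → E (i, j) a → E b (i, j) →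
          lwt a + ((List.map lwt t').sum + lwt b) + lwt (i + 1, j + 1) = n →
          e (i, j) a * wprod e (a :: (t' ++ [b])) * e b (i, j) = 1 := by
        intro a b h1 h2 h3 h4
        have h5 := IH (((i, j) :: (a :: (t' ++ [b]))).map lwt).sum (by simp [lwt] at h4 ⊢; omega) (i, j) (a :: (t' ++ [b])) (by
          have : (i, j) :: (a :: (t' ++ [b]) ++ [(i, j)]) = [(i, j)] ++ (a :: (t' ++ [b])) ++ [(i, j)] := by simp
          rw [this]
          rw [List.isChain_append, List.isChain_append]
          refine ⟨⟨by simp, h1, by simpa using h2⟩, by simp, ?_⟩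
          intro x hx y hy
          have : x = b := by
            have h : (([(i, j)] ++ a :: (t' ++ [b])) : List (ℕ × ℕ)) = ((i, j) :: a :: t') ++ [b] := by simp
            rw [h, List.getLast?_append] at hx
            simpa using hx.symm
          simp at hy
          rw [this, ← hy]; exact h3) rfl
        have : (i, j) :: (a :: (t' ++ [b]) ++ [(i, j)]) = ((i, j) :: a :: t') ++ b :: [(i, j)] := by simp
        rw [this, wprod_append] at h5
        simpa [wprod, mul_assoc] using h5
      have cyc : ∀ p q X r s : Γ, r * p = s * q → q * X * s = 1 → p * X * r = 1 := by
        intro p q X r s h1 h2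
        have h3 : X = q⁻¹ * s⁻¹ := by
          have : q⁻¹ * (q * X * s) * s⁻¹ = q⁻¹ * s⁻¹ := by rw [h2]; simp
          rw [← this]; group
        have h4 : p = r⁻¹ * (s * q) := by rw [← h1]; group
        rw [h3, h4]; group
      by_cases hy : a.2 = j + 1
      · have ha : a = (i, j + 1) := by ext <;> simp only <;> omega
        have hb : b = (i + 1, j) := by ext <;> simp only <;> omega
        subst ha; subst hb
        exact cyc _ _ _ _ _ Q2 (step _ _ hin E4 E3 (by omega))
      · have ha : a = (i + 1, j) := by ext <;> simp only <;> omega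
        have hb : b = (i, j + 1) := by ext <;> simp only <;> omega
        subst ha; subst hb
        exact cyc _ _ _ _ _ Q1 (step _ _ hin E2 E1 (by omega))
  intro c t hch hn
  obtain ⟨l₁, v, l₂, hl, hmax⟩ := exists_max_split (fun v : ℕ × ℕ => v.1 + v.2) (c :: t) (by simp)
  cases l₁ with
  | nil =>
    simp at hl
    obtain ⟨rfl, rfl⟩ := hl
    exact main c t hch hn (fun u hu => hmax u (by simp [hu]))
  | cons c' l₁ =>
    simp only [List.cons_append, List.cons.injEq] at hl
    obtain ⟨rfl, rfl⟩ := hl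
    have h1 : c :: (l₁ ++ v :: l₂ ++ [c]) = (c :: l₁) ++ v :: (l₂ ++ [c]) := by simp
    have h2 : v :: ((l₂ ++ c :: l₁) ++ [v]) = (v :: l₂) ++ c :: (l₁ ++ [v]) := by simp
    have h3 : List.IsChain E (v :: ((l₂ ++ c :: l₁) ++ [v])) := by
      rw [h1, List.isChain_split] at hch
      rw [h2, List.isChain_split]
      exact ⟨hch.2, hch.1⟩
    have h4 := main v (l₂ ++ c :: l₁) h3 (by simp at hn ⊢; omega) (by
      intro u hu; apply hmax; simp at hu ⊢; tauto)
    rw [h2, wprod_append] at h4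
    rw [h1, wprod_append]
    exact mul_eq_one_comm.mp h4

end NiceSet

namespace NiceSet

/-! ### The geometric part of the lattice argument -/

/-- crossing number with integer squares -/
def xingZ (i j : ℤ) (u v : ℕ × ℕ) : ZMod 2 :=
  if (u.2 : ℤ) = v.2 ∧ j < u.2 ∧ (((u.1 : ℤ) = i ∧ (v.1 : ℤ) = i + 1) ∨
    ((v.1 : ℤ) = i ∧ (u.1 : ℤ) = i + 1)) then 1 else 0

theorem xing_eq (s u v : ℕ × ℕ) : xing s u v = xingZ s.1 s.2 u v := by
  unfold xing xingZ
  congr 1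
  apply propext
  omega

theorem wsum_congr {V : Type*} {R : V → V → Prop} (e₁ e₂ : V → V → ZMod 2)
    (h : ∀ u v, R u v → e₁ u v = e₂ u v) (l : List V) (hl : List.IsChain R l) :
    wsum e₁ l = wsum e₂ l := by
  induction l with
  | nil => rfl
  | cons a l ih =>
    cases l with
    | nil => rfl
    | cons b l =>
      simp only [wsum]
      rw [List.isChain_cons_cons] at hl
      rw [h _ _ hl.1, ih hl.2]

theorem wsum_add {V : Type*} (e₁ e₂ : V → V → ZMod 2) (l : List V) :
    wsum (fun u v => e₁ u v + e₂ u v) l = wsum e₁ l + wsum e₂ l := by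
  induction l with
  | nil => simp [wsum]
  | cons a l ih =>
    cases l with
    | nil => simp [wsum]
    | cons b l => simp only [wsum]; rw [ih]; ring

theorem wsum_coboundary {V : Type*} (φ : V → ZMod 2) (c : V) (l : List V) (d : V) :
    wsum (fun u v => φ u + φ v) (c :: (l ++ [d])) = φ c + φ d := by
  induction l generalizing c with
  | nil => simp [wsum]
  | cons a l ih =>
    simp only [wsum, List.cons_append]
    have := ih a
    rw [this]
    have h2 : φ a + φ a = 0 := CharTwo.add_self_eq_zero _
    linear_combination h2

/-- lattice point -/
noncomputable def lpt (v : ℕ × ℕ) : ℂ := ⟨v.1, v.2⟩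

/-- closed unit square -/
def lsq (i j : ℤ) : Set ℂ := Icc (i : ℝ) (i + 1) ×ℂ Icc (j : ℝ) (j + 1)

theorem mem_lsq {i j : ℤ} {p : ℂ} : p ∈ lsq i j ↔
    ((i : ℝ) ≤ p.re ∧ p.re ≤ i + 1) ∧ ((j : ℝ) ≤ p.im ∧ p.im ≤ j + 1) := by
  simp [lsq, Complex.mem_reProdIm]

theorem isClosed_lsq (i j : ℤ) : IsClosed (lsq i j) := isClosed_Icc.reProdIm isClosed_Icc

theorem convex_lsq (i j : ℤ) : Convex ℝ (lsq i j) := by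
  intro x hx y hy a b ha hb hab
  rw [mem_lsq] at *
  simp only [Complex.add_re, Complex.real_smul, Complex.re_ofReal_mul, Complex.add_im,
    Complex.im_ofReal_mul]
  obtain rfl : b = 1 - a := by linarith
  refine ⟨⟨?_, ?_⟩, ?_, ?_⟩ <;> nlinarith

theorem isBounded_lsq (i j : ℤ) : Bornology.IsBounded (lsq i j) :=
  (Metric.isBounded_Icc _ _).reProdIm (Metric.isBounded_Icc _ _)

theorem mem_hseg {i j : ℕ} {p : ℂ} (h1 : (i : ℝ) ≤ p.re) (h2 : p.re ≤ i + 1) (h3 : p.im = j) :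
    p ∈ segment ℝ (lpt (i, j)) (lpt (i + 1, j)) := by
  rw [segment_eq_image_lineMap]
  refine ⟨p.re - i, ⟨by linarith, by linarith⟩, ?_⟩
  apply Complex.ext
  · simp [AffineMap.lineMap_apply, lpt]
  · simp [AffineMap.lineMap_apply, lpt, h3]

theorem mem_vseg {i j : ℕ} {p : ℂ} (h1 : (j : ℝ) ≤ p.im) (h2 : p.im ≤ j + 1) (h3 : p.re = i) :
    p ∈ segment ℝ (lpt (i, j)) (lpt (i, j + 1)) := by
  rw [segment_eq_image_lineMap]
  refine ⟨p.im - j, ⟨by linarith, by linarith⟩, ?_⟩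
  apply Complex.ext
  · simp [AffineMap.lineMap_apply, lpt, h3]
  · simp [AffineMap.lineMap_apply, lpt]

theorem xingZ_vert {i j : ℤ} {p : ℂ} (h1 : p ∈ lsq i j) (h2 : p ∈ lsq i (j + 1)) (u v : ℕ × ℕ)
    (hp : p ∉ segment ℝ (lpt u) (lpt v)) : xingZ i j u v = xingZ i (j + 1) u v := by
  rw [mem_lsq] at h1 h2
  have him : p.im = ((j + 1 : ℤ) : ℝ) := by push_cast at *; linarith [h1.2.2, h2.2.1]
  by_cases hc : (u.2 : ℤ) = j + 1 ∧ (u.2 : ℤ) = v.2 ∧ (((u.1 : ℤ) = i ∧ (v.1 : ℤ) = i + 1) ∨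
    ((v.1 : ℤ) = i ∧ (u.1 : ℤ) = i + 1))
  · exfalso; apply hp
    obtain ⟨u1, u2⟩ := u
    obtain ⟨v1, v2⟩ := v
    simp only at hc
    rcases hc.2.2 with h | h
    · have e1 : v1 = u1 + 1 := by omega
      have e2 : v2 = u2 := by omega
      subst e1; subst e2
      apply mem_hseg
      · have := h1.1.1; rw [← h.1] at this; exact_mod_cast this
      · have := h1.1.2; rw [← h.1] at this; exact_mod_cast this
      · rw [him, ← hc.1]; rfl
    · have e1 : u1 = v1 + 1 := by omega
      have e2 : v2 = u2 := by omega
      subst e1; subst e2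
      rw [segment_symm]
      apply mem_hseg
      · have := h1.1.1; rw [← h.1] at this; exact_mod_cast this
      · have := h1.1.2; rw [← h.1] at this; exact_mod_cast this
      · rw [him, ← hc.1]; rfl
  · unfold xingZ
    congr 1
    apply propext
    omega

theorem xingZ_horiz {i j : ℤ} {p : ℂ} (h1 : p ∈ lsq i j) (h2 : p ∈ lsq (i + 1) j) (u v : ℕ × ℕ)
    (hadj : LAdj u v) (hp : p ∉ segment ℝ (lpt u) (lpt v)) :
    xingZ i j u v + xingZ (i + 1) j u v =
      (if (u.1 : ℤ) = i + 1 ∧ j < u.2 then 1 else 0) +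
        (if (v.1 : ℤ) = i + 1 ∧ j < v.2 then 1 else 0) := by
  rw [mem_lsq] at h1 h2
  have hre : p.re = ((i + 1 : ℤ) : ℝ) := by push_cast at *; linarith [h1.1.2, h2.1.1]
  by_cases hc : (u.1 : ℤ) = i + 1 ∧ (u.1 : ℤ) = v.1 ∧ (((u.2 : ℤ) = j ∧ (v.2 : ℤ) = j + 1) ∨
    ((v.2 : ℤ) = j ∧ (u.2 : ℤ) = j + 1))
  · exfalso; apply hp
    obtain ⟨u1, u2⟩ := u
    obtain ⟨v1, v2⟩ := v
    simp only at hc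
    rcases hc.2.2 with h | h
    · have e1 : v2 = u2 + 1 := by omega
      have e2 : v1 = u1 := by omega
      subst e1; subst e2
      apply mem_vseg
      · have := h1.2.1; rw [← h.1] at this; exact_mod_cast this
      · have := h1.2.2; rw [← h.1] at this; exact_mod_cast this
      · rw [hre, ← hc.1]; rfl
    · have e1 : u2 = v2 + 1 := by omega
      have e2 : v1 = u1 := by omega
      subst e1; subst e2
      rw [segment_symm]
      apply mem_vseg
      · have := h1.2.1; rw [← h.1] at this; exact_mod_cast this
      · have := h1.2.2; rw [← h.1] at this; exact_mod_cast this
      · rw [hre, ← hc.1]; rfl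
  · unfold xingZ
    unfold LAdj at hadj
    have h11 : (1 : ZMod 2) + 1 = 0 := CharTwo.add_self_eq_zero _
    split_ifs <;> first | (exfalso; omega) | exact h11.symm | (simp; done) | (simp [h11]; done)

theorem winding_geom (U : Set ℂ)
    (hH : ∀ O : Set ℂ, IsOpen O → Bornology.IsBounded O → frontier O ⊆ U → O ⊆ U)
    (c : ℕ × ℕ) (t : List (ℕ × ℕ))
    (hch : List.IsChain (fun u v => LAdj u v ∧ segment ℝ (lpt u) (lpt v) ⊆ U) (c :: (t ++ [c])))
    (s : ℕ × ℕ) (hs : wsum (xing s) (c :: (t ++ [c])) ≠ 0) : lsq s.1 s.2 ⊆ U := by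
  set l := c :: (t ++ [c]) with hl
  set w : ℤ → ℤ → ZMod 2 := fun i j => wsum (xingZ i j) l with hw
  -- adjacent squares
  have hconst : ∀ p ∉ U, ∀ i j i' j', p ∈ lsq i j → p ∈ lsq i' j' → w i j = w i' j' := by
    intro p hp
    have hch' : List.IsChain (fun u v => LAdj u v ∧ p ∉ segment ℝ (lpt u) (lpt v)) l :=
      hch.imp (fun u v h => ⟨h.1, fun h' => hp (h.2 h')⟩)
    have hv : ∀ i j, p ∈ lsq i j → p ∈ lsq i (j + 1) → w i j = w i (j + 1) := by
      intro i j h1 h2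
      exact wsum_congr _ _ (fun u v h => xingZ_vert h1 h2 u v h.2) l hch'
    have hh : ∀ i j, p ∈ lsq i j → p ∈ lsq (i + 1) j → w i j = w (i + 1) j := by
      intro i j h1 h2
      have h3 := wsum_congr _ _ (fun u v h => xingZ_horiz h1 h2 u v h.1 h.2) l hch'
      rw [wsum_add (xingZ i j) (xingZ (i + 1) j)] at h3
      rw [hl, wsum_coboundary (fun u : ℕ × ℕ => if (u.1 : ℤ) = i + 1 ∧ j < u.2 then (1 : ZMod 2) else 0),
        CharTwo.add_self_eq_zero, ← hl] at h3
      exact CharTwo.add_eq_zero.mp h3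
    have hv' : ∀ i j j', p ∈ lsq i j → p ∈ lsq i j' → w i j = w i j' := by
      intro i j j' h1 h2
      have h1' := mem_lsq.mp h1
      have h2' := mem_lsq.mp h2
      have k1 : (j : ℝ) ≤ ((j' + 1 : ℤ) : ℝ) := by push_cast; linarith [h1'.2.1, h2'.2.2]
      have k2 : (j' : ℝ) ≤ ((j + 1 : ℤ) : ℝ) := by push_cast; linarith [h2'.2.1, h1'.2.2]
      have k1 : j ≤ j' + 1 := by exact_mod_cast k1
      have k2 : j' ≤ j + 1 := by exact_mod_cast k2
      have : j' = j ∨ j' = j + 1 ∨ j = j' + 1 := by omega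
      rcases this with h | h | h
      · rw [h]
      · subst h; exact hv _ _ h1 h2
      · subst h; exact (hv _ _ h2 h1).symm
    have hh' : ∀ i i' j, p ∈ lsq i j → p ∈ lsq i' j → w i j = w i' j := by
      intro j j' i h1 h2
      have h1' := mem_lsq.mp h1
      have h2' := mem_lsq.mp h2
      have k1 : (j : ℝ) ≤ ((j' + 1 : ℤ) : ℝ) := by push_cast; linarith [h1'.1.1, h2'.1.2]
      have k2 : (j' : ℝ) ≤ ((j + 1 : ℤ) : ℝ) := by push_cast; linarith [h2'.1.1, h1'.1.2]
      have k1 : j ≤ j' + 1 := by exact_mod_cast k1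
      have k2 : j' ≤ j + 1 := by exact_mod_cast k2
      have : j' = j ∨ j' = j + 1 ∨ j = j' + 1 := by omega
      rcases this with h | h | h
      · rw [h]
      · subst h; exact hh _ _ h1 h2
      · subst h; exact (hh _ _ h2 h1).symm
    intro i j i' j' h1 h2
    have h3 : p ∈ lsq i j' := mem_lsq.mpr ⟨(mem_lsq.mp h1).1, (mem_lsq.mp h2).2⟩
    exact (hv' i j j' h1 h3).trans (hh' i i' j' h3 h2)
  -- finiteness
  have hfin : {q : ℤ × ℤ | w q.1 q.2 ≠ 0}.Finite := by
    obtain ⟨N, hN⟩ : ∃ N : ℕ, ∀ u ∈ l, u.1 < N ∧ u.2 < N := by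
      refine ⟨(l.map (fun u => u.1 + u.2)).sum + 1, fun u hu => ?_⟩
      have : u.1 + u.2 ≤ (l.map (fun u => u.1 + u.2)).sum :=
        List.single_le_sum (by simp) _ (List.mem_map.mpr ⟨u, hu, rfl⟩)
      omega
    obtain ⟨l', hl'⟩ : ∃ l', l' = l := ⟨l, rfl⟩
    have hbig : ∀ i j : ℤ, w i j ≠ 0 → -1 ≤ i ∧ i ≤ N ∧ j ≤ N := by
      intro i j hne
      by_contra hcon
      apply hne
      apply wsum_eq_zero
      intro u hu v hv
      have := hN u hu; have := hN v hv
      unfold xingZ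
      rw [if_neg]
      omega
    have hlow : ∀ i j : ℤ, j < -1 → w i j = w i (-1) := by
      intro i j hj
      apply wsum_congr (R := fun _ _ => True) _ _ _ _ (by
        exact hch.imp (fun _ _ _ => trivial))
      intro u v _
      unfold xingZ
      congr 1
      apply propext; omega
    -- below the walk the winding vanishes
    have hzero : ∀ i j : ℤ, j < 0 → w i j = 0 := by
      intro i j hj
      by_contra hne
      have hstep : ∀ i : ℤ, w i j = w (i + 1) j := by
        intro i
        have h3 : wsum (fun u v => xingZ i j u v + xingZ (i + 1) j u v) l = wsum (fun u v =>
          (if (u.1 : ℤ) = i + 1 ∧ j < u.2 then 1 else 0) +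
          (if (v.1 : ℤ) = i + 1 ∧ j < v.2 then 1 else 0)) l := by
          apply wsum_congr _ _ _ _ hch
          intro u v h
          have hadj := h.1
          unfold xingZ
          unfold LAdj at hadj
          have h11 : (1 : ZMod 2) + 1 = 0 := CharTwo.add_self_eq_zero _
          split_ifs <;> first | (exfalso; omega) | exact h11.symm | (simp; done) | (simp [h11]; done)
        rw [wsum_add (xingZ i j) (xingZ (i + 1) j)] at h3
        rw [hl, wsum_coboundary (fun u : ℕ × ℕ => if (u.1 : ℤ) = i + 1 ∧ j < u.2 then (1 : ZMod 2) else 0),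
          CharTwo.add_self_eq_zero, ← hl] at h3
        exact CharTwo.add_eq_zero.mp h3
      have hall : ∀ n : ℕ, w (i + n) j = w i j := by
        intro n
        induction n with
        | zero => simp
        | succ n ih => rw [← ih, hstep (i + n)]; congr 1; push_cast; ring
      have h1 := hbig i j hne
      have h2 := hbig (i + (N + 5 : ℕ)) j (by rw [hall]; exact hne)
      push_cast at h2
      omega
    apply (((Set.finite_Icc (-1 : ℤ) N).prod (Set.finite_Icc (0 : ℤ) N))).subset
    rintro ⟨i, j⟩ hq
    have h1 := hbig i j hq
    have h2 : ¬ j < 0 := fun h => hq (hzero i j h)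
    simp only [mem_prod, mem_Icc]
    omega
  set A : Set ℂ := ⋃ q ∈ {q : ℤ × ℤ | w q.1 q.2 ≠ 0}, lsq q.1 q.2 with hA
  have hAc : IsClosed A := hfin.isClosed_biUnion (fun q _ => isClosed_lsq _ _)
  have hAb : Bornology.IsBounded A := (Bornology.isBounded_biUnion hfin).mpr (fun q _ => isBounded_lsq _ _)
  have hcl : closure (interior A) ⊆ A := hAc.closure_interior_subset
  have hfr : frontier (interior A) ⊆ U := by
    intro p hp
    by_contra hpU
    rw [isOpen_interior.frontier_eq] at hp
    have hpA : p ∈ A := hcl hp.1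
    simp only [hA, mem_iUnion, exists_prop] at hpA
    obtain ⟨q, hq, hpq⟩ := hpA
    apply hp.2
    rw [mem_interior_iff_mem_nhds]
    have hnb : ∀ᶠ y in nhds p, p ∈ lsq ⌊y.re⌋ ⌊y.im⌋ := by
      have key : ∀ x : ℝ, ∀ᶠ y : ℝ in nhds x, (⌊y⌋ : ℝ) ≤ x ∧ x ≤ ⌊y⌋ + 1 := by
        intro x
        have h1 : ∀ᶠ y : ℝ in nhds x, y < ⌊x⌋ + 1 := eventually_lt_nhds (Int.lt_floor_add_one x)
        have h2 : ∀ᶠ y in nhds x, ((⌈x⌉ - 1 : ℤ) : ℝ) < y := by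
          apply eventually_gt_nhds
          push_cast
          linarith [Int.ceil_lt_add_one x]
        filter_upwards [h1, h2] with y hy1 hy2
        constructor
        · have : ⌊y⌋ < ⌊x⌋ + 1 := Int.floor_lt.mpr (by exact_mod_cast hy1)
          have : ⌊y⌋ ≤ ⌊x⌋ := by omega
          exact le_trans (by exact_mod_cast this) (Int.floor_le x)
        · have : ⌈x⌉ - 1 ≤ ⌊y⌋ := Int.le_floor.mpr hy2.le
          have : ⌈x⌉ ≤ ⌊y⌋ + 1 := by omega
          exact le_trans (Int.le_ceil x) (by exact_mod_cast this)
      filter_upwards [Complex.continuous_re.continuousAt.eventually (key p.re),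
        Complex.continuous_im.continuousAt.eventually (key p.im)] with y h1 h2
      exact mem_lsq.mpr ⟨h1, h2⟩
    filter_upwards [hnb] with y hy
    simp only [hA, mem_iUnion, exists_prop]
    refine ⟨(⌊y.re⌋, ⌊y.im⌋), ?_, mem_lsq.mpr ⟨⟨Int.floor_le _, (Int.lt_floor_add_one _).le⟩,
      ⟨Int.floor_le _, (Int.lt_floor_add_one _).le⟩⟩⟩
    simp only [mem_ofPred_eq]
    rw [← hconst p hpU _ _ _ _ hpq hy]
    exact hq
  have hOU : interior A ⊆ U := hH _ isOpen_interior (hAb.subset interior_subset) hfr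
  have hclU : closure (interior A) ⊆ U := by
    rw [closure_eq_self_union_frontier]
    exact union_subset hOU hfr
  refine Subset.trans ?_ hclU
  have hsub : lsq s.1 s.2 ⊆ A := by
    apply subset_biUnion_of_mem (u := fun q : ℤ × ℤ => lsq q.1 q.2)
      (show ((s.1 : ℤ), (s.2 : ℤ)) ∈ {q : ℤ × ℤ | w q.1 q.2 ≠ 0} from ?_)
    simp only [mem_ofPred_eq, hw]
    convert hs using 2
    congr 1
    funext u v
    exact (xing_eq s u v).symm
  have hcl2 : closure (interior (lsq s.1 s.2)) = lsq s.1 s.2 := by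
    unfold lsq
    rw [Complex.interior_reProdIm, Complex.closure_reProdIm]
    simp
  rw [← hcl2]
  exact closure_mono (interior_mono hsub)

end NiceSet

namespace NiceSet

/-! ### Open connected plane sets without holes are simply connected -/

/-- a holonomy functional: flattening of the fundamental groupoid -/
theorem exists_hol (X : Type) [TopologicalSpace X] [PathConnectedSpace X] :
    ∃ (Γ : Type) (_ : Group Γ) (hol : ∀ a b : X, Path a b → Γ),
      (∀ a b c (p : Path a b) (q : Path b c), hol a c (p.trans q) = hol a b p * hol b c q) ∧
      (∀ a b (p q : Path a b), p.Homotopic q → hol a b p = hol a b q) ∧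
      (∀ a (p : Path a a), hol a a p = 1 → p.Homotopic (Path.refl a)) := by
  classical
  obtain ⟨x0⟩ : Nonempty X := inferInstance
  let α : ∀ a : X, Path.Homotopic.Quotient x0 a := fun a => .mk (PathConnectedSpace.somePath x0 a)
  refine ⟨FundamentalGroup X x0, inferInstance, fun a b p =>
    ((α b).trans ((Path.Homotopic.Quotient.mk p).symm.trans (α a).symm) :
      Path.Homotopic.Quotient x0 x0), ?_, ?_, ?_⟩
  · intro a b c p q
    rw [FundamentalGroup.mul_def]
    simp only [Path.Homotopic.Quotient.mk_trans]
    generalize Path.Homotopic.Quotient.mk p = P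
    generalize Path.Homotopic.Quotient.mk q = Q
    have h1 : (P.trans Q).symm = Q.symm.trans P.symm := by
      induction P using Path.Homotopic.Quotient.ind
      induction Q using Path.Homotopic.Quotient.ind
      rw [← Path.Homotopic.Quotient.mk_trans, ← Path.Homotopic.Quotient.mk_symm, Path.trans_symm]
      rfl
    rw [h1]
    simp only [Path.Homotopic.Quotient.trans_assoc]
    congr 2
    rw [← Path.Homotopic.Quotient.trans_assoc (α b).symm, Path.Homotopic.Quotient.symm_trans,
      Path.Homotopic.Quotient.refl_trans]
  · intro a b p q h
    have : Path.Homotopic.Quotient.mk p = .mk q := Path.Homotopic.Quotient.eq.mpr h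
    simp only [this]
  · intro a p h
    rw [FundamentalGroup.one_def] at h
    have h2 : (Path.Homotopic.Quotient.mk p).symm = .refl a := by
      have h3 : (α a).symm.trans (((α a).trans ((Path.Homotopic.Quotient.mk p).symm.trans (α a).symm)).trans (α a)) = (α a).symm.trans ((Path.Homotopic.Quotient.refl x0).trans (α a)) := by
        have h' : (α a).trans ((Path.Homotopic.Quotient.mk p).symm.trans (α a).symm) = .refl x0 := h
        rw [h']
      simp only [Path.Homotopic.Quotient.trans_assoc, Path.Homotopic.Quotient.refl_trans, Path.Homotopic.Quotient.symm_trans, Path.Homotopic.Quotient.trans_refl] at h3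
      rw [← Path.Homotopic.Quotient.trans_assoc, Path.Homotopic.Quotient.symm_trans,
        Path.Homotopic.Quotient.refl_trans] at h3
      exact h3
    rw [← Path.Homotopic.Quotient.mk_symm, ← Path.Homotopic.Quotient.mk_refl,
      Path.Homotopic.Quotient.eq] at h2
    simpa using h2.symm₂

theorem homotopic_of_convex {U A : Set ℂ} (hA : Convex ℝ A) (hAU : A ⊆ U) {a b : U}
    (p q : Path a b) (hp : ∀ t, (p t : ℂ) ∈ A) (hq : ∀ t, (q t : ℂ) ∈ A) : p.Homotopic q := by
  have : Nonempty A := ⟨⟨_, hp 0⟩⟩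
  have hne : A.Nonempty := ⟨_, hp 0⟩
  have : ContractibleSpace A := hA.contractibleSpace hne
  have ha : (a : ℂ) ∈ A := by simpa using hp 0
  have hb : (b : ℂ) ∈ A := by simpa using hp 1
  let p' : Path (⟨a, ha⟩ : A) ⟨b, hb⟩ :=
    { toFun := fun t => ⟨p t, hp t⟩
      continuous_toFun := by fun_prop
      source' := by simp
      target' := by simp }
  let q' : Path (⟨a, ha⟩ : A) ⟨b, hb⟩ :=
    { toFun := fun t => ⟨q t, hq t⟩
      continuous_toFun := by fun_prop
      source' := by simp
      target' := by simp }
  have h := SimplyConnectedSpace.paths_homotopic p' q'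
  have h2 := h.map ⟨Set.inclusion hAU, continuous_inclusion hAU⟩
  exact h2

/-- straight segment as a path in a subset -/
noncomputable def segPath {U : Set ℂ} {a b : ℂ} (h : segment ℝ a b ⊆ U) :
    Path (⟨a, h (left_mem_segment ℝ a b)⟩ : U) ⟨b, h (right_mem_segment ℝ a b)⟩ where
  toFun t := ⟨AffineMap.lineMap a b (t : ℝ), h (by
    rw [segment_eq_image_lineMap]; exact ⟨t, t.2, rfl⟩)⟩
  continuous_toFun := by
    apply Continuous.subtype_mk
    exact (AffineMap.lineMap_continuous).comp continuous_subtype_val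
  source' := by simp
  target' := by simp

theorem segPath_mem {U : Set ℂ} {a b : ℂ} (h : segment ℝ a b ⊆ U) (t) :
    (segPath h t : ℂ) ∈ segment ℝ a b := by
  rw [segment_eq_image_lineMap]; exact ⟨t, t.2, rfl⟩

theorem chain_of_reach {V Γ : Type*} [Group Γ] (E : V → V → Prop) (e : V → V → Γ) (v0 : V)
    (x : V × Γ)
    (h : Relation.ReflTransGen (fun x y : V × Γ => E x.1 y.1 ∧ y.2 = x.2 * e x.1 y.1) (v0, 1) x) :
    ∃ l : List V, List.IsChain E (l ++ [x.1]) ∧ (l ++ [x.1]).head? = some v0 ∧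
      wprod e (l ++ [x.1]) = x.2 := by
  induction h with
  | refl => exact ⟨[], by simp, by simp, by simp [wprod]⟩
  | @tail y z hy hyz ih =>
    obtain ⟨l, h1, h2, h3⟩ := ih
    refine ⟨l ++ [y.1], ?_, ?_, ?_⟩
    · rw [List.isChain_append]
      refine ⟨h1, by simp, ?_⟩
      intro a ha b hb
      simp at ha hb
      subst ha; subst hb
      exact hyz.1
    · rw [List.head?_append, h2]; rfl
    · rw [List.append_assoc, List.singleton_append, wprod_append, h3, hyz.2]
      simp [wprod]

theorem affine_H (U : Set ℂ)
    (hH : ∀ O : Set ℂ, IsOpen O → Bornology.IsBounded O → frontier O ⊆ U → O ⊆ U)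
    (p0 : ℂ) (δ : ℝ) (hδ : 0 < δ) :
    ∀ O : Set ℂ, IsOpen O → Bornology.IsBounded O →
      frontier O ⊆ (fun q : ℂ => p0 + δ * q) ⁻¹' U → O ⊆ (fun q : ℂ => p0 + δ * q) ⁻¹' U := by
  intro O hO hb hf
  have hδ' : (δ : ℂ) ≠ 0 := by exact_mod_cast hδ.ne'
  let a : ℂ ≃ₜ ℂ := (Homeomorph.mulLeft₀ (δ : ℂ) hδ').trans (Homeomorph.addLeft p0)
  have ha : ∀ q, a q = p0 + δ * q := fun q => rfl
  have h1 : a '' O ⊆ U := by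
    apply hH _ (a.isOpenMap _ hO)
    · obtain ⟨M, hM⟩ := hb.exists_norm_le
      rw [isBounded_iff_forall_norm_le]
      refine ⟨‖p0‖ + δ * M, ?_⟩
      rintro _ ⟨q, hq, rfl⟩
      rw [ha]
      refine (norm_add_le _ _).trans ?_
      rw [norm_mul, Complex.norm_real, Real.norm_of_nonneg hδ.le]
      gcongr
      exact hM q hq
    · rw [← a.image_frontier]
      rintro _ ⟨q, hq, rfl⟩
      exact hf hq
  intro q hq
  exact h1 ⟨q, hq, rfl⟩

theorem simplyConnected_of_H (U : Set ℂ) (hU : IsOpen U) (hconn : IsConnected U)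
    (hH : ∀ O : Set ℂ, IsOpen O → Bornology.IsBounded O → frontier O ⊆ U → O ⊆ U) :
    SimplyConnectedSpace U := by
  have hpc : IsPathConnected U := hU.isConnected_iff_isPathConnected.mp hconn
  haveI : PathConnectedSpace U := isPathConnected_iff_pathConnectedSpace.mp hpc
  rw [simply_connected_iff_loops_nullhomotopic]
  refine ⟨inferInstance, ?_⟩
  intro x0 γ
  obtain ⟨Γ, _, hol, hol_trans, hol_hom, hol_one⟩ := exists_hol U
  apply hol_one
  classical
  -- segment classes
  let s : ℂ → ℂ → Γ := fun a b => if h : segment ℝ a b ⊆ U then hol _ _ (segPath h) else 1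
  have s_path : ∀ (A : Set ℂ), Convex ℝ A → A ⊆ U → ∀ (a b : U) (p : Path a b),
      (∀ t, (p t : ℂ) ∈ A) → hol a b p = s a b := by
    intro A hA hAU a b p hp
    have ha : (a : ℂ) ∈ A := by simpa using hp 0
    have hb : (b : ℂ) ∈ A := by simpa using hp 1
    have hs : segment ℝ (a : ℂ) b ⊆ A := hA.segment_subset ha hb
    have : s a b = hol _ _ (segPath (hs.trans hAU)) := dif_pos (hs.trans hAU)
    rw [this]
    exact hol_hom _ _ _ _ (homotopic_of_convex hA hAU _ _ hp (fun t => hs (segPath_mem _ t)))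
  have s_mul : ∀ (A : Set ℂ), Convex ℝ A → A ⊆ U → ∀ a ∈ A, ∀ b ∈ A, ∀ c ∈ A,
      s a b * s b c = s a c := by
    intro A hA hAU a ha b hb c hc
    have h1 : segment ℝ a b ⊆ A := hA.segment_subset ha hb
    have h2 : segment ℝ b c ⊆ A := hA.segment_subset hb hc
    have e1 : s a b = hol _ _ (segPath (h1.trans hAU)) := dif_pos (h1.trans hAU)
    have e2 : s b c = hol _ _ (segPath (h2.trans hAU)) := dif_pos (h2.trans hAU)
    rw [e1, e2, ← hol_trans]
    refine s_path A hA hAU _ _ _ ?_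
    intro t
    have : ((segPath (h1.trans hAU)).trans (segPath (h2.trans hAU))) t ∈
        range (segPath (h1.trans hAU)) ∪ range (segPath (h2.trans hAU)) := by
      rw [← Path.trans_range]; exact ⟨t, rfl⟩
    rcases this with ⟨t', ht⟩ | ⟨t', ht⟩
    · rw [← ht]; exact h1 (segPath_mem _ t')
    · rw [← ht]; exact h2 (segPath_mem _ t')
  have s_self : ∀ a ∈ U, s a a = 1 := by
    intro a ha
    have := s_mul {a} (convex_singleton a) (by simpa using ha) a rfl a rfl a rfl
    simpa using this
  -- scale
  have hK : IsCompact (range (fun t => (γ t : ℂ))) := isCompact_range (by fun_prop)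
  have hKU : range (fun t => (γ t : ℂ)) ⊆ U := by rintro _ ⟨t, rfl⟩; exact (γ t).2
  obtain ⟨η, hη, hηU⟩ := hK.exists_thickening_subset_open hU hKU
  have hball : ∀ t, Metric.ball (γ t : ℂ) η ⊆ U := by
    intro t y hy
    exact hηU (Metric.mem_thickening_iff.mpr ⟨_, ⟨t, rfl⟩, hy⟩)
  set δ : ℝ := η / 8 with hδdef
  have hδ : 0 < δ := by positivity
  obtain ⟨M, hM⟩ := hK.isBounded.exists_norm_le
  set p0 : ℂ := ⟨-M, -M⟩ with hp0
  let pt : ℕ × ℕ → ℂ := fun v => p0 + δ * lpt v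
  let E : ℕ × ℕ → ℕ × ℕ → Prop := fun u v => LAdj u v ∧ segment ℝ (pt u) (pt v) ⊆ U
  let e : ℕ × ℕ → ℕ × ℕ → Γ := fun u v => s (pt u) (pt v)
  have aff_seg : ∀ (a b q : ℂ), q ∈ segment ℝ a b →
      p0 + δ * q ∈ segment ℝ (p0 + δ * a) (p0 + δ * b) := by
    rintro a b q ⟨x, y, hx, hy, hxy, rfl⟩
    refine ⟨x, y, hx, hy, hxy, ?_⟩
    simp only [Complex.real_smul]
    have : (x : ℂ) + y = 1 := by exact_mod_cast hxy
    linear_combination p0 * this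
  have comb := comb_trivial e E (fun q => (fun q : ℂ => p0 + δ * q) '' lsq q.1 q.2 ⊆ U)
    (fun u v h => h.1)
    (by
      intro u v h1 h2
      have := s_mul _ (convex_segment _ _) h1.2 (pt u) (left_mem_segment _ _ _) (pt v)
        (right_mem_segment _ _ _) (pt u) (left_mem_segment _ _ _)
      rw [s_self _ (h1.2 (left_mem_segment _ _ _))] at this
      exact this)
    (by
      intro i j hF
      simp only at hF
      set A := (fun q : ℂ => p0 + δ * q) '' lsq i j with hA
      have hAc : Convex ℝ A := by
        rintro _ ⟨x, hx, rfl⟩ _ ⟨y, hy, rfl⟩ a b ha hb hab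
        refine ⟨a • x + b • y, convex_lsq _ _ hx hy ha hb hab, ?_⟩
        simp only [Complex.real_smul]
        have : (a : ℂ) + b = 1 := by exact_mod_cast hab
        linear_combination - p0 * this
      have m1 : pt (i, j) ∈ A := ⟨_, by rw [mem_lsq]; simp [lpt], rfl⟩
      have m2 : pt (i + 1, j) ∈ A := ⟨_, by rw [mem_lsq]; simp [lpt], rfl⟩
      have m3 : pt (i, j + 1) ∈ A := ⟨_, by rw [mem_lsq]; simp [lpt], rfl⟩
      have m4 : pt (i + 1, j + 1) ∈ A := ⟨_, by rw [mem_lsq]; simp [lpt], rfl⟩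
      have sg : ∀ {a b}, a ∈ A → b ∈ A → segment ℝ a b ⊆ U :=
        fun ha hb => (hAc.segment_subset ha hb).trans hF
      refine ⟨⟨⟨?_, sg m3 m1⟩, ⟨?_, sg m1 m2⟩, ⟨?_, sg m2 m1⟩, ⟨?_, sg m1 m3⟩⟩, ?_, ?_⟩
      · simp [LAdj]
      · simp [LAdj]
      · simp [LAdj]
      · simp [LAdj]
      · simp only [e]
        rw [s_mul A hAc hF _ m3 _ m4 _ m2, s_mul A hAc hF _ m3 _ m1 _ m2]
      · simp only [e]
        rw [s_mul A hAc hF _ m2 _ m4 _ m3, s_mul A hAc hF _ m2 _ m1 _ m3])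
    (by
      intro c t hch q hq
      have := winding_geom _ (affine_H U hH p0 δ hδ) c t (hch.imp (by
        intro u v h
        refine ⟨h.1, fun q hq => h.2 (aff_seg _ _ _ hq)⟩)) q hq
      rintro _ ⟨y, hy, rfl⟩
      exact this hy)
  -- subdivision
  obtain ⟨N, hN0, hN⟩ : ∃ N : ℕ, 0 < N ∧ ∀ t t' : unitInterval, dist t t' ≤ 1 / N →
      dist (γ t : ℂ) (γ t') < δ := by
    have huc : UniformContinuous (fun t => (γ t : ℂ)) :=
      CompactSpace.uniformContinuous_of_continuous (by fun_prop)
    obtain ⟨r, hr, h⟩ := Metric.uniformContinuous_iff.mp huc δ hδ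
    obtain ⟨N, hN⟩ := exists_nat_one_div_lt hr
    refine ⟨N + 1, by omega, fun t t' htt => h (lt_of_le_of_lt htt (by push_cast; exact hN))⟩
  let τ : ℕ → unitInterval := fun k => Set.projIcc 0 1 zero_le_one ((k : ℝ) / N)
  have hτ0 : τ 0 = 0 := by simp [τ]
  have hτN : τ N = 1 := by
    have : (N : ℝ) / N = 1 := div_self (by positivity)
    simp [τ, this]
  have hττ : ∀ k, dist (τ k) (τ (k + 1)) ≤ 1 / N := by
    intro k
    refine (LipschitzWith.dist_le_mul (LipschitzWith.projIcc zero_le_one) _ _).trans ?_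
    have h0 : (0 : ℝ) < N := by exact_mod_cast hN0
    simp only [NNReal.coe_one, one_mul, Real.dist_eq]
    rw [← _root_.sub_div]
    push_cast
    rw [show (k : ℝ) - (k + 1) = -1 by ring, abs_div, abs_neg, abs_one, abs_of_pos h0]
  let vf : ℂ → ℕ × ℕ := fun w => (⌊(w.re + M) / δ⌋₊, ⌊(w.im + M) / δ⌋₊)
  have key : ∀ x : ℝ, 0 ≤ x → δ * ⌊x / δ⌋₊ ≤ x ∧ x < δ * ⌊x / δ⌋₊ + δ := by
    intro x hx
    have h1 := Nat.floor_le (a := x / δ) (by positivity)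
    have h2 := Nat.lt_floor_add_one (x / δ)
    rw [le_div_iff₀ hδ] at h1
    rw [div_lt_iff₀ hδ] at h2
    constructor <;> linarith
  have hnn : ∀ t, 0 ≤ (γ t : ℂ).re + M ∧ 0 ≤ (γ t : ℂ).im + M := by
    intro t
    have h1 := hM _ ⟨t, rfl⟩
    have h2 := (abs_le.mp ((Complex.abs_re_le_norm (γ t : ℂ)).trans h1)).1
    have h3 := (abs_le.mp ((Complex.abs_im_le_norm (γ t : ℂ)).trans h1)).1
    constructor <;> linarith
  have ptre : ∀ v, (pt v).re = -M + δ * v.1 := by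
    intro v; simp [pt, p0, lpt]
  have ptim : ∀ v, (pt v).im = -M + δ * v.2 := by
    intro v; simp [pt, p0, lpt]
  have near : ∀ (w a : ℂ), |w.re - a.re| ≤ 2 * δ → |w.im - a.im| ≤ 2 * δ → w ∈ Metric.ball a η := by
    intro w a h1 h2
    rw [mem_ball_iff_norm]
    refine lt_of_le_of_lt (Complex.norm_le_abs_re_add_abs_im _) ?_
    simp only [Complex.sub_re, Complex.sub_im]
    linarith
  -- single-step: equal or adjacent vertices
  let R : (ℕ × ℕ) × Γ → (ℕ × ℕ) × Γ → Prop := fun x y => E x.1 y.1 ∧ y.2 = x.2 * e x.1 y.1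
  have one_step : ∀ (A : Set ℂ), Convex ℝ A → A ⊆ U → ∀ (u v : ℕ × ℕ) (g : Γ), pt u ∈ A → pt v ∈ A →
      (u = v ∨ LAdj u v) → Relation.ReflTransGen R (u, g) (v, g * s (pt u) (pt v)) := by
    intro A hA hAU u v g hu hv h
    rcases h with rfl | h
    · rw [s_self _ (hAU hu), mul_one]
    · exact Relation.ReflTransGen.single ⟨⟨h, (hA.segment_subset hu hv).trans hAU⟩, rfl⟩
  have induct : ∀ k : ℕ, ∃ g : Γ, Relation.ReflTransGen R (vf (γ (τ 0)), 1) (vf (γ (τ k)), g) ∧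
      hol _ _ (γ.subpath (τ 0) (τ k)) * s (γ (τ k)) (pt (vf (γ (τ k)))) =
        s (γ (τ 0)) (pt (vf (γ (τ 0)))) * g := by
    intro k
    induction k with
    | zero =>
      refine ⟨1, Relation.ReflTransGen.refl, ?_⟩
      rw [Path.subpath_self]
      have : hol _ _ (Path.refl (γ (τ 0))) = s (γ (τ 0)) (γ (τ 0)) :=
        s_path {(γ (τ 0) : ℂ)} (convex_singleton _) (by simp) _ _ _ (by simp)
      rw [this, s_self _ (γ (τ 0)).2]; simp
    | succ k ih =>
      obtain ⟨g, hg1, hg2⟩ := ih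
      set a := γ (τ k) with ha
      set b := γ (τ (k + 1)) with hb
      set A := Metric.ball (a : ℂ) η with hA
      have hAc : Convex ℝ A := convex_ball _ _
      have hAU : A ⊆ U := hball _
      have hab : dist (a : ℂ) b < δ := hN _ _ (hττ k)
      have hre : |(a : ℂ).re - (b : ℂ).re| < δ := lt_of_le_of_lt (by simpa using Complex.abs_re_le_norm ((a : ℂ) - b)) (by rwa [dist_eq_norm] at hab)
      have him : |(a : ℂ).im - (b : ℂ).im| < δ := lt_of_le_of_lt (by simpa using Complex.abs_im_le_norm ((a : ℂ) - b)) (by rwa [dist_eq_norm] at hab)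
      rw [abs_lt] at hre him
      obtain ⟨a1, a2⟩ := hnn (τ k)
      obtain ⟨b1, b2⟩ := hnn (τ (k + 1))
      obtain ⟨r1, r2⟩ := key _ a1
      obtain ⟨r3, r4⟩ := key _ a2
      obtain ⟨r5, r6⟩ := key _ b1
      obtain ⟨r7, r8⟩ := key _ b2
      have u1 : (vf a).1 = ⌊((a : ℂ).re + M) / δ⌋₊ := rfl
      have u2 : (vf a).2 = ⌊((a : ℂ).im + M) / δ⌋₊ := rfl
      have u3 : (vf b).1 = ⌊((b : ℂ).re + M) / δ⌋₊ := rfl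
      have u4 : (vf b).2 = ⌊((b : ℂ).im + M) / δ⌋₊ := rfl
      rw [← ha, ← u1] at r1 r2
      rw [← ha, ← u2] at r3 r4
      rw [← hb, ← u3] at r5 r6
      rw [← hb, ← u4] at r7 r8
      set m : ℕ × ℕ := ((vf b).1, (vf a).2) with hm
      have mema : (a : ℂ) ∈ A := Metric.mem_ball_self hη
      have memb : (b : ℂ) ∈ A := by rw [hA, Metric.mem_ball, dist_comm]; linarith
      have mva : pt (vf a) ∈ A := by
        apply near <;> rw [abs_le] <;> simp only [ptre, ptim] <;> constructor <;> linarith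
      have mvb : pt (vf b) ∈ A := by
        apply near <;> rw [abs_le] <;> simp only [ptre, ptim] <;> constructor <;> linarith
      have mm : pt m ∈ A := by
        apply near <;> rw [abs_le] <;> simp only [ptre, ptim, hm] <;> constructor <;> linarith
      have cmp : ∀ x y : ℕ, δ * x < δ * y + 2 * δ → x ≤ y + 1 := by
        intro x y h
        have : (x : ℝ) < y + 2 := by
          have : δ * x < δ * (y + 2) := by linarith
          exact lt_of_mul_lt_mul_left this hδ.le
        have : x < y + 2 := by exact_mod_cast this
        omega
      have c1 : (vf a).1 ≤ (vf b).1 + 1 := cmp _ _ (by linarith)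
      have c2 : (vf b).1 ≤ (vf a).1 + 1 := cmp _ _ (by linarith)
      have c3 : (vf a).2 ≤ (vf b).2 + 1 := cmp _ _ (by linarith)
      have c4 : (vf b).2 ≤ (vf a).2 + 1 := cmp _ _ (by linarith)
      have adj1 : vf a = m ∨ LAdj (vf a) m := by
        by_cases h : (vf a).1 = (vf b).1
        · left; rw [hm, ← h]
        · right; right; exact ⟨rfl, by show (vf a).1 + 1 = (vf b).1 ∨ (vf b).1 + 1 = (vf a).1; omega⟩
      have adj2 : m = vf b ∨ LAdj m (vf b) := by
        by_cases h : (vf a).2 = (vf b).2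
        · left; rw [hm, h]
        · right; left; exact ⟨rfl, by show (vf a).2 + 1 = (vf b).2 ∨ (vf b).2 + 1 = (vf a).2; omega⟩
      refine ⟨g * s (pt (vf a)) (pt m) * s (pt m) (pt (vf b)), ?_, ?_⟩
      · exact (hg1.trans (one_step A hAc hAU _ _ _ mva mm adj1)).trans
          (one_step A hAc hAU _ _ _ mm mvb adj2)
      · have h1 : hol _ _ (γ.subpath (τ 0) (τ (k + 1))) =
            hol _ _ (γ.subpath (τ 0) (τ k)) * hol _ _ (γ.subpath (τ k) (τ (k + 1))) := by
          rw [← hol_trans]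
          exact (hol_hom _ _ _ _ ⟨Path.Homotopy.subpathTransSubpath γ _ _ _⟩).symm
        have h2 : hol _ _ (γ.subpath (τ k) (τ (k + 1))) = s a b := by
          apply s_path A hAc hAU
          intro t
          have ht : γ.subpath (τ k) (τ (k + 1)) t ∈ γ '' uIcc (τ k) (τ (k + 1)) := by
            rw [← Path.range_subpath]; exact ⟨t, rfl⟩
          obtain ⟨t', ht', he⟩ := ht
          rw [← he, hA, Metric.mem_ball]
          have : dist (τ k) t' ≤ 1 / N := by
            refine le_trans ?_ (hττ k)
            rw [Subtype.dist_eq, Subtype.dist_eq]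
            apply Real.dist_left_le_of_mem_uIcc
            rw [Set.mem_uIcc] at ht' ⊢
            exact ht'
          have := hN _ _ this
          rw [dist_comm]; linarith
        rw [h1, h2, mul_assoc, s_mul A hAc hAU _ mema _ memb _ mvb,
          ← s_mul A hAc hAU _ mema _ mva _ mvb, ← s_mul A hAc hAU _ mva _ mm _ mvb]
        have := hg2
        rw [← mul_assoc, this]
        simp only [mul_assoc]
  obtain ⟨g, hg1, hg2⟩ := induct N
  have hsp : hol _ _ (γ.subpath (τ 0) (τ N)) = hol _ _ γ := by
    have gen : ∀ (t t' : unitInterval), t = 0 → t' = 1 → hol _ _ (γ.subpath t t') = hol _ _ γ := by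
      rintro _ _ rfl rfl
      have : ∀ (a b : U) (p : Path a b) (a' b' : U) (ha : a' = a) (hb : b' = b),
        hol _ _ (p.cast ha hb) = hol _ _ p := by
          intro a b p a' b' ha hb; subst ha; subst hb; rfl
      rw [Path.subpath_zero_one]
      exact this _ _ _ _ _ _ _
    exact gen _ _ hτ0 hτN
  have hclosed : vf (γ (τ N)) = vf (γ (τ 0)) := by rw [hτ0, hτN]; simp
  rw [hclosed] at hg1
  have hgone : g = 1 := by
    obtain ⟨l, h1, h2, h3⟩ := chain_of_reach E e _ _ hg1
    cases l with
    | nil => simpa [wprod] using h3.symm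
    | cons c t =>
      simp at h2
      subst h2
      exact h3.symm.trans (comb _ _ t h1 rfl)
  rw [hsp, hgone, hclosed] at hg2
  have e0 : (γ (τ N) : ℂ) = γ (τ 0) := by rw [hτ0, hτN]; simp
  rw [e0, mul_one] at hg2
  exact mul_eq_right.mp hg2

end NiceSet

namespace NiceSet

lemma lin_bound {F : ℂ → ℂ} {c k : ℂ} {s ε : ℝ} (hF : DifferentiableOn ℂ F (ball c s))
    (hk : ∀ w ∈ ball c s, ‖deriv F w - k‖ ≤ ε) :
    ∀ τ ∈ ball c s, ∀ σ ∈ ball c s, ‖F τ - F σ - k * (τ - σ)‖ ≤ ε * ‖τ - σ‖ := by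
  intro τ hτ σ hσ
  have hd : ∀ w ∈ ball c s, HasDerivAt (fun x => F x - k * x) (deriv F w - k) w := by
    intro w hw
    have h1 := (hF.differentiableAt (isOpen_ball.mem_nhds hw)).hasDerivAt
    have h2 := (hasDerivAt_id w).const_mul k
    have h3 := h1.sub h2
    rw [mul_one] at h3
    exact h3
  have := (convex_ball c s).norm_image_sub_le_of_norm_hasDerivWithin_le
    (fun w hw => (hd w hw).hasDerivWithinAt) hk hσ hτ
  have e : F τ - F σ - k * (τ - σ) = F τ - k * τ - (F σ - k * σ) := by ring
  rw [e]
  exact this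

lemma koe {F : ℂ → ℂ} {c k : ℂ} {s : ℝ} (hk : k ≠ 0) (hF : DifferentiableOn ℂ F (ball c s))
    (hd : ∀ w ∈ ball c s, ‖deriv F w - k‖ ≤ ‖k‖ / 2) {r : ℝ} (hr : 0 < r) (hrs : r < s) :
    ball (F c) (‖k‖ * r / 4) ⊆ F '' closedBall c r := by
  have hk' : 0 < ‖k‖ := norm_pos_iff.mpr hk
  have low : ∀ w ∈ ball c s, ‖k‖ / 2 * ‖w - c‖ ≤ ‖F w - F c‖ := by
    intro w hw
    have h1 := lin_bound hF hd w hw c (mem_ball_self (hr.trans hrs))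
    have h2 : ‖k * (w - c)‖ ≤ ‖F w - F c‖ + ‖F w - F c - k * (w - c)‖ := by
      have := norm_sub_le (F w - F c) (F w - F c - k * (w - c))
      simpa using this
    rw [norm_mul] at h2
    linarith
  have key := DiffContOnCl.ball_subset_image_closedBall (f := F) (z₀ := c) (r := r)
    (ε := ‖k‖ / 2 * r) ((hF.mono (closedBall_subset_ball hrs)).diffContOnCl_ball subset_rfl) hr ?_ ?_
  · convert key using 2; ring
  · intro z hz
    have := low z (closedBall_subset_ball hrs (sphere_subset_closedBall hz))
    rwa [mem_sphere_iff_norm.mp hz] at this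
  · have h1 : ∀ᶠ z in 𝓝[≠] c, F z ≠ F c := by
      have h3 : ∀ᶠ z in 𝓝[≠] c, z ∈ ball c s :=
        mem_nhdsWithin_of_mem_nhds (ball_mem_nhds _ (hr.trans hrs))
      filter_upwards [h3, self_mem_nhdsWithin] with z hz hne h
      have := low z hz
      rw [h, sub_self, norm_zero] at this
      have : 0 < ‖z - c‖ := norm_pos_iff.mpr (sub_ne_zero.mpr hne)
      nlinarith
    exact h1.frequently.filter_mono nhdsWithin_le_nhds

lemma bloch {F : ℂ → ℂ} {c : ℂ} {ρ : ℝ} (hρ : 0 < ρ) (hF : DifferentiableOn ℂ F (ball c ρ)) :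
    ∃ b, ball b (‖deriv F c‖ * ρ / 256) ⊆ F '' ball c ρ := by
  by_cases h0 : deriv F c = 0
  · exact ⟨0, by simp [h0]⟩
  have h0' : 0 < ‖deriv F c‖ := norm_pos_iff.mpr h0
  have hsub : closedBall c (ρ / 2) ⊆ ball c ρ := closedBall_subset_ball (by linarith)
  have hF' : DifferentiableOn ℂ (deriv F) (ball c ρ) := hF.deriv isOpen_ball
  have hcont : ContinuousOn (fun a => ‖deriv F a‖ * (ρ / 2 - dist a c)) (closedBall c (ρ / 2)) := by
    apply ContinuousOn.mul
    · exact (hF'.continuousOn.mono hsub).norm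
    · fun_prop
  obtain ⟨a, ha, hmax⟩ := (isCompact_closedBall c (ρ / 2)).exists_isMaxOn
    ⟨c, mem_closedBall_self (by linarith)⟩ hcont
  have hmax' : ∀ w ∈ closedBall c (ρ / 2),
    ‖deriv F w‖ * (ρ / 2 - dist w c) ≤ ‖deriv F a‖ * (ρ / 2 - dist a c) := fun w hw => hmax hw
  set A := ‖deriv F a‖ with hA
  set d := ρ / 2 - dist a c with hdd
  have hc := hmax' c (mem_closedBall_self (by linarith))
  rw [dist_self, sub_zero] at hc
  have hd0 : 0 ≤ d := by rw [mem_closedBall] at ha; linarith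
  have hA0 : 0 ≤ A := norm_nonneg _
  have hAd : 0 < A * d := lt_of_lt_of_le (by positivity) hc
  have hd : 0 < d := by
    rcases hd0.lt_or_eq with h | h
    · exact h
    · rw [← h] at hAd; simp at hAd
  have hA1 : 0 < A := by
    rcases hA0.lt_or_eq with h | h
    · exact h
    · rw [← h] at hAd; simp at hAd
  have sub2 : ball a (d / 2) ⊆ ball c ρ := by
    intro w hw
    rw [mem_ball] at *
    have := dist_triangle w a c
    linarith
  have bd : ∀ w ∈ ball a (d / 2), ‖deriv F w‖ ≤ 2 * A := by
    intro w hw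
    rw [mem_ball] at hw
    have h1 := dist_triangle w a c
    have h2 := hmax' w (by rw [mem_closedBall]; linarith)
    have h3 : d / 2 ≤ ρ / 2 - dist w c := by linarith
    have h4 : ‖deriv F w‖ * (d / 2) ≤ A * d :=
      (mul_le_mul_of_nonneg_left h3 (norm_nonneg _)).trans h2
    nlinarith
  have bd2 : ∀ w ∈ ball a (d / 16), ‖deriv F w - deriv F a‖ ≤ ‖deriv F a‖ / 2 := by
    intro w hw
    have := Complex.dist_le_div_mul_dist_of_mapsTo_ball (f := deriv F) (c := a) (R₁ := d / 2)
      (R₂ := 3 * A) (z := w) (hF'.mono sub2) ?_ (ball_subset_ball (by linarith) hw)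
    · rw [dist_eq_norm] at this
      rw [mem_ball] at hw
      refine this.trans ?_
      rw [← hA, div_mul_eq_mul_div, div_le_iff₀ (by positivity)]
      nlinarith
    · intro v hv
      rw [mem_closedBall, dist_eq_norm]
      have := norm_sub_le (deriv F v) (deriv F a)
      have := bd v hv
      linarith
  refine ⟨F a, ?_⟩
  have hK := koe (F := F) (c := a) (k := deriv F a) (s := d / 16) (norm_pos_iff.mp hA1)
    (hF.mono ((ball_subset_ball (by linarith)).trans sub2)) bd2 (r := d / 32) (by linarith)
    (by linarith)
  refine (ball_subset_ball ?_).trans (hK.trans (image_mono ?_))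
  · rw [← hA]; nlinarith
  · exact (closedBall_subset_ball (by linarith)).trans sub2

lemma exists_log {F : ℂ → ℂ} {c : ℂ} {ρ : ℝ} (hρ : 0 < ρ) (hF : DifferentiableOn ℂ F (ball c ρ))
    (h0 : ∀ w ∈ ball c ρ, F w ≠ 0) :
    ∃ l : ℂ → ℂ, (∀ w ∈ ball c ρ, HasDerivAt l (deriv F w / F w) w) ∧
      ∀ w ∈ ball c ρ, Complex.exp (l w) = F w := by
  have hq : DifferentiableOn ℂ (fun w => deriv F w / F w) (ball c ρ) :=
    (hF.deriv isOpen_ball).div hF h0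
  obtain ⟨l, hl0, hl⟩ := (hq.isExactOn_ball).with_val_at c (Complex.log (F c))
  refine ⟨l, hl, ?_⟩
  have hder : ∀ w ∈ ball c ρ, HasDerivAt (fun x => F x * Complex.exp (- l x)) 0 w := by
    intro w hw
    have h1 := (hF.differentiableAt (isOpen_ball.mem_nhds hw)).hasDerivAt
    have h2 := (hl w hw).neg.cexp
    have h3 := h1.mul h2
    have e : deriv F w * Complex.exp (-l w) + F w * (Complex.exp (-l w) * -(deriv F w / F w))
        = 0 := by
      have := h0 w hw
      field_simp
      ring
    rw [← e]
    exact h3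
  have hcst : ∀ w ∈ ball c ρ, F w * Complex.exp (- l w) = 1 := by
    intro w hw
    have h1 := (convex_ball c ρ).norm_image_sub_le_of_norm_hasDerivWithin_le (C := 0)
      (fun w hw => (hder w hw).hasDerivWithinAt) (by simp) (mem_ball_self hρ) hw
    simp only [zero_mul, norm_le_zero_iff, sub_eq_zero] at h1
    rw [h1, hl0, Complex.exp_neg, Complex.exp_log (h0 c (mem_ball_self hρ))]
    exact mul_inv_cancel₀ (h0 c (mem_ball_self hρ))
  intro w hw
  have := hcst w hw
  rw [Complex.exp_neg] at this
  have e := Complex.exp_ne_zero (l w)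
  field_simp at this
  exact this.symm

/-- logarithmic derivative bound for injective nonvanishing maps -/
lemma logderiv {F : ℂ → ℂ} {c : ℂ} {ρ : ℝ} (hρ : 0 < ρ) (hF : DifferentiableOn ℂ F (ball c ρ))
    (h0 : ∀ w ∈ ball c ρ, F w ≠ 0) (hinj : InjOn F (ball c ρ)) :
    ‖deriv F c / F c‖ ≤ 2048 / ρ := by
  obtain ⟨l, hl, he⟩ := exists_log hρ hF h0
  have hld : DifferentiableOn ℂ l (ball c ρ) := fun w hw =>
    (hl w hw).differentiableAt.differentiableWithinAt
  obtain ⟨b, hb⟩ := bloch hρ hld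
  rw [(hl c (mem_ball_self hρ)).deriv] at hb
  by_contra hcon
  push Not at hcon
  rw [div_lt_iff₀ hρ] at hcon
  have hbig : 8 < ‖deriv F c / F c‖ * ρ / 256 := by linarith
  obtain ⟨u, hu, hue⟩ := hb (mem_ball_self (by linarith))
  have hmem : b + 2 * Real.pi * Complex.I ∈ ball b (‖deriv F c / F c‖ * ρ / 256) := by
    rw [mem_ball, dist_eq_norm]
    simp only [add_sub_cancel_left, norm_mul, Complex.norm_I, mul_one, Complex.norm_real,
      Complex.norm_ofNat, Real.norm_eq_abs, abs_of_pos Real.pi_pos]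
    have := Real.pi_lt_four
    linarith
  obtain ⟨v, hv, hve⟩ := hb hmem
  have : F u = F v := by
    rw [← he u hu, ← he v hv, hue, hve, Complex.exp_add, Complex.exp_two_pi_mul_I, mul_one]
  have huv := hinj hu hv this
  rw [huv, hve] at hue
  simp [Real.pi_ne_zero] at hue

/-- Koebe-type growth bound -/
lemma growth {G : ℂ → ℂ} {c : ℂ} {ρ : ℝ} (hρ : 0 < ρ) (hG : DifferentiableOn ℂ G (ball c ρ))
    (hinj : InjOn G (ball c ρ)) (hd : deriv G c ≠ 0) :
    ∀ w ∈ ball c (ρ / 2), ‖G w - G c‖ ≤ Real.exp 2049 * ‖deriv G c‖ * ‖w - c‖ := by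
  have hcm : c ∈ ball c ρ := mem_ball_self hρ
  set q := dslope G c with hq
  have hqd : DifferentiableOn ℂ q (ball c ρ) :=
    (Complex.differentiableOn_dslope (ball_mem_nhds c hρ)).mpr hG
  have hqn : ∀ w, w ≠ c → q w = (G w - G c) / (w - c) := by
    intro w hw
    rw [hq, dslope_of_ne _ hw, slope_def_field]
  have hqm : ∀ w, G w - G c = q w * (w - c) := by
    intro w
    have := sub_smul_dslope G c w
    rw [← this, smul_eq_mul, mul_comm]
  have hq0 : ∀ w ∈ ball c ρ, q w ≠ 0 := by
    intro w hw h
    by_cases hwc : w = c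
    · rw [hwc, hq, dslope_same] at h; exact hd h
    · have := hqm w
      rw [h, zero_mul, sub_eq_zero] at this
      exact hwc (hinj hw hcm this)
  have hlq : ∀ w ∈ sphere c (ρ / 2), ‖deriv q w / q w‖ ≤ 4098 / ρ := by
    intro w hw
    have hwn : ‖w - c‖ = ρ / 2 := mem_sphere_iff_norm.mp hw
    have hwc : w ≠ c := by rintro rfl; simp at hwn; linarith
    have hwb : w ∈ ball c ρ := by rw [mem_ball, dist_eq_norm]; linarith
    have hsub : ball w (ρ / 2) ⊆ ball c ρ := by
      intro v hv
      rw [mem_ball] at *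
      have := dist_triangle v w c
      rw [dist_eq_norm w c] at this
      linarith
    have h1 := logderiv (F := fun v => G v - G c) (c := w) (ρ := ρ / 2) (by linarith)
      ((hG.mono hsub).sub_const _) (by
        intro v hv h
        have := hinj (hsub hv) hcm (sub_eq_zero.mp h)
        rw [this, mem_ball, dist_comm, dist_eq_norm, hwn] at hv
        exact lt_irrefl _ hv) (by
        intro u hu v hv h
        exact hinj (hsub hu) (hsub hv) (sub_left_inj.mp h))
    have hGd := (hG.differentiableAt (isOpen_ball.mem_nhds hwb)).hasDerivAt
    have hqd' := (hqd.differentiableAt (isOpen_ball.mem_nhds hwb)).hasDerivAt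
    have h2 : deriv (fun v => G v - G c) w = deriv q w * (w - c) + q w := by
      have h3 : (fun v => G v - G c) = fun v => q v * (v - c) := funext hqm
      rw [h3]
      have := hqd'.mul ((hasDerivAt_id w).sub_const c)
      rw [mul_one] at this
      exact this.deriv
    have hqw := hq0 w hwb
    have hwc' : w - c ≠ 0 := sub_ne_zero.mpr hwc
    have h4 : deriv q w / q w = deriv (fun v => G v - G c) w / (G w - G c) - 1 / (w - c) := by
      rw [h2, hqm w]
      field_simp
      ring
    rw [h4]
    refine (norm_sub_le _ _).trans ?_
    rw [norm_div 1, norm_one, hwn]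
    calc _ ≤ 2048 / (ρ / 2) + 1 / (ρ / 2) := by gcongr
      _ = 4098 / ρ := by field_simp; norm_num
  have hQd : DifferentiableOn ℂ (fun w => deriv q w / q w) (ball c ρ) :=
    (hqd.deriv isOpen_ball).div hqd hq0
  have hbd : ∀ w ∈ closedBall c (ρ / 2), ‖deriv q w / q w‖ ≤ 4098 / ρ := by
    intro w hw
    apply Complex.norm_le_of_forall_mem_frontier_norm_le (U := ball c (ρ / 2)) isBounded_ball
      ((hQd.mono (closedBall_subset_ball (by linarith))).diffContOnCl_ball subset_rfl)
    · intro v hv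
      rw [frontier_ball _ (by linarith)] at hv
      exact hlq v hv
    · rwa [closure_ball _ (by linarith)]
  obtain ⟨l, hl, he⟩ := exists_log hρ hqd hq0
  intro w hw
  have hw2 : w ∈ ball c ρ := ball_subset_ball (by linarith) hw
  have h1 := (convex_ball c (ρ / 2)).norm_image_sub_le_of_norm_hasDerivWithin_le (C := 4098 / ρ)
      (fun w hw => (hl w (ball_subset_ball (by linarith) hw)).hasDerivWithinAt)
      (fun w hw => hbd w (ball_subset_closedBall hw)) (mem_ball_self (by linarith)) hw
  have h2 : ‖l w - l c‖ ≤ 2049 := by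
    refine h1.trans ?_
    rw [mem_ball, dist_eq_norm] at hw
    rw [div_mul_eq_mul_div, div_le_iff₀ hρ]
    linarith
  have h3 : ‖q w‖ ≤ Real.exp 2049 * ‖q c‖ := by
    rw [← he w hw2, ← he c hcm, Complex.norm_exp, Complex.norm_exp, ← Real.exp_add]
    apply Real.exp_le_exp.mpr
    have := (Complex.re_le_norm (l w - l c)).trans h2
    rw [Complex.sub_re] at this
    linarith
  rw [hqm, norm_mul]
  have : q c = deriv G c := by rw [hq, dslope_same]
  rw [← this]
  gcongr

/-- Lemma A' -/
lemma section_analytic {Φ u : ℂ → ℂ} {t : ℂ} (hΦ : AnalyticAt ℂ Φ (u t))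
    (hu : ∀ᶠ τ in 𝓝 t, ContinuousAt u τ) (h : ∀ᶠ τ in 𝓝 t, Φ (u τ) = τ) :
    AnalyticAt ℂ u t ∧ deriv Φ (u t) ≠ 0 ∧ deriv u t ≠ 0 := by
  have hut : ContinuousAt u t := hu.self_of_nhds
  have hΦ' := hΦ.deriv
  have an : AnalyticAt ℂ u t := by
    apply Complex.analyticAt_of_differentiable_on_punctured_nhds_of_continuousAt _ hut
    have hne : ∀ᶠ x in 𝓝[≠] (u t), deriv Φ x ≠ 0 := by
      rcases hΦ'.eventually_eq_zero_or_eventually_ne_zero with h0 | h0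
      · exfalso
        obtain ⟨r, hr, hball⟩ := Metric.eventually_nhds_iff_ball.mp (h0.and hΦ.eventually_analyticAt)
        have hc : ∀ x ∈ ball (u t) r, Φ x = Φ (u t) := by
          intro x hx
          have h1 := (convex_ball (u t) r).norm_image_sub_le_of_norm_hasDerivWithin_le (C := 0)
            (f := Φ) (f' := fun _ => 0)
            (fun w hw => by
              have := (hball w hw).2.differentiableAt.hasDerivAt
              rw [(hball w hw).1] at this
              exact this.hasDerivWithinAt) (by simp) (mem_ball_self hr) hx
          simpa [sub_eq_zero] using h1
        have h2 : ∀ᶠ τ in 𝓝 t, u τ ∈ ball (u t) r := hut (ball_mem_nhds _ hr)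
        have h3 : ∀ᶠ τ in 𝓝 t, τ = t := by
          filter_upwards [h, h2] with τ h4 h5
          rw [← h4, hc _ h5, h.self_of_nhds]
        have h4 : ∀ᶠ τ in 𝓝[≠] t, τ = t := h3.filter_mono nhdsWithin_le_nhds
        obtain ⟨τ, h5, h6⟩ := (h4.and self_mem_nhdsWithin).exists
        exact h6 h5
      · exact h0
    have hne' : ∀ᶠ x in 𝓝 (u t), x ≠ u t → deriv Φ x ≠ 0 := eventually_nhdsWithin_iff.mp hne
    have e1 := hut.eventually hne'
    have e2 := hut.eventually hΦ.eventually_analyticAt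
    have e3 := h.eventually_nhds
    filter_upwards [e1.filter_mono nhdsWithin_le_nhds, e2.filter_mono nhdsWithin_le_nhds,
      e3.filter_mono nhdsWithin_le_nhds, hu.filter_mono nhdsWithin_le_nhds,
      self_mem_nhdsWithin] with τ h1 h2 h3 h4 h5
    have hne2 : u τ ≠ u t := by
      intro hh
      have := h3.self_of_nhds
      rw [hh, h.self_of_nhds] at this
      exact h5 this.symm
    exact (HasDerivAt.of_local_left_inverse h4 h2.differentiableAt.hasDerivAt (h1 hne2) h3).differentiableAt
  have hch : deriv Φ (u t) * deriv u t = 1 := by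
    have h1 := hΦ.differentiableAt.hasDerivAt.comp t an.differentiableAt.hasDerivAt
    have h2 : HasDerivAt (Φ ∘ u) 1 t := (hasDerivAt_id t).congr_of_eventuallyEq h
    exact h1.unique h2
  exact ⟨an, left_ne_zero_of_mul_eq_one hch, right_ne_zero_of_mul_eq_one hch⟩

end NiceSet

namespace NiceSet

section sphere
variable {𝕊 : Type} [MetricSpace 𝕊] [CompactSpace 𝕊] (S : SphereModel 𝕊)

lemma toC_ι (t : ℂ) : S.toC (S.ι t) = t := Function.leftInverse_invFun S.injective_ι t

lemma ι_ne_infty (t : ℂ) : S.ι t ≠ S.infty := by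
  have : S.ι t ∈ range S.ι := ⟨t, rfl⟩
  rw [S.range_ι] at this
  exact this

lemma exists_ι {x : 𝕊} (h : x ≠ S.infty) : ∃ t, S.ι t = x := by
  have : x ∈ range S.ι := by rw [S.range_ι]; exact h
  exact this

lemma sphereInv_inj : Injective S.sphereInv :=
  (show LeftInverse S.sphereInv S.sphereInv from S.sphereInv_invol).injective

lemma sphereInv_open : IsOpenMap S.sphereInv := by
  intro U hU
  have : S.sphereInv '' U = S.sphereInv ⁻¹' U := by
    ext x; constructor
    · rintro ⟨y, hy, rfl⟩; rw [mem_preimage, S.sphereInv_invol]; exact hy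
    · intro hx; exact ⟨_, hx, S.sphereInv_invol x⟩
  rw [this]; exact hU.preimage S.continuous_sphereInv

lemma chartInv_infty : S.chartInv S.infty = S.sphereInv ∘ S.ι := by simp [SphereModel.chartInv]
lemma chartInv_ne {w : 𝕊} (h : w ≠ S.infty) : S.chartInv w = S.ι := by
  simp [SphereModel.chartInv, h]
lemma chart_infty : S.chart S.infty = S.toC ∘ S.sphereInv := by simp [SphereModel.chart]
lemma chart_ne {w : 𝕊} (h : w ≠ S.infty) : S.chart w = S.toC := by
  simp [SphereModel.chart, h]

lemma chartInv_cont (w : 𝕊) : Continuous (S.chartInv w) := by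
  by_cases h : w = S.infty
  · rw [h, chartInv_infty]; exact S.continuous_sphereInv.comp S.continuous_ι
  · rw [chartInv_ne S h]; exact S.continuous_ι

lemma chartInv_inj (w : 𝕊) : Injective (S.chartInv w) := by
  by_cases h : w = S.infty
  · rw [h, chartInv_infty]; exact (sphereInv_inj S).comp S.injective_ι
  · rw [chartInv_ne S h]; exact S.injective_ι

lemma chartInv_open (w : 𝕊) : IsOpenMap (S.chartInv w) := by
  by_cases h : w = S.infty
  · rw [h, chartInv_infty]; exact (sphereInv_open S).comp S.isOpenMap_ι
  · rw [chartInv_ne S h]; exact S.isOpenMap_ι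

lemma chartInv_emb (w : 𝕊) : IsOpenEmbedding (S.chartInv w) :=
  .of_continuous_injective_isOpenMap (chartInv_cont S w) (chartInv_inj S w) (chartInv_open S w)

lemma chart_chartInv (w : 𝕊) (t : ℂ) : S.chart w (S.chartInv w t) = t := by
  by_cases h : w = S.infty
  · rw [h, chartInv_infty, chart_infty]; simp [S.sphereInv_invol, toC_ι]
  · rw [chartInv_ne S h, chart_ne S h, toC_ι]

lemma chartInv_chart {w x : 𝕊} (h : x ∈ range (S.chartInv w)) : S.chartInv w (S.chart w x) = x := by
  obtain ⟨t, rfl⟩ := h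
  rw [chart_chartInv]

lemma mem_range_chartInv (w : 𝕊) : w ∈ range (S.chartInv w) := by
  by_cases h : w = S.infty
  · rw [h, chartInv_infty]; exact ⟨0, S.sphereInv_zero⟩
  · rw [chartInv_ne S h]; exact exists_ι S h

lemma chartInv_chart_self (w : 𝕊) : S.chartInv w (S.chart w w) = w :=
  chartInv_chart S (mem_range_chartInv S w)

lemma isOpen_range_chartInv (w : 𝕊) : IsOpen (range (S.chartInv w)) := (chartInv_open S w).isOpen_range

lemma chart_continuousAt {w x : 𝕊} (h : x ∈ range (S.chartInv w)) : ContinuousAt (S.chart w) x := by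
  obtain ⟨t, rfl⟩ := h
  rw [(chartInv_emb S w).continuousAt_iff.symm]
  have : S.chart w ∘ S.chartInv w = id := funext (chart_chartInv S w)
  rw [this]; exact continuousAt_id

lemma transition {b w : 𝕊} {t : ℂ} (h : S.chartInv b t ∈ range (S.chartInv w)) :
    AnalyticAt ℂ (S.chart w ∘ S.chartInv b) t := by
  have inv_case : ∀ t : ℂ, t ≠ 0 → AnalyticAt ℂ (fun t => S.toC (S.sphereInv (S.ι t))) t := by
    intro t ht
    have : (fun t => S.toC (S.sphereInv (S.ι t))) =ᶠ[𝓝 t] fun t => t⁻¹ := by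
      filter_upwards [isOpen_ne.mem_nhds ht] with τ hτ
      rw [S.sphereInv_ι _ hτ, toC_ι]
    exact (analyticAt_id.inv ht).congr this.symm
  by_cases hb : b = S.infty <;> by_cases hw : w = S.infty
  · rw [hb, hw]
    have : S.chart S.infty ∘ S.chartInv S.infty = id := funext (chart_chartInv S _)
    rw [this]; exact analyticAt_id
  · rw [hb, chart_ne S hw, chartInv_infty]
    rw [hb, chartInv_ne S hw, S.range_ι, chartInv_infty] at h
    apply inv_case
    rintro rfl
    exact h S.sphereInv_zero
  · rw [hw, chartInv_ne S hb, chart_infty]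
    apply inv_case
    rintro rfl
    rw [chartInv_ne S hb, hw, chartInv_infty] at h
    obtain ⟨τ, hτ⟩ := h
    have : S.ι τ = S.infty := by
      apply sphereInv_inj S
      rw [S.sphereInv_infty]; exact hτ
    exact ι_ne_infty S τ this
  · rw [chart_ne S hw, chartInv_ne S hb]
    have : S.toC ∘ S.ι = id := funext (toC_ι S)
    rw [this]; exact analyticAt_id

/-- holomorphic curves in the sphere -/
def HolC (h : ℂ → 𝕊) (t : ℂ) : Prop := ContinuousAt h t ∧ AnalyticAt ℂ (S.chart (h t) ∘ h) t

variable {S}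

lemma HolC.congr {h k : ℂ → 𝕊} {t : ℂ} (hh : HolC S h t) (e : h =ᶠ[𝓝 t] k) : HolC S k t := by
  refine ⟨hh.1.congr e, ?_⟩
  have := hh.2
  rw [e.self_of_nhds] at this
  exact this.congr (e.fun_comp _)

lemma HolC.chart_an {h : ℂ → 𝕊} {t : ℂ} (hh : HolC S h t) {b : 𝕊}
    (hb : h t ∈ range (S.chartInv b)) : AnalyticAt ℂ (S.chart b ∘ h) t := by
  have e : S.chart b ∘ h =ᶠ[𝓝 t] (S.chart b ∘ S.chartInv (h t)) ∘ (S.chart (h t) ∘ h) := by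
    filter_upwards [hh.1 ((isOpen_range_chartInv S (h t)).mem_nhds (mem_range_chartInv S _))] with τ hτ
    simp only [comp_apply]
    rw [chartInv_chart S hτ]
  refine AnalyticAt.congr ?_ e.symm
  apply AnalyticAt.comp _ hh.2
  apply transition
  simp only [comp_apply]
  rwa [chartInv_chart_self]

lemma HolC.of_chartInv {u : ℂ → ℂ} {t : ℂ} (hu : AnalyticAt ℂ u t) (b : 𝕊) :
    HolC S (S.chartInv b ∘ u) t := by
  refine ⟨(chartInv_cont S b).continuousAt.comp hu.continuousAt, ?_⟩
  rw [← comp_assoc]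
  exact (transition S (mem_range_chartInv S _)).comp hu

lemma HolC.chartInv (b : 𝕊) (t : ℂ) : HolC S (S.chartInv b) t :=
  HolC.of_chartInv (u := id) analyticAt_id b

lemma HolC.comp {F : 𝕊 → 𝕊} {h : ℂ → 𝕊} {t : ℂ} (hF : S.HolAt F (h t)) (hh : HolC S h t) :
    HolC S (F ∘ h) t := by
  refine ⟨hF.1.comp hh.1, ?_⟩
  have e : S.chart ((F ∘ h) t) ∘ F ∘ h =ᶠ[𝓝 t]
      (S.chart (F (h t)) ∘ F ∘ S.chartInv (h t)) ∘ (S.chart (h t) ∘ h) := by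
    filter_upwards [hh.1 ((isOpen_range_chartInv S (h t)).mem_nhds (mem_range_chartInv S _))] with τ hτ
    simp only [comp_apply]
    rw [chartInv_chart S hτ]
  exact (AnalyticAt.comp (g := S.chart (F (h t)) ∘ F ∘ S.chartInv (h t)) (f := S.chart (h t) ∘ h)
    hF.2 hh.2).congr e.symm

lemma HolC.comp_an {h : ℂ → 𝕊} {u : ℂ → ℂ} {t : ℂ} (hh : HolC S h (u t)) (hu : AnalyticAt ℂ u t) :
    HolC S (h ∘ u) t :=
  ⟨hh.1.comp hu.continuousAt, AnalyticAt.comp (g := S.chart (h (u t)) ∘ h) (f := u) hh.2 hu⟩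

lemma holAt_of_holC {F : 𝕊 → 𝕊} {b : 𝕊} {t : ℂ} (h : HolC S (F ∘ S.chartInv b) t) :
    S.HolAt F (S.chartInv b t) := by
  refine ⟨?_, ?_⟩
  · rw [← (chartInv_emb S b).continuousAt_iff]; exact h.1
  · have h1 : AnalyticAt ℂ (S.chart b ∘ S.chartInv (S.chartInv b t))
      (S.chart (S.chartInv b t) (S.chartInv b t)) := by
      apply transition
      rw [chartInv_chart_self]; exact ⟨t, rfl⟩
    have e1 : (S.chart b ∘ S.chartInv (S.chartInv b t))
      (S.chart (S.chartInv b t) (S.chartInv b t)) = t := by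
      simp only [comp_apply]
      rw [chartInv_chart_self, chart_chartInv]
    have h2 := AnalyticAt.comp (g := S.chart ((F ∘ S.chartInv b) t) ∘ (F ∘ S.chartInv b))
      (f := S.chart b ∘ S.chartInv (S.chartInv b t))
      (x := (S.chart (S.chartInv b t) (S.chartInv b t))) (by rw [e1]; exact h.2) h1
    refine h2.congr ?_
    have h3 : ∀ᶠ τ in 𝓝 (S.chart (S.chartInv b t) (S.chartInv b t)),
        S.chartInv (S.chartInv b t) τ ∈ range (S.chartInv b) := by
      apply (chartInv_cont S _).continuousAt
      rw [chartInv_chart_self]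
      exact (isOpen_range_chartInv S b).mem_nhds ⟨t, rfl⟩
    filter_upwards [h3] with τ hτ
    simp only [comp_apply]
    rw [chartInv_chart S hτ]

lemma holC_of_holAt {F : 𝕊 → 𝕊} {b : 𝕊} {t : ℂ} (h : S.HolAt F (S.chartInv b t)) :
    HolC S (F ∘ S.chartInv b) t := HolC.comp h (HolC.chartInv b t)

lemma holAt_comp {F G : 𝕊 → 𝕊} {x : 𝕊} (hF : S.HolAt F (G x)) (hG : S.HolAt G x) :
    S.HolAt (F ∘ G) x := by
  rw [← chartInv_chart_self S x] at hF hG ⊢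
  apply holAt_of_holC
  exact HolC.comp (h := G ∘ S.chartInv x) hF (holC_of_holAt hG)

lemma holAt_id (x : 𝕊) : S.HolAt id x := by
  rw [← chartInv_chart_self S x]
  exact holAt_of_holC (HolC.chartInv x _)

lemma holAt_const (a x : 𝕊) : S.HolAt (fun _ => a) x :=
  ⟨continuousAt_const, by
    have : S.chart a ∘ (fun _ => a) ∘ S.chartInv x = fun _ => S.chart a a := rfl
    rw [this]; exact analyticAt_const⟩

lemma exists_chart (x : 𝕊) : ∃ t, S.ι t = x ∨ S.chartInv S.infty t = x := by
  by_cases h : x = S.infty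
  · exact ⟨0, Or.inr (by rw [chartInv_infty, h]; exact S.sphereInv_zero)⟩
  · obtain ⟨t, ht⟩ := exists_ι S h
    exact ⟨t, Or.inl ht⟩

lemma chartInv_ι0 : S.chartInv (S.ι 0) = S.ι := chartInv_ne S (ι_ne_infty S 0)

lemma holAt_sphereInv (x : 𝕊) : S.HolAt S.sphereInv x := by
  obtain ⟨t, rfl | rfl⟩ := exists_chart (S := S) x
  · rw [← chartInv_ι0 (S := S)]
    apply holAt_of_holC
    have : S.sphereInv ∘ S.chartInv (S.ι 0) = S.chartInv S.infty := by
      rw [chartInv_ι0, chartInv_infty]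
    rw [this]
    exact HolC.chartInv _ _
  · apply holAt_of_holC
    have : S.sphereInv ∘ S.chartInv S.infty = S.chartInv (S.ι 0) := by
      rw [chartInv_ι0, chartInv_infty]
      funext t; exact S.sphereInv_invol _
    rw [this]
    exact HolC.chartInv _ _

open Classical in
/-- translations of the sphere -/
noncomputable def trans (S : SphereModel 𝕊) (a : ℂ) (x : 𝕊) : 𝕊 :=
  if x = S.infty then S.infty else S.ι (S.toC x + a)

lemma trans_ι (a t : ℂ) : trans S a (S.ι t) = S.ι (t + a) := by
  simp [trans, ι_ne_infty, toC_ι]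

lemma trans_infty (a : ℂ) : trans S a S.infty = S.infty := by simp [trans]

lemma trans_trans (a : ℂ) (x : 𝕊) : trans S (-a) (trans S a x) = x := by
  by_cases h : x = S.infty
  · simp [h, trans_infty]
  · obtain ⟨t, rfl⟩ := exists_ι S h
    simp [trans_ι]

lemma holAt_trans (a : ℂ) (x : 𝕊) : S.HolAt (trans S a) x := by
  by_cases h : x = S.infty
  · have hx : x = S.chartInv S.infty 0 := by
      rw [chartInv_infty, h]; exact S.sphereInv_zero.symm
    rw [hx]
    apply holAt_of_holC
    have h1 : AnalyticAt ℂ (fun τ : ℂ => τ / (1 + a * τ)) 0 := by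
      apply AnalyticAt.div analyticAt_id
      · fun_prop
      · simp
    refine (HolC.of_chartInv h1 S.infty).congr ?_
    have h2 : ∀ᶠ τ : ℂ in 𝓝 0, 1 + a * τ ≠ 0 := by
      have : ContinuousAt (fun τ : ℂ => 1 + a * τ) 0 := by fun_prop
      exact this.eventually_ne (by simp)
    filter_upwards [h2] with τ hτ
    simp only [comp_apply, chartInv_infty]
    by_cases h0 : τ = 0
    · simp [h0, S.sphereInv_zero, trans_infty]
    · rw [S.sphereInv_ι _ h0, trans_ι, S.sphereInv_ι _ (div_ne_zero h0 hτ)]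
      congr 1
      field_simp
  · obtain ⟨t, rfl⟩ := exists_ι S h
    rw [← chartInv_ι0 (S := S)]
    apply holAt_of_holC
    have h1 : AnalyticAt ℂ (fun τ : ℂ => τ + a) t := by fun_prop
    refine (HolC.of_chartInv h1 (S.ι 0)).congr ?_
    filter_upwards with τ
    simp only [comp_apply, chartInv_ι0, trans_ι]

variable (S) in
/-- Möbius-type pairs -/
structure Mob (M M' : 𝕊 → 𝕊) : Prop where
  hol : ∀ x, S.HolAt M x
  hol' : ∀ x, S.HolAt M' x
  left : ∀ x, M' (M x) = x
  right : ∀ x, M (M' x) = x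

lemma Mob.comp {M M' N N' : 𝕊 → 𝕊} (h : Mob S M M') (k : Mob S N N') :
    Mob S (M ∘ N) (N' ∘ M') where
  hol x := holAt_comp (h.hol _) (k.hol _)
  hol' x := holAt_comp (k.hol' _) (h.hol' _)
  left x := by simp [h.left, k.left]
  right x := by simp [h.right, k.right]

lemma Mob.trans (a : ℂ) : Mob S (trans S a) (NiceSet.trans S (-a)) where
  hol := holAt_trans a
  hol' := holAt_trans (-a)
  left := trans_trans a
  right x := by simpa using trans_trans (S := S) (-a) x

lemma Mob.inv : Mob S S.sphereInv S.sphereInv where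
  hol := holAt_sphereInv
  hol' := holAt_sphereInv
  left := S.sphereInv_invol
  right := S.sphereInv_invol

lemma Mob.cont {M M' : 𝕊 → 𝕊} (h : Mob S M M') : Continuous M :=
  continuous_iff_continuousAt.mpr fun x => (h.hol x).1
lemma Mob.cont' {M M' : 𝕊 → 𝕊} (h : Mob S M M') : Continuous M' :=
  continuous_iff_continuousAt.mpr fun x => (h.hol' x).1
lemma Mob.symm {M M' : 𝕊 → 𝕊} (h : Mob S M M') : Mob S M' M := ⟨h.hol', h.hol, h.right, h.left⟩
lemma Mob.inj {M M' : 𝕊 → 𝕊} (h : Mob S M M') : Injective M :=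
  (show LeftInverse M' M from h.left).injective

variable (S)

lemma exists_mob_infty (b : 𝕊) : ∃ M M', Mob S M M' ∧ M b = S.infty := by
  by_cases h : b = S.infty
  · refine ⟨_, _, Mob.trans 0, ?_⟩
    rw [h, trans_infty]
  · obtain ⟨t, rfl⟩ := exists_ι S h
    refine ⟨_, _, Mob.inv.comp (Mob.trans (-t)), ?_⟩
    simp [trans_ι, S.sphereInv_zero]

lemma exists_mob {a b : 𝕊} (hab : a ≠ b) :
    ∃ M M', Mob S M M' ∧ M a = S.ι 0 ∧ M b = S.infty := by
  obtain ⟨N, N', hN, hb⟩ := exists_mob_infty S b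
  have : N a ≠ S.infty := by
    rw [← hb]; exact fun h => hab (hN.inj h)
  obtain ⟨t, ht⟩ := exists_ι S this
  refine ⟨_, _, (Mob.trans (-t)).comp hN, ?_, ?_⟩
  · simp [← ht, trans_ι]
  · simp [hb, trans_infty]

end sphere
end NiceSet

namespace NiceSet

section sphere2
variable {𝕊 : Type} [MetricSpace 𝕊] [CompactSpace 𝕊] {S : SphereModel 𝕊}

lemma map_chartInv_nhds (b : 𝕊) (t : ℂ) : map (S.chartInv b) (𝓝 t) = 𝓝 (S.chartInv b t) :=
  (chartInv_emb S b).map_nhds_eq t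

lemma chart_injOn (b : 𝕊) : InjOn (S.chart b) (range (S.chartInv b)) := by
  rintro _ ⟨t, rfl⟩ _ ⟨s, rfl⟩ h
  rw [chart_chartInv, chart_chartInv] at h
  rw [h]

/-- local behaviour of holomorphic maps -/
lemma holAt_local {F : 𝕊 → 𝕊} {x : 𝕊} (hF : S.HolAt F x) :
    (∀ᶠ y in 𝓝 x, F y = F x) ∨
      ((∀ᶠ y in 𝓝[≠] x, F y ≠ F x) ∧ 𝓝 (F x) ≤ map F (𝓝 x)) := by
  set t := S.chart x x with ht
  have hxt : S.chartInv x t = x := chartInv_chart_self S x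
  set A := S.chart (F x) ∘ F ∘ S.chartInv x with hA
  have hAt : A t = S.chart (F x) (F x) := by simp only [hA, comp_apply, hxt]
  have hr : ∀ᶠ y in 𝓝 x, F y ∈ range (S.chartInv (F x)) :=
    hF.1 ((isOpen_range_chartInv S _).mem_nhds (mem_range_chartInv S _))
  have hr' : ∀ᶠ τ in 𝓝 t, F (S.chartInv x τ) ∈ range (S.chartInv (F x)) := by
    have h := hr
    rw [← hxt, ← map_chartInv_nhds, eventually_map, hxt] at h
    exact h
  rcases hF.2.eventually_eq_or_eventually_ne (analyticAt_const (v := A t)) with h | h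
  · left
    conv => rw [← hxt]
    rw [← map_chartInv_nhds, eventually_map]
    filter_upwards [h, hr'] with τ h1 h2
    rw [hxt]
    apply chart_injOn (F x) h2 (mem_range_chartInv S _)
    rw [← hAt]; exact h1
  · right
    constructor
    · rw [eventually_nhdsWithin_iff] at h ⊢
      conv => rw [← hxt]
      rw [← map_chartInv_nhds, eventually_map]
      filter_upwards [h] with τ h1 h2 h3
      rw [hxt] at h3
      apply h1
      · intro h4
        apply h2
        rw [mem_singleton_iff, h4]
      · show S.chart (F x) (F (S.chartInv x τ)) = A t
        rw [h3, hAt]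
    · have h2 := hF.2.eventually_constant_or_nhds_le_map_nhds.resolve_left (by
        intro h3
        have h4 : ∀ᶠ τ in 𝓝[≠] t, A τ = A t := h3.filter_mono nhdsWithin_le_nhds
        obtain ⟨τ, h5, h6⟩ := (h4.and h).exists
        exact h6 h5)
      have h3 : map (S.chartInv (F x)) (𝓝 (A t)) = 𝓝 (F x) := by
        rw [map_chartInv_nhds, hAt, chartInv_chart_self]
      rw [← h3]
      refine (map_mono h2).trans ?_
      rw [map_map]
      have h4 : S.chartInv (F x) ∘ A =ᶠ[𝓝 t] F ∘ S.chartInv x := by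
        filter_upwards [hr'] with τ hτ
        exact chartInv_chart S hτ
      rw [map_congr h4, ← map_map, map_chartInv_nhds, hxt]

lemma deriv_locInj {Φ : ℂ → ℂ} {t : ℂ} (h : AnalyticAt ℂ Φ t) (h0 : deriv Φ t ≠ 0) :
    ∃ V ∈ 𝓝 t, InjOn Φ V := by
  have h1 := h.hasStrictDerivAt
  have h2 := h1.hasStrictFDerivAt_equiv h0
  exact ⟨_, (h2.toOpenPartialHomeomorph Φ).open_source.mem_nhds h2.mem_toOpenPartialHomeomorph_source,
    (h2.toOpenPartialHomeomorph Φ).injOn⟩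

lemma section_holC {F : 𝕊 → 𝕊} {h : ℂ → 𝕊} {b : 𝕊} {t : ℂ} (hF : S.HolAt F (h t))
    (hc : ∀ᶠ τ in 𝓝 t, ContinuousAt h τ) (e : ∀ᶠ τ in 𝓝 t, F (h τ) = S.chartInv b τ) :
    HolC S h t ∧ ∃ V ∈ 𝓝 (h t), InjOn F V := by
  set x := h t with hx
  set Φ := S.chart b ∘ F ∘ S.chartInv x with hΦ
  set u := S.chart x ∘ h with hu
  have hut : S.chartInv x (u t) = x := chartInv_chart_self S x
  have hht : ContinuousAt h t := hc.self_of_nhds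
  have hΦa : AnalyticAt ℂ Φ (u t) := by
    apply HolC.chart_an
    · apply holC_of_holAt; rw [hut]; exact hF
    · simp only [comp_apply, hut]
      exact ⟨t, e.self_of_nhds.symm⟩
  have hr : ∀ᶠ τ in 𝓝 t, h τ ∈ range (S.chartInv x) :=
    hht ((isOpen_range_chartInv S _).mem_nhds (mem_range_chartInv S _))
  have huc : ∀ᶠ τ in 𝓝 t, ContinuousAt u τ := by
    filter_upwards [hc, hr] with τ h1 h2
    exact (chart_continuousAt S h2).comp h1
  have hue : ∀ᶠ τ in 𝓝 t, Φ (u τ) = τ := by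
    filter_upwards [e, hr] with τ h1 h2
    simp only [hΦ, hu, comp_apply]
    rw [chartInv_chart S h2, h1, chart_chartInv]
  obtain ⟨h1, h2, -⟩ := section_analytic hΦa huc hue
  refine ⟨⟨hht, h1⟩, ?_⟩
  obtain ⟨V, hV, hinj⟩ := deriv_locInj hΦa h2
  refine ⟨S.chartInv x '' V, ?_, ?_⟩
  · have := image_mem_map (m := S.chartInv x) hV
    rwa [map_chartInv_nhds, hut] at this
  · rintro _ ⟨p, hp, rfl⟩ _ ⟨q, hq, rfl⟩ h3
    rw [hinj hp hq]
    simp only [hΦ, comp_apply, h3]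

lemma sec_unique {X Y Z : Type*} [TopologicalSpace X] [TopologicalSpace Y] [T2Space Y] {F : Y → Z}
    {A : Set X} (hA : IsPreconnected A) {g₁ g₂ : X → Y} (h₁ : ContinuousOn g₁ A)
    (h₂ : ContinuousOn g₂ A) (he : ∀ a ∈ A, F (g₁ a) = F (g₂ a))
    (hl : ∀ a ∈ A, ∃ V ∈ 𝓝 (g₁ a), InjOn F V) {a₀ : X} (ha₀ : a₀ ∈ A) (h0 : g₁ a₀ = g₂ a₀) :
    EqOn g₁ g₂ A := by
  have : PreconnectedSpace A := isPreconnected_iff_preconnectedSpace.mp hA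
  have c1 := continuousOn_iff_continuous_domRestrict.mp h₁
  have c2 := continuousOn_iff_continuous_domRestrict.mp h₂
  have hcl : IsClopen {a : A | A.domRestrict g₁ a = A.domRestrict g₂ a} := by
    refine ⟨isClosed_eq c1 c2, ?_⟩
    rw [isOpen_iff_mem_nhds]
    intro a ha
    obtain ⟨V, hV, hinj⟩ := hl a a.2
    have e1 : ∀ᶠ b in 𝓝 a, A.domRestrict g₁ b ∈ V := c1.continuousAt hV
    have e2 : ∀ᶠ b in 𝓝 a, A.domRestrict g₂ b ∈ V := c2.continuousAt (by
      have : A.domRestrict g₂ a = g₁ a := ha.symm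
      rw [this]; exact hV)
    filter_upwards [e1, e2] with b h3 h4
    exact hinj h3 h4 (he b b.2)
  have hu := hcl.eq_univ ⟨⟨a₀, ha₀⟩, h0⟩
  intro a ha
  have : (⟨a, ha⟩ : A) ∈ {a : A | A.domRestrict g₁ a = A.domRestrict g₂ a} := by rw [hu]; trivial
  exact this

variable {f : 𝕊 → 𝕊}

lemma dom_cases (hf : S.MeroOrRat f) : S.dom f = univ ∨ (S.dom f = {S.infty}ᶜ ∧ S.TranscendentalDyn f) := by
  rcases hf with h | h
  · right
    refine ⟨?_, h⟩
    ext x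
    constructor
    · intro hx hxi
      rw [mem_singleton_iff] at hxi
      subst hxi
      exact h.2 ⟨f, fun _ => rfl, hx⟩
    · intro hx
      obtain ⟨t, rfl⟩ := exists_ι S hx
      exact h.1 t
  · left
    ext x; exact ⟨fun _ => trivial, fun _ => h.1 x⟩

lemma dom_open (hf : S.MeroOrRat f) : IsOpen (S.dom f) := by
  rcases dom_cases hf with h | ⟨h, -⟩
  · rw [h]; exact isOpen_univ
  · rw [h]; exact isOpen_compl_singleton

lemma preconn_range_ι : IsPreconnected ({S.infty}ᶜ : Set 𝕊) := by
  rw [← S.range_ι]; exact isPreconnected_range S.continuous_ι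

lemma ι_dense : closure (range S.ι) = univ := by
  apply eq_univ_of_forall
  intro x
  obtain ⟨t, rfl | rfl⟩ := exists_chart (S := S) x
  · exact subset_closure ⟨t, rfl⟩
  · rw [mem_closure_iff_nhds]
    intro V hV
    have h1' : ∀ᶠ τ in 𝓝 t, S.chartInv S.infty τ ∈ V := (chartInv_cont S S.infty).continuousAt hV
    have h1 : ∀ᶠ τ in 𝓝[≠] t, S.chartInv S.infty τ ∈ V := h1'.filter_mono nhdsWithin_le_nhds
    have h2 : ∀ᶠ τ in 𝓝[≠] t, τ ≠ 0 := by
      by_cases h0 : t = 0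
      · rw [h0]; exact self_mem_nhdsWithin
      · have h2' : ∀ᶠ τ in 𝓝 t, τ ≠ 0 := isOpen_ne.mem_nhds h0
        exact h2'.filter_mono nhdsWithin_le_nhds
    obtain ⟨τ, h3, h4⟩ := (h1.and h2).exists
    refine ⟨_, h3, ?_⟩
    rw [chartInv_infty]
    exact ⟨τ⁻¹, (S.sphereInv_ι τ h4).symm⟩

lemma preconn_univ (S : SphereModel 𝕊) : IsPreconnected (univ : Set 𝕊) := by
  rw [← ι_dense (S := S), S.range_ι]
  exact preconn_range_ι.closure

lemma dom_preconn (hf : S.MeroOrRat f) : IsPreconnected (S.dom f) := by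
  rcases dom_cases hf with h | ⟨h, -⟩
  · rw [h]; exact preconn_univ S
  · rw [h]; exact preconn_range_ι

lemma dom_nonempty (hf : S.MeroOrRat f) : (S.dom f).Nonempty := by
  refine ⟨S.ι 0, ?_⟩
  rcases dom_cases hf with h | ⟨h, -⟩
  · rw [h]; trivial
  · rw [h]; exact ι_ne_infty S 0

/-- a holomorphic map is nowhere locally constant -/
lemma not_loc_const (hf : S.MeroOrRat f) {x : 𝕊} (hx : x ∈ S.dom f) : ¬ ∀ᶠ y in 𝓝 x, f y = f x := by
  intro hconst
  have : PreconnectedSpace (S.dom f) := isPreconnected_iff_preconnectedSpace.mp (dom_preconn hf)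
  have hnh : ∀ x : S.dom f, map (Subtype.val) (𝓝 x) = 𝓝 (x : 𝕊) := fun x =>
    (dom_open hf).isOpenEmbedding_subtypeVal.map_nhds_eq x
  set L : Set (S.dom f) := {x | ∀ᶠ y in 𝓝 (x : 𝕊), f y = f x} with hL
  have hopen : IsOpen L := by
    rw [isOpen_iff_mem_nhds]
    intro a ha
    have h1 : ∀ᶠ b in 𝓝 (a : 𝕊), ∀ᶠ y in 𝓝 b, f y = f a := Filter.Eventually.eventually_nhds ha
    rw [← hnh, eventually_map] at h1
    filter_upwards [h1] with b hb
    have := hb.self_of_nhds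
    filter_upwards [hb] with y hy
    rw [hy, this]
  have hclosed : IsClosed L := by
    rw [← isOpen_compl_iff, isOpen_iff_mem_nhds]
    intro a ha
    have h1 := (holAt_local (F := f) (show S.HolAt f a from a.2)).resolve_left ha
    have hE : ∀ᶠ b in 𝓝[≠] (a : 𝕊), ¬ ∀ᶠ y in 𝓝 b, f y = f b := by
      -- chart computation
      by_contra hcon
      have hfreq : ∃ᶠ b in 𝓝[≠] (a : 𝕊), ∀ᶠ y in 𝓝 b, f y = f b := by
        rw [not_eventually] at hcon
        exact hcon.mono fun b hb => not_not.mp hb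
      set t := S.chart a a
      have hat : S.chartInv (a : 𝕊) t = a := chartInv_chart_self S _
      set A := S.chart (f a) ∘ f ∘ S.chartInv (a : 𝕊) with hA
      have hAn : AnalyticAt ℂ A t := (show S.HolAt f a from a.2).2
      have hfr2 : ∃ᶠ τ in 𝓝[≠] t, deriv A τ = 0 := by
        rw [frequently_nhdsWithin_iff] at hfreq ⊢
        rw [← hat, ← map_chartInv_nhds, frequently_map] at hfreq
        refine hfreq.mono ?_
        rintro τ ⟨h2, h3⟩
        refine ⟨?_, fun h4 => h3 (by rw [mem_singleton_iff] at h4; rw [h4]; rfl)⟩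
        rw [← map_chartInv_nhds, eventually_map] at h2
        have : A =ᶠ[𝓝 τ] fun _ => A τ := by
          filter_upwards [h2] with σ hσ
          simp only [hA, comp_apply, hσ]
        rw [this.deriv_eq]; simp
      have hz := (hAn.deriv.eventually_eq_zero_or_eventually_ne_zero).resolve_right (by
        intro h; exact hfr2 h)
      obtain ⟨r, hr, hball⟩ := Metric.eventually_nhds_iff_ball.mp (hz.and hAn.eventually_analyticAt)
      have hcc : ∀ᶠ τ in 𝓝 t, A τ = A t := by
        filter_upwards [ball_mem_nhds t hr] with τ hτ
        have h1 := (convex_ball t r).norm_image_sub_le_of_norm_hasDerivWithin_le (C := 0)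
          (f := A) (f' := fun _ => 0)
          (fun w hw => by
            have := (hball w hw).2.differentiableAt.hasDerivAt
            rw [(hball w hw).1] at this
            exact this.hasDerivWithinAt) (by simp) (mem_ball_self hr) hτ
        simpa [sub_eq_zero] using h1
      have h5 := h1.1
      rw [eventually_nhdsWithin_iff] at h5
      rw [← hat, ← map_chartInv_nhds, eventually_map, hat] at h5
      have h6 : ∀ᶠ τ in 𝓝 t, f (S.chartInv (a : 𝕊) τ) ∈ range (S.chartInv (f a)) := by
        have : ContinuousAt (f ∘ S.chartInv (a : 𝕊)) t :=
          (holC_of_holAt (by rw [hat]; exact a.2)).1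
        apply this
        simp only [comp_apply, hat]
        exact (isOpen_range_chartInv S _).mem_nhds (mem_range_chartInv S _)
      have h7 : ∀ᶠ τ in 𝓝[≠] t, False := by
        filter_upwards [h5.filter_mono nhdsWithin_le_nhds, hcc.filter_mono nhdsWithin_le_nhds,
          h6.filter_mono nhdsWithin_le_nhds, self_mem_nhdsWithin] with τ h8 h9 h10 h11
        apply h8
        · intro h12
          apply h11
          apply chartInv_inj S (a : 𝕊)
          rw [mem_singleton_iff] at h12
          rw [h12, hat]
        · apply chart_injOn (f a) h10 (mem_range_chartInv S _)
          have : A t = S.chart (f a) (f a) := by simp only [hA, comp_apply, hat]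
          rw [← this]; exact h9
      exact h7.exists.choose_spec
    rw [eventually_nhdsWithin_iff, ← hnh, eventually_map] at hE
    filter_upwards [hE] with b hb
    by_cases hba : b = a
    · rw [hba]; exact ha
    · exact hb (fun h => hba (Subtype.ext h))
  have hLu : L = univ := IsClopen.eq_univ ⟨hclosed, hopen⟩ ⟨⟨x, hx⟩, hconst⟩
  have hloc : IsLocallyConstant (fun y : S.dom f => f y) := by
    rw [IsLocallyConstant.iff_eventually_eq]
    intro y
    have hy : y ∈ L := by rw [hLu]; trivial
    have hy' : ∀ᶠ w in 𝓝 (y : 𝕊), f w = f y := hy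
    rw [← hnh, eventually_map] at hy'
    exact hy'
  have hall : ∀ y ∈ S.dom f, f y = f x := fun y hy =>
    hloc.apply_eq_of_preconnectedSpace ⟨y, hy⟩ ⟨x, hx⟩
  rcases hf with h | h
  · apply h.2
    refine ⟨fun _ => f x, fun t => (hall _ (h.1 t)).symm, holAt_const _ _⟩
  · exact h.2.1 (f x) (funext fun y => hall y (h.1 y))

lemma f_nhds (hf : S.MeroOrRat f) {x : 𝕊} (hx : x ∈ S.dom f) : 𝓝 (f x) ≤ map f (𝓝 x) :=
  ((holAt_local (F := f) hx).resolve_left (not_loc_const hf hx)).2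

lemma f_isolated (hf : S.MeroOrRat f) {x : 𝕊} (hx : x ∈ S.dom f) : ∀ᶠ y in 𝓝[≠] x, f y ≠ f x :=
  ((holAt_local (F := f) hx).resolve_left (not_loc_const hf hx)).1

/-! iterates -/

lemma defined_succ {x : 𝕊} {m : ℕ} (h : S.DefinedUpTo f x (m + 1)) :
    x ∈ S.dom f ∧ S.DefinedUpTo f (f x) m :=
  ⟨h 0 (by omega), fun i hi => by have := h (i + 1) (by omega); rwa [iterate_succ_apply] at this⟩

lemma defined_succ' {x : 𝕊} {m : ℕ} (h : x ∈ S.dom f) (h2 : S.DefinedUpTo f (f x) m) :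
    S.DefinedUpTo f x (m + 1) := by
  intro i hi
  cases i with
  | zero => exact h
  | succ j => rw [iterate_succ_apply]; exact h2 j (by omega)

lemma defined_add {x : 𝕊} {m k : ℕ} : S.DefinedUpTo f x (m + k) ↔
    S.DefinedUpTo f x m ∧ S.DefinedUpTo f (f^[m] x) k := by
  constructor
  · intro h
    refine ⟨fun i hi => h i (by omega), fun i hi => ?_⟩
    rw [← iterate_add_apply, add_comm]
    exact h _ (by omega)
  · rintro ⟨h1, h2⟩ i hi
    by_cases h : i < m
    · exact h1 i h
    · have := h2 (i - m) (by omega)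
      rwa [← iterate_add_apply, Nat.sub_add_cancel (by omega)] at this

lemma defined_mono {x : 𝕊} {m k : ℕ} (h : S.DefinedUpTo f x k) (hm : m ≤ k) : S.DefinedUpTo f x m :=
  fun i hi => h i (by omega)

lemma holAt_iter {x : 𝕊} {m : ℕ} (h : S.DefinedUpTo f x m) : S.HolAt (f^[m]) x := by
  induction m generalizing x with
  | zero => exact holAt_id x
  | succ m ih =>
    obtain ⟨h1, h2⟩ := defined_succ h
    exact holAt_comp (G := f) (ih h2) h1

lemma defined_nhds (hf : S.MeroOrRat f) {x : 𝕊} {m : ℕ} (h : S.DefinedUpTo f x m) :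
    ∀ᶠ y in 𝓝 x, S.DefinedUpTo f y m := by
  induction m with
  | zero => exact Eventually.of_forall fun y i hi => by omega
  | succ m ih =>
    have h1 := ih (defined_mono h (by omega))
    have h2 := (holAt_iter (defined_mono h (Nat.le_succ m))).1 ((dom_open hf).mem_nhds (h m (by omega)))
    filter_upwards [h1, h2] with y h3 h4 i hi
    by_cases h5 : i < m
    · exact h3 i h5
    · have : i = m := by omega
      rw [this]; exact h4

lemma iter_nhds (hf : S.MeroOrRat f) {x : 𝕊} {m : ℕ} (h : S.DefinedUpTo f x m) :
    𝓝 (f^[m] x) ≤ map (f^[m]) (𝓝 x) := by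
  induction m generalizing x with
  | zero => simp
  | succ m ih =>
    obtain ⟨h1, h2⟩ := defined_succ h
    rw [iterate_succ_apply, iterate_succ, ← map_map]
    exact (ih h2).trans (map_mono (f_nhds hf h1))

/-! postsingular set -/
lemma sing_subset : S.singularValues f ⊆ S.postSingular f := by
  intro v hv
  apply subset_closure
  simp only [SphereModel.orbSet, mem_iUnion]
  exact ⟨v, hv, 0, fun i hi => by omega, rfl⟩

lemma post_closed : IsClosed (S.postSingular f) := isClosed_closure

lemma post_fwd (hf : S.MeroOrRat f) {x : 𝕊} (hx : x ∈ S.postSingular f) (hd : x ∈ S.dom f) :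
    f x ∈ S.postSingular f := by
  have h1 : x ∈ closure (S.orbSet f (S.singularValues f) ∩ S.dom f) := by
    have := (dom_open hf).inter_closure (t := S.orbSet f (S.singularValues f)) ⟨hd, hx⟩
    rwa [inter_comm] at this
  have h2 : f x ∈ closure (f '' (S.orbSet f (S.singularValues f) ∩ S.dom f)) :=
    mem_closure_image (show S.HolAt f x from hd).1 h1
  refine closure_mono ?_ h2
  rintro _ ⟨y, ⟨hy1, hy2⟩, rfl⟩
  simp only [SphereModel.orbSet, mem_iUnion] at hy1 ⊢
  obtain ⟨v, hv, n, hn, rfl⟩ := hy1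
  refine ⟨v, hv, n + 1, ?_, by rw [iterate_succ_apply']⟩
  rw [defined_add]
  exact ⟨hn, fun i hi => by have : i = 0 := by omega
                            rw [this]; exact hy2⟩

lemma post_fwd_iter (hf : S.MeroOrRat f) {x : 𝕊} {m : ℕ} (hx : x ∈ S.postSingular f)
    (hd : S.DefinedUpTo f x m) : f^[m] x ∈ S.postSingular f := by
  induction m generalizing x with
  | zero => exact hx
  | succ m ih =>
    obtain ⟨h1, h2⟩ := defined_succ hd
    exact ih (post_fwd hf hx h1) h2

end sphere2
end NiceSet

namespace NiceSet

lemma cov_of_sections {E X : Type*} [TopologicalSpace E] [T2Space E] [TopologicalSpace X] {p : E → X}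
    (hp : Continuous p) {V : Set X} (hV : IsOpen V) (hVc : IsPreconnected V) {v : X} (hv : v ∈ V)
    (hsec : ∀ x, p x ∈ V → ∃ g : X → E, ContinuousOn g V ∧ g (p x) = x ∧ ∀ w ∈ V, p (g w) = w)
    (hinj : ∀ x, p x ∈ V → ∃ N ∈ 𝓝 x, InjOn p N) : IsEvenlyCovered p v (p ⁻¹' {v}) := by
  have hsec' : ∀ x, ∃ g : X → E, p x ∈ V → ContinuousOn g V ∧ g (p x) = x ∧ ∀ w ∈ V, p (g w) = w := by
    intro x
    by_cases h : p x ∈ V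
    · obtain ⟨g, hg⟩ := hsec x h
      exact ⟨g, fun _ => hg⟩
    · exact ⟨fun _ => x, fun h' => absurd h' h⟩
  choose g hg using hsec'
  have hgc : ∀ x, p x ∈ V → ContinuousOn (g x) V := fun x h => (hg x h).1
  have hg1 : ∀ x, p x ∈ V → g x (p x) = x := fun x h => (hg x h).2.1
  have hg2 : ∀ x, p x ∈ V → ∀ w ∈ V, p (g x w) = w := fun x h => (hg x h).2.2
  have hex : ∀ y, p y ∈ V → ∃ x, p x = v ∧ EqOn (g x) (g y) V := by
    intro y hy
    have h1 : p (g y v) = v := hg2 y hy v hv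
    have h2 : p (g y v) ∈ V := by rw [h1]; exact hv
    refine ⟨g y v, h1, ?_⟩
    refine sec_unique (F := p) hVc (hgc _ h2) (hgc _ hy) ?_ ?_ hv ?_
    · intro a ha; rw [hg2 _ h2 a ha, hg2 _ hy a ha]
    · intro a ha; apply hinj; rw [hg2 _ h2 a ha]; exact ha
    · have := hg1 _ h2
      rwa [h1] at this
  by_cases hF : IsEmpty (p ⁻¹' {v})
  · refine IsEvenlyCovered.of_preimage_eq_empty _ (hV.mem_nhds hv) ?_
    by_contra hne
    obtain ⟨y, hy⟩ := nonempty_iff_ne_empty.mpr hne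
    obtain ⟨x, hx, -⟩ := hex y hy
    exact hF.false ⟨x, hx⟩
  rw [not_isEmpty_iff] at hF
  have hmem : ∀ x : p ⁻¹' {v}, p x ∈ V := fun x => by
    have : p x = v := x.2
    rw [this]; exact hv
  have : Nonempty (X → E) := ⟨fun _ => hF.some⟩
  letI : TopologicalSpace (p ⁻¹' {v}) := ⊥
  haveI : DiscreteTopology (p ⁻¹' {v}) := ⟨rfl⟩
  have hopen : ∀ x : p ⁻¹' {v}, IsOpen (g x '' V) := by
    intro x
    rw [isOpen_iff_mem_nhds]
    rintro _ ⟨w, hw, rfl⟩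
    have hpw := hg2 x (hmem x) w hw
    obtain ⟨N, hN, hNi⟩ := hinj (g x w) (by rw [hpw]; exact hw)
    have c1 : ContinuousAt (g x) (p (g x w)) := by
      rw [hpw]; exact (hgc _ (hmem x)).continuousAt (hV.mem_nhds hw)
    have c2 : ContinuousAt (fun y => g x (p y)) (g x w) := ContinuousAt.comp (g := g x) c1 hp.continuousAt
    have e1 : ∀ᶠ y in 𝓝 (g x w), g x (p y) ∈ N := c2 (by
      show N ∈ 𝓝 (g x (p (g x w)))
      rw [hpw]; exact hN)
    have e2 : ∀ᶠ y in 𝓝 (g x w), p y ∈ V := hp.continuousAt (by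
      rw [hpw]; exact hV.mem_nhds hw)
    filter_upwards [e1, e2, hN] with y h1 h2 h3
    exact ⟨p y, h2, hNi h1 h3 (hg2 _ (hmem x) _ h2)⟩
  have hev : IsEvenlyCovered p v (p ⁻¹' {v}) := by
    refine IsEvenlyCovered.of_trivialization (t := IsOpen.trivializationDiscrete
      (fun x : p ⁻¹' {v} => g x '' V) V hV ?_ ?_ ?_ ?_ ?_) hv
    · intro x W hW
      constructor
      · intro h; exact (h.preimage hp).inter (hopen x)
      · intro h
        have h2 := (hgc _ (hmem x)).isOpen_inter_preimage hV h
        convert h2 using 1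
        ext w
        constructor
        · intro hw
          exact ⟨hW hw, by
            show p (g x w) ∈ W
            rw [hg2 _ (hmem x) w (hW hw)]; exact hw, w, hW hw, rfl⟩
        · rintro ⟨h3, h4, -⟩
          have : p (g x w) ∈ W := h4
          rwa [hg2 _ (hmem x) w h3] at this
    · rintro x _ ⟨a, ha, rfl⟩ _ ⟨b, hb, rfl⟩ h
      rw [hg2 _ (hmem x) a ha, hg2 _ (hmem x) b hb] at h
      rw [h]
    · intro x w hw
      exact ⟨g x w, ⟨w, hw, rfl⟩, hg2 _ (hmem x) w hw⟩
    · intro x y hxy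
      rw [Function.onFun, Set.disjoint_left]
      rintro _ ⟨a, ha, rfl⟩ ⟨b, hb, hab⟩
      apply hxy
      have h1 := hg2 _ (hmem x) a ha
      rw [← hab, hg2 _ (hmem y) b hb] at h1
      subst h1
      have := sec_unique (F := p) hVc (hgc _ (hmem x)) (hgc _ (hmem y))
        (fun c hc => by rw [hg2 _ (hmem x) c hc, hg2 _ (hmem y) c hc])
        (fun c hc => hinj _ (by rw [hg2 _ (hmem x) c hc]; exact hc)) ha hab.symm hv
      have e1 := hg1 _ (hmem x)
      have e2 := hg1 _ (hmem y)
      rw [show p x = v from x.2] at e1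
      rw [show p y = v from y.2] at e2
      apply Subtype.ext
      rw [← e1, ← e2, this]
    · intro y hy
      obtain ⟨x, hx, he⟩ := hex y hy
      rw [mem_iUnion]
      exact ⟨⟨x, hx⟩, p y, hy, by rw [he hy, hg1 y hy]⟩
  exact hev.to_isEvenlyCovered_preimage

section cov
variable {𝕊 : Type} [MetricSpace 𝕊] [CompactSpace 𝕊] {S : SphereModel 𝕊} {f : 𝕊 → 𝕊}

lemma loc_inj_of_sec {F : 𝕊 → 𝕊} {g : 𝕊 → 𝕊} {V : Set 𝕊} (hV : IsOpen V) (hg : ContinuousOn g V)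
    (hh : ∀ w ∈ V, S.HolAt F (g w)) (hs : ∀ w ∈ V, F (g w) = w) {w : 𝕊} (hw : w ∈ V) :
    ∃ N ∈ 𝓝 (g w), InjOn F N := by
  set t := S.chart w w
  have hwt : S.chartInv w t = w := chartInv_chart_self S w
  have hVt : ∀ᶠ τ in 𝓝 t, S.chartInv w τ ∈ V :=
    (chartInv_cont S w).continuousAt (by rw [hwt]; exact hV.mem_nhds hw)
  have h := section_holC (S := S) (F := F) (h := g ∘ S.chartInv w) (b := w) (t := t) ?_ ?_ ?_
  · have := h.2
    simp only [comp_apply, hwt] at this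
    exact this
  · simp only [comp_apply, hwt]; exact hh w hw
  · filter_upwards [hVt] with τ hτ
    exact (hg.continuousAt (hV.mem_nhds hτ)).comp (chartInv_cont S w).continuousAt
  · filter_upwards [hVt] with τ hτ
    exact hs _ hτ

lemma f_cont (x : S.dom f) : ContinuousAt f x := (show S.HolAt f x from x.2).1

lemma fsub_cont : Continuous (fun x : S.dom f => f x) :=
  continuous_iff_continuousAt.mpr fun x => (f_cont x).comp continuous_subtype_val.continuousAt

lemma f_covering (hf : S.MeroOrRat f) :
    IsCoveringMapOn (fun x : S.dom f => f x) (S.singularValues f)ᶜ := by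
  intro v hv
  have hv' : ∃ W : Set 𝕊, IsOpen W ∧ v ∈ W ∧
      ∀ x ∈ S.dom f, f x ∈ W →
        ∃ g : 𝕊 → 𝕊, ContinuousOn g W ∧ Set.InjOn g W ∧ g (f x) = x ∧
          ∀ w ∈ W, g w ∈ S.dom f ∧ f (g w) = w := not_not.mp hv
  obtain ⟨W, hWo, hvW, hW⟩ := hv'
  have e : ∀ᶠ τ in 𝓝 (S.chart v v), S.chartInv v τ ∈ W :=
    (chartInv_cont S v).continuousAt (by rw [chartInv_chart_self]; exact hWo.mem_nhds hvW)
  obtain ⟨r, hr, hball⟩ := Metric.eventually_nhds_iff_ball.mp e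
  have hVW : S.chartInv v '' ball (S.chart v v) r ⊆ W := by
    rintro _ ⟨τ, hτ, rfl⟩; exact hball τ hτ
  have hdo := dom_open hf
  refine cov_of_sections fsub_cont (chartInv_open S v _ (isOpen_ball (x := S.chart v v) (ε := r)))
    ((convex_ball _ _).isPreconnected.image _ (chartInv_cont S v).continuousOn)
    ⟨S.chart v v, mem_ball_self hr, chartInv_chart_self S v⟩ ?_ ?_
  · rintro ⟨x, hx⟩ hfx
    obtain ⟨g, h1, h2, h3, h4⟩ := hW x hx (hVW hfx)
    classical
    refine ⟨fun w => if h : w ∈ W then ⟨g w, (h4 w h).1⟩ else ⟨x, hx⟩, ?_, ?_, ?_⟩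
    · apply ContinuousOn.mono _ hVW
      rw [Topology.IsInducing.subtypeVal.continuousOn_iff]
      refine h1.congr ?_
      intro w hw
      simp [hw]
    · have : f x ∈ W := hVW hfx
      simp [this, h3]
    · intro w hw
      have : w ∈ W := hVW hw
      simp [this, (h4 w this).2]
  · rintro ⟨x, hx⟩ hfx
    obtain ⟨g, h1, h2, h3, h4⟩ := hW x hx (hVW hfx)
    obtain ⟨N, hN, hi⟩ := loc_inj_of_sec (S := S) (F := f) hWo h1 (fun w hw => (h4 w hw).1)
      (fun w hw => (h4 w hw).2) (hVW hfx)
    rw [h3] at hN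
    refine ⟨Subtype.val ⁻¹' N, continuous_subtype_val.continuousAt hN, ?_⟩
    intro a ha b hb hab
    exact Subtype.ext (hi ha hb hab)

lemma lift_ball (hf : S.MeroOrRat f) {A : Set ℂ} (hA : Convex ℝ A) (hAo : IsOpen A) {h : ℂ → 𝕊}
    (hh : ContinuousOn h A) (hs : ∀ a ∈ A, h a ∉ S.singularValues f) {a₀ : ℂ} (ha₀ : a₀ ∈ A)
    {x₀ : 𝕊} (hx₀ : x₀ ∈ S.dom f) (h0 : f x₀ = h a₀) :
    ∃ H : ℂ → 𝕊, ContinuousOn H A ∧ H a₀ = x₀ ∧ ∀ a ∈ A, H a ∈ S.dom f ∧ f (H a) = h a := by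
  have hcov := (f_covering hf).isCoveringMap_restrictPreimage
  have : ContractibleSpace A := hA.contractibleSpace ⟨a₀, ha₀⟩
  have : LocallyPathConnectedSpace A := hAo.locallyPathConnectedSpace
  let φ : C(A, ((S.singularValues f)ᶜ : Set 𝕊)) :=
    ⟨fun a => ⟨h a, hs a a.2⟩, (continuousOn_iff_continuous_domRestrict.mp hh).subtype_mk _⟩
  have hm : f x₀ ∈ (S.singularValues f)ᶜ := by rw [h0]; exact hs _ ha₀
  obtain ⟨F, ⟨hF1, hF2⟩, -⟩ := hcov.existsUnique_continuousMap_lifts φ ⟨a₀, ha₀⟩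
    ⟨⟨x₀, hx₀⟩, hm⟩ (Subtype.ext h0)
  classical
  refine ⟨fun a => if ha : a ∈ A then ((F ⟨a, ha⟩ : S.dom f) : 𝕊) else x₀, ?_, ?_, ?_⟩
  · rw [continuousOn_iff_continuous_domRestrict]
    have : A.domRestrict (fun a => if ha : a ∈ A then ((F ⟨a, ha⟩ : S.dom f) : 𝕊) else x₀)
        = fun a : A => ((F a : S.dom f) : 𝕊) := by
      ext a; simp
    rw [this]
    exact continuous_subtype_val.comp (continuous_subtype_val.comp F.continuous)
  · simp [ha₀, hF1]
  · intro a ha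
    simp only [ha, dif_pos]
    refine ⟨(F ⟨a, ha⟩ : S.dom f).2, ?_⟩
    have := congrFun hF2 ⟨a, ha⟩
    exact congrArg Subtype.val this

lemma branch_ex (hf : S.MeroOrRat f) {A : Set ℂ} (hA : Convex ℝ A) (hAo : IsOpen A) (m : ℕ) {h : ℂ → 𝕊}
    (hh : ContinuousOn h A) (hs : ∀ a ∈ A, h a ∉ S.postSingular f) {a₀ : ℂ} (ha₀ : a₀ ∈ A)
    {x : 𝕊} (hx : S.DefinedUpTo f x m) (h0 : f^[m] x = h a₀) :
    ∃ H : ℂ → 𝕊, ContinuousOn H A ∧ H a₀ = x ∧ ∀ a ∈ A, S.DefinedUpTo f (H a) m ∧ f^[m] (H a) = h a := by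
  induction m generalizing x with
  | zero => exact ⟨h, hh, h0.symm, fun a ha => ⟨fun i hi => by omega, rfl⟩⟩
  | succ m ih =>
    obtain ⟨h1, h2⟩ := defined_succ hx
    obtain ⟨H, hH1, hH2, hH3⟩ := ih h2 (by rw [← h0, iterate_succ_apply])
    obtain ⟨K, hK1, hK2, hK3⟩ := lift_ball hf hA hAo hH1 (fun a ha hsing => by
      apply hs a ha
      rw [← (hH3 a ha).2]
      exact post_fwd_iter hf (sing_subset hsing) (hH3 a ha).1) ha₀ h1 hH2.symm
    refine ⟨K, hK1, hK2, fun a ha => ⟨defined_succ' (hK3 a ha).1 ?_, ?_⟩⟩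
    · rw [(hK3 a ha).2]; exact (hH3 a ha).1
    · rw [iterate_succ_apply, (hK3 a ha).2]; exact (hH3 a ha).2

end cov
end NiceSet

namespace NiceSet
section two
variable {𝕊 : Type} [MetricSpace 𝕊] [CompactSpace 𝕊] {S : SphereModel 𝕊} {f : 𝕊 → 𝕊}

lemma bdd_of_omit {N : Set 𝕊} (hN : N ∈ 𝓝 S.infty) : ∃ R : ℝ, ∀ t, S.ι t ∉ N → ‖t‖ ≤ R := by
  obtain ⟨ε, hε, hb⟩ := Metric.mem_nhds_iff.mp hN
  refine ⟨2 / ε, fun t ht => ?_⟩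
  by_contra hcon
  push Not at hcon
  apply ht
  apply hb
  rw [mem_ball, S.dist_infty]
  have h1 : ‖t‖ < Real.sqrt (1 + ‖t‖ ^ 2) := by
    apply Real.lt_sqrt_of_sq_lt; linarith
  have h2 : 2 / ε < Real.sqrt (1 + ‖t‖ ^ 2) := hcon.trans h1
  have h3 : 0 < 2 / ε := by positivity
  rw [div_lt_iff₀ (h3.trans h2)]
  rw [div_lt_iff₀ hε] at h2
  linarith

lemma chart_ι (S : SphereModel 𝕊) (t : ℂ) : S.chart (S.ι 0) (S.ι t) = t := by
  rw [chart_ne S (ι_ne_infty S 0), toC_ι]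

lemma exists_ne_of_nhds (S : SphereModel 𝕊) (v : 𝕊) {w : 𝕊} {U : Set 𝕊} (hU : U ∈ 𝓝 w) : ∃ y ∈ U, y ≠ v := by
  rw [← chartInv_chart_self S w, ← map_chartInv_nhds, mem_map] at hU
  obtain ⟨r, hr, hb⟩ := Metric.mem_nhds_iff.mp hU
  set t := S.chart w w
  have h1 : t + (r / 2 : ℝ) ∈ ball t r := by
    rw [mem_ball, dist_eq_norm, add_sub_cancel_left, Complex.norm_real, Real.norm_of_nonneg (by linarith)]
    linarith
  by_cases h : S.chartInv w t = v
  · refine ⟨_, hb h1, ?_⟩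
    rw [← h]
    intro h2
    have := chartInv_inj S w h2
    rw [add_eq_left, Complex.ofReal_eq_zero] at this
    linarith
  · exact ⟨_, hb (mem_ball_self hr), h⟩

/-- Existence of the distinct points in the postsingular set. -/
lemma sing_not_subsingleton (hf : S.MeroOrRat f) (v : 𝕊) (hv : S.singularValues f ⊆ {v}) : False := by
  obtain ⟨M, M', hM, hMv⟩ := exists_mob_infty S v
  have hvM : ∀ t, M' (S.ι t) ≠ v := by
    intro t h
    have := hM.right (S.ι t)
    rw [h, hMv] at this
    exact ι_ne_infty S t this.symm
  have hpar : ∀ y, y ≠ v → ∃ t, M' (S.ι t) = y := by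
    intro y hy
    obtain ⟨t, ht⟩ := exists_ι S (x := M y) (by rw [← hMv]; exact fun h => hy (hM.inj h))
    exact ⟨t, by rw [ht, hM.left]⟩
  have hinjM : Injective fun t => M' (S.ι t) := fun a b h => S.injective_ι (hM.symm.inj h)
  have hsec : ∀ x ∈ S.dom f, ∀ t, f x = M' (S.ι t) → ∃ H : ℂ → 𝕊, H t = x ∧ Continuous H ∧
      (∀ τ, H τ ∈ S.dom f ∧ f (H τ) = M' (S.ι τ)) ∧ ∀ τ, HolC S H τ ∧ ∃ V ∈ 𝓝 (H τ), InjOn f V := by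
    intro x hx t ht
    obtain ⟨H, h1, h2, h3⟩ := lift_ball hf convex_univ isOpen_univ (h := fun t => M' (S.ι t))
      (hM.cont'.comp S.continuous_ι).continuousOn
      (fun a _ h => hvM a (hv h)) (mem_univ t) hx ht
    have hc : Continuous H := continuousOn_univ.mp h1
    refine ⟨H, h2, hc, fun τ => h3 τ trivial, fun τ => ?_⟩
    have := section_holC (S := S) (F := M ∘ f) (h := H) (b := S.ι 0) (t := τ)
      (holAt_comp (hM.hol _) (h3 τ trivial).1) (Eventually.of_forall fun _ => hc.continuousAt)
      (Eventually.of_forall fun σ => by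
        rw [comp_apply, (h3 σ trivial).2, hM.right, chartInv_ι0])
    obtain ⟨h4, V, hV, h5⟩ := this
    exact ⟨h4, V, hV, fun a ha b hb hab => h5 ha hb (by simp [hab])⟩
  have hinj1 : ∀ x₁ ∈ S.dom f, ∀ x₂ ∈ S.dom f, f x₁ = f x₂ → f x₁ ≠ v → x₁ = x₂ := by
    intro x₁ hx₁ x₂ hx₂ h12 hne
    by_contra hx12
    obtain ⟨t, ht⟩ := hpar _ hne
    obtain ⟨H₁, a1, a2, a3, a4⟩ := hsec x₁ hx₁ t ht.symm
    obtain ⟨H₂, b1, b2, b3, b4⟩ := hsec x₂ hx₂ t (by rw [← h12, ht])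
    have hdis : ∀ τ σ, H₁ τ ≠ H₂ σ := by
      intro τ σ h
      have e := (a3 τ).2
      rw [h, (b3 σ).2] at e
      have e := hinjM e
      subst e
      have := sec_unique (F := f) isPreconnected_univ a2.continuousOn b2.continuousOn
        (fun a _ => by rw [(a3 a).2, (b3 a).2]) (fun a _ => (a4 a).2) (mem_univ σ) h (mem_univ t)
      rw [a1, b1] at this
      exact hx12 this
    have hN : ∀ᶠ y in 𝓝 x₂, ∃ σ, H₂ σ = y := by
      obtain ⟨V, hV, hVi⟩ := (b4 t).2
      rw [b1] at hV
      have hMf : ContinuousAt (fun y => S.chart (S.ι 0) (M (f y))) x₂ := by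
        have e1 : ContinuousAt (S.chart (S.ι 0)) (M (f x₂)) := chart_continuousAt S
          ⟨t, by rw [chartInv_ι0, ← h12, ← ht, hM.right]⟩
        exact ContinuousAt.comp (f := fun y => M (f y)) e1 (hM.cont.continuousAt.comp (show S.HolAt f x₂ from hx₂).1)
      have hval : S.chart (S.ι 0) (M (f x₂)) = t := by
        rw [← h12, ← ht, hM.right, chart_ι]
      have c2 : ∀ᶠ y in 𝓝 x₂, H₂ (S.chart (S.ι 0) (M (f y))) ∈ V := by
        have : ContinuousAt (fun y => H₂ (S.chart (S.ι 0) (M (f y)))) x₂ :=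
          ContinuousAt.comp (f := fun y => S.chart (S.ι 0) (M (f y))) b2.continuousAt hMf
        apply this
        simp only [hval, b1]
        exact hV
      have c3 : ∀ᶠ y in 𝓝 x₂, f y ≠ v := (show S.HolAt f x₂ from hx₂).1
        (isOpen_ne.mem_nhds (by rw [← h12]; exact hne))
      filter_upwards [c2, c3, hV] with y h1 h2 h3
      refine ⟨_, hVi h1 h3 ?_⟩
      obtain ⟨s, hs⟩ := hpar _ h2
      rw [(b3 _).2, ← hs, hM.right, chart_ι]
    obtain ⟨K, K', hK, hKx⟩ := exists_mob_infty S x₂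
    have hN' : {y | ∃ σ, H₂ σ = K' y} ∈ 𝓝 S.infty := by
      rw [← hKx]
      have := hK.cont'.continuousAt (x := K x₂)
      refine this.eventually (p := fun y => ∃ σ, H₂ σ = y) ?_
      rw [hK.left]; exact hN
    obtain ⟨R, hR⟩ := bdd_of_omit hN'
    have hne : ∀ τ, K (H₁ τ) ≠ S.infty := by
      intro τ h
      rw [← hKx] at h
      have := hK.inj h
      rw [← b1] at this
      exact hdis _ _ this
    set u : ℂ → ℂ := S.chart (S.ι 0) ∘ (K ∘ H₁) with hu
    have huι : ∀ τ, S.ι (u τ) = K (H₁ τ) := by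
      intro τ
      obtain ⟨s, hs⟩ := exists_ι S (hne τ)
      rw [hu, comp_apply, comp_apply, ← hs, chart_ι]
    have hud : Differentiable ℂ u := by
      intro τ
      refine (HolC.chart_an (HolC.comp (hK.hol _) (a4 τ).1) ?_).differentiableAt
      obtain ⟨s, hs⟩ := exists_ι S (hne τ)
      exact ⟨s, by rw [chartInv_ι0, hs]; rfl⟩
    have hub : Bornology.IsBounded (range u) := by
      rw [isBounded_iff_forall_norm_le]
      refine ⟨R, ?_⟩
      rintro _ ⟨τ, rfl⟩
      apply hR
      rintro ⟨σ, hσ⟩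
      rw [huι, hK.left] at hσ
      exact hdis _ _ hσ.symm
    have h1 := hud.apply_eq_apply_of_bounded hub 0 1
    have h2 : H₁ 0 = H₁ 1 := by
      apply hK.inj; rw [← huι, ← huι, h1]
    have h3 : f (H₁ 0) = f (H₁ 1) := by rw [h2]
    rw [(a3 0).2, (a3 1).2] at h3
    exact zero_ne_one (hinjM h3)
  have hinj : InjOn f (S.dom f) := by
    intro x₁ hx₁ x₂ hx₂ h12
    by_contra hne
    obtain ⟨N₁, N₂, hN₁, hN₂, hd⟩ := t2_separation_nhds hne
    have e1 : f '' (N₁ ∩ S.dom f) ∈ 𝓝 (f x₁) :=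
      f_nhds hf hx₁ (image_mem_map (inter_mem hN₁ ((dom_open hf).mem_nhds hx₁)))
    have e2 : f '' (N₂ ∩ S.dom f) ∈ 𝓝 (f x₁) := by
      rw [h12]
      exact f_nhds hf hx₂ (image_mem_map (inter_mem hN₂ ((dom_open hf).mem_nhds hx₂)))
    obtain ⟨y, ⟨⟨y₁, hy₁, e3⟩, ⟨y₂, hy₂, e4⟩⟩, hy⟩ := exists_ne_of_nhds S v (inter_mem e1 e2)
    have := hinj1 y₁ hy₁.2 y₂ hy₂.2 (by rw [e3, e4]) (by rw [e3]; exact hy)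
    exact Set.disjoint_left.mp hd hy₁.1 (this ▸ hy₂.1)
  rcases hf with h | h
  swap
  · exact h.2.2 fun a b hab => hinj (h.1 a) (h.1 b) hab
  -- transcendental case
  classical
  have hf : S.MeroOrRat f := Or.inl h
  set x₀ := S.ι 0
  have hx₀ : x₀ ∈ S.dom f := h.1 0
  obtain ⟨N₁, N₂, hN₁, hN₂, hd⟩ := t2_separation_nhds (ι_ne_infty S 0)
  have e1 : f '' (N₁ ∩ S.dom f) ∈ 𝓝 (f x₀) :=
    f_nhds hf hx₀ (image_mem_map (inter_mem hN₁ ((dom_open hf).mem_nhds hx₀)))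
  obtain ⟨K, K', hK, hKx⟩ := exists_mob_infty S (f x₀)
  have hN' : {y | K' y ∈ f '' (N₁ ∩ S.dom f)} ∈ 𝓝 S.infty := by
    rw [← hKx]
    have := hK.cont'.continuousAt (x := K (f x₀))
    apply this
    rw [hK.left]; exact e1
  obtain ⟨R, hR⟩ := bdd_of_omit hN'
  have hinf0 : S.chartInv S.infty 0 = S.infty := by
    rw [chartInv_infty]; exact S.sphereInv_zero
  have hpt : ∀ t : ℂ, t ≠ 0 → S.chartInv S.infty t ∈ S.dom f := by
    intro t ht
    rw [chartInv_infty, comp_apply, S.sphereInv_ι t ht]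
    exact h.1 _
  have hN₂' : ∀ᶠ t in 𝓝 (0 : ℂ), S.chartInv S.infty t ∈ N₂ :=
    (chartInv_cont S _).continuousAt (by rw [hinf0]; exact hN₂)
  obtain ⟨r, hr, hball⟩ := Metric.eventually_nhds_iff_ball.mp hN₂'
  have hom : ∀ t ∈ ball (0 : ℂ) r, t ≠ 0 → f (S.chartInv S.infty t) ∉ f '' (N₁ ∩ S.dom f) := by
    rintro t ht ht0 ⟨y, hy, hyt⟩
    have := hinj hy.2 (hpt t ht0) hyt
    exact Set.disjoint_left.mp hd hy.1 (this ▸ hball t ht)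
  have hfin : ∀ t ∈ ball (0 : ℂ) r, t ≠ 0 → ∃ s, S.ι s = K (f (S.chartInv S.infty t)) := by
    intro t ht ht0
    apply exists_ι
    intro h1
    have h2 := mem_of_mem_nhds hN'
    rw [← h1, mem_ofPred_eq, hK.left] at h2
    exact hom t ht ht0 h2
  set u : ℂ → ℂ := S.chart (S.ι 0) ∘ (K ∘ f ∘ S.chartInv S.infty) with hu
  have huι : ∀ t ∈ ball (0 : ℂ) r, t ≠ 0 → S.ι (u t) = K (f (S.chartInv S.infty t)) := by
    intro t ht ht0
    obtain ⟨s, hs⟩ := hfin t ht ht0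
    simp only [hu, comp_apply]
    rw [← hs, chart_ι]
  have hud : DifferentiableOn ℂ u (ball 0 r \ {0}) := by
    rintro t ⟨ht, ht0⟩
    obtain ⟨s, hs⟩ := hfin t ht ht0
    refine (HolC.chart_an (HolC.comp (hK.hol _) (holC_of_holAt (F := f) (hpt t ht0)))
      ⟨s, ?_⟩).differentiableAt.differentiableWithinAt
    rw [chartInv_ι0, hs]; rfl
  have hub : BddAbove (norm ∘ u '' (ball 0 r \ {0})) := by
    refine ⟨R, ?_⟩
    rintro _ ⟨t, ⟨ht, ht0⟩, rfl⟩
    apply hR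
    rw [mem_ofPred_eq, huι t ht ht0, hK.left]
    exact hom t ht ht0
  have hext := Complex.differentiableOn_update_limUnder_of_bddAbove (ball_mem_nhds (0 : ℂ) hr) hud hub
  set U := update u 0 (limUnder (𝓝[≠] 0) u) with hU
  have hUa : AnalyticAt ℂ U 0 := hext.analyticAt (ball_mem_nhds (0 : ℂ) hr)
  apply h.2
  refine ⟨fun x => if x = S.infty then K' (S.ι (U 0)) else f x, fun t => by simp [ι_ne_infty], ?_⟩
  rw [← hinf0]
  apply holAt_of_holC
  have h1 : HolC S (K' ∘ (S.chartInv (S.ι 0) ∘ U)) 0 :=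
    HolC.comp (hK.hol' _) (HolC.of_chartInv hUa _)
  refine h1.congr ?_
  filter_upwards [ball_mem_nhds (0 : ℂ) hr] with t ht
  by_cases ht0 : t = 0
  · subst ht0
    simp [hinf0, chartInv_ι0]
  · have e3 : S.chartInv S.infty t ≠ S.infty := by
      rw [chartInv_infty, comp_apply, S.sphereInv_ι t ht0]; exact ι_ne_infty S _
    have e4 : U t = u t := by rw [hU, update_of_ne ht0]
    simp only [comp_apply, hinf0, e3, if_false, e4]
    rw [chartInv_ι0, huι t ht ht0, hK.left]

lemma two_post (hf : S.MeroOrRat f) : ∃ a ∈ S.postSingular f, ∃ b ∈ S.postSingular f, a ≠ b := by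
  by_contra hcon
  push Not at hcon
  by_cases h : (S.singularValues f).Nonempty
  · obtain ⟨v, hv⟩ := h
    exact sing_not_subsingleton hf v fun w hw => hcon w (sing_subset hw) v (sing_subset hv)
  · rw [not_nonempty_iff_eq_empty] at h
    exact sing_not_subsingleton hf S.infty (by rw [h]; exact empty_subset _)

end two
end NiceSet

namespace NiceSet
section eq
variable {𝕊 : Type} [MetricSpace 𝕊] [CompactSpace 𝕊] {S : SphereModel 𝕊} {f : 𝕊 → 𝕊}

lemma dist_exp_le (S : SphereModel 𝕊) (p q : ℂ) (h : ‖q - p‖ ≤ 1) :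
    dist (S.ι (Complex.exp p)) (S.ι (Complex.exp q)) ≤ 4 * ‖q - p‖ := by
  rw [S.dist_ι]
  have hp : 0 < ‖Complex.exp p‖ := norm_pos_iff.mpr (Complex.exp_ne_zero p)
  have h1 : ‖Complex.exp p‖ ≤ Real.sqrt (1 + ‖Complex.exp p‖ ^ 2) := by
    apply Real.le_sqrt_of_sq_le; linarith
  have h2 : 1 ≤ Real.sqrt (1 + ‖Complex.exp q‖ ^ 2) := by
    apply Real.le_sqrt_of_sq_le; nlinarith [sq_nonneg ‖Complex.exp q‖]
  have h3 : ‖Complex.exp p‖ ≤ Real.sqrt (1 + ‖Complex.exp p‖ ^ 2) * Real.sqrt (1 + ‖Complex.exp q‖ ^ 2) := by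
    nlinarith
  have h4 : dist (Complex.exp p) (Complex.exp q) ≤ ‖Complex.exp p‖ * (2 * ‖q - p‖) := by
    have e : Complex.exp q = Complex.exp p * Complex.exp (q - p) := by
      rw [← Complex.exp_add]; congr 1; ring
    rw [dist_comm, dist_eq_norm]
    have : Complex.exp q - Complex.exp p = Complex.exp p * (Complex.exp (q - p) - 1) := by
      rw [mul_sub, ← e, mul_one]
    rw [this, norm_mul]
    gcongr
    exact Complex.norm_exp_sub_one_le h
  rw [div_le_iff₀ (lt_of_lt_of_le hp h3)]
  calc 2 * dist (Complex.exp p) (Complex.exp q) ≤ 2 * (‖Complex.exp p‖ * (2 * ‖q - p‖)) := by linarith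
    _ = 4 * ‖q - p‖ * ‖Complex.exp p‖ := by ring
    _ ≤ _ := by gcongr

lemma EQ {a b : 𝕊} (hab : a ≠ b) : ∀ ε > 0, ∃ δ > 0, ∀ ρ > 0, ∀ (t : ℂ) (h : ℂ → 𝕊),
    (∀ τ ∈ ball t ρ, HolC S h τ ∧ h τ ≠ a ∧ h τ ≠ b) → InjOn h (ball t ρ) →
    ∀ τ ∈ ball t (ρ / 2), ∀ σ ∈ ball t (ρ / 2), ‖τ - σ‖ ≤ δ * ρ → dist (h τ) (h σ) < ε := by
  intro ε hε
  obtain ⟨M, M', hM, hMa, hMb⟩ := exists_mob S hab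
  have huc := (CompactSpace.uniformContinuous_of_continuous hM.cont')
  obtain ⟨η, hη, hη'⟩ := Metric.uniformContinuous_iff.mp huc ε hε
  refine ⟨min η 1 / (5 * 4096), by positivity, ?_⟩
  intro ρ hρ t h hh hinj τ hτ σ hσ hts
  set u : ℂ → ℂ := S.chart (S.ι 0) ∘ (M ∘ h) with hu
  have hmem : ∀ w ∈ ball t ρ, M (h w) ∈ range (S.chartInv (S.ι 0)) := by
    intro w hw
    rw [chartInv_ι0]
    apply exists_ι S
    rw [← hMb]
    exact fun h' => (hh w hw).2.2 (hM.inj h')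
  have hιu : ∀ w ∈ ball t ρ, S.ι (u w) = M (h w) := by
    intro w hw
    have := chartInv_chart S (hmem w hw)
    rwa [chartInv_ι0] at this
  have hud : ∀ w ∈ ball t ρ, AnalyticAt ℂ u w := by
    intro w hw
    exact HolC.chart_an (HolC.comp (hM.hol _) (hh w hw).1) (hmem w hw)
  have hudiff : DifferentiableOn ℂ u (ball t ρ) := fun w hw =>
    (hud w hw).differentiableAt.differentiableWithinAt
  have hu0 : ∀ w ∈ ball t ρ, u w ≠ 0 := by
    intro w hw h0
    have := hιu w hw
    rw [h0, ← hMa] at this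
    exact (hh w hw).2.1 (hM.inj this.symm)
  have huinj : InjOn u (ball t ρ) := by
    intro w hw v hv e
    apply hinj hw hv
    apply hM.inj
    rw [← hιu w hw, ← hιu v hv, e]
  obtain ⟨l, hl, hle⟩ := exists_log hρ hudiff hu0
  have hsub : ball t (ρ / 2) ⊆ ball t ρ := ball_subset_ball (by linarith)
  have hbd : ∀ w ∈ ball t (ρ / 2), ‖deriv u w / u w‖ ≤ 4096 / ρ := by
    intro w hw
    have hs : ball w (ρ / 2) ⊆ ball t ρ := by
      apply ball_subset_ball'
      rw [mem_ball] at hw; linarith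
    have := logderiv (c := w) (ρ := ρ / 2) (F := u) (by positivity) (hudiff.mono hs)
      (fun v hv => hu0 v (hs hv)) (huinj.mono hs)
    calc _ ≤ _ := this
      _ = 4096 / ρ := by field_simp; norm_num
  have hmv : ‖l σ - l τ‖ ≤ 4096 / ρ * ‖σ - τ‖ :=
    (convex_ball t (ρ / 2)).norm_image_sub_le_of_norm_hasDerivWithin_le
      (fun w hw => (hl w (hsub hw)).hasDerivWithinAt) hbd hτ hσ
  have h1 : ‖l σ - l τ‖ ≤ min η 1 / 5 := by
    calc ‖l σ - l τ‖ ≤ 4096 / ρ * ‖σ - τ‖ := hmv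
      _ ≤ 4096 / ρ * (min η 1 / (5 * 4096) * ρ) := by
        rw [norm_sub_rev]; gcongr
      _ = _ := by field_simp
  have hm1 : min η 1 ≤ 1 := min_le_right _ _
  have hm2 : min η 1 ≤ η := min_le_left _ _
  have hm0 : 0 < min η 1 := by positivity
  have := dist_exp_le S (l τ) (l σ) (by linarith)
  rw [hle τ (hsub hτ), hle σ (hsub hσ), hιu τ (hsub hτ), hιu σ (hsub hσ)] at this
  have h2 := hη' (a := M (h τ)) (b := M (h σ)) (by linarith)
  rwa [hM.left, hM.left] at h2

end eq
end NiceSet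

namespace NiceSet
section rb
variable {𝕊 : Type} [MetricSpace 𝕊] [CompactSpace 𝕊]

/-- The chart coordinate of the base point. -/
noncomputable def ctr (S : SphereModel 𝕊) (z : 𝕊) : ℂ := S.chart z z

/-- An inverse branch of an iterate, read in the chart at `z`. -/
structure RB (S : SphereModel 𝕊) (f : 𝕊 → 𝕊) (z : 𝕊) (R ρ : ℝ) (m : ℕ) (G : ℂ → ℂ) : Prop where
  diff : DifferentiableOn ℂ G (ball (ctr S z) R)
  maps : MapsTo G (ball (ctr S z) R) (ball (ctr S z) ρ)
  dfd : ∀ τ ∈ ball (ctr S z) R, S.DefinedUpTo f (S.chartInv z (G τ)) m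
  sec : ∀ τ ∈ ball (ctr S z) R, f^[m] (S.chartInv z (G τ)) = S.chartInv z τ

/-- The basic setting. -/
structure Setup (S : SphereModel 𝕊) (f : 𝕊 → 𝕊) (z : 𝕊) (ρ R : ℝ) : Prop where
  hf : S.MeroOrRat f
  hz : z ∈ S.julia f
  ρpos : 0 < ρ
  Rpos : 0 < R
  Rle : R ≤ ρ / 2
  hP : ∀ τ ∈ ball (ctr S z) ρ, S.chartInv z τ ∉ S.postSingular f
  rbex : ∀ m, ∀ x ∈ ball (ctr S z) R, ∀ τ₀ ∈ ball (ctr S z) R, S.DefinedUpTo f (S.chartInv z x) m →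
    f^[m] (S.chartInv z x) = S.chartInv z τ₀ → ∃ G, RB S f z R ρ m G ∧ G τ₀ = x

variable {S : SphereModel 𝕊} {f : 𝕊 → 𝕊} {z : 𝕊} {R ρ : ℝ} {m : ℕ} {G : ℂ → ℂ}

lemma exists_setup (hf : S.MeroOrRat f) (hz : z ∈ S.julia f) (hzP : z ∉ S.postSingular f) :
    ∃ ρ R, Setup S f z ρ R := by
  obtain ⟨a, ha, b, hb, hab⟩ := two_post hf
  set c := ctr S z with hc
  have hψc : S.chartInv z c = z := chartInv_chart_self S z
  have h0 : ∀ᶠ τ in 𝓝 c, S.chartInv z τ ∉ S.postSingular f := by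
    have : ContinuousAt (S.chartInv z) c := (chartInv_cont S z).continuousAt
    apply this.eventually (p := fun x => x ∉ S.postSingular f)
    rw [hψc]
    exact (post_closed (S := S) (f := f)).isOpen_compl.mem_nhds hzP
  obtain ⟨ρ, hρ, hP⟩ := Metric.eventually_nhds_iff_ball.mp h0
  have hcomp : IsCompact (S.chartInv z '' closedBall c (ρ / 2)) :=
    (isCompact_closedBall _ _).image (chartInv_cont S z)
  obtain ⟨ε, hε, hth⟩ := hcomp.exists_thickening_subset_open (chartInv_open S z _ (isOpen_ball : IsOpen (ball c ρ)))
    (image_mono (closedBall_subset_ball (by linarith)))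
  obtain ⟨δ, hδ, hE⟩ := EQ (S := S) hab ε hε
  refine ⟨ρ, min (ρ / 2) (δ * ρ / 2), hf, hz, hρ, by positivity, min_le_left _ _, hP, ?_⟩
  intro m x hx τ₀ hτ₀ hd he
  have hR1 : min (ρ / 2) (δ * ρ / 2) ≤ ρ / 2 := min_le_left _ _
  have hR2 : min (ρ / 2) (δ * ρ / 2) ≤ δ * ρ / 2 := min_le_right _ _
  have hsub1 : ball c (min (ρ / 2) (δ * ρ / 2)) ⊆ ball c (ρ / 2) := ball_subset_ball hR1
  have hsub : ball c (ρ / 2) ⊆ ball c ρ := ball_subset_ball (by linarith)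
  obtain ⟨H, hHc, hH0, hH⟩ := branch_ex hf (convex_ball c ρ) isOpen_ball m
    (chartInv_cont S z).continuousOn hP (hsub (hsub1 hτ₀)) hd he
  have hHol : ∀ τ ∈ ball c ρ, HolC S H τ := by
    intro τ hτ
    refine (section_holC (F := f^[m]) (b := z) (holAt_iter (hH τ hτ).1) ?_ ?_).1
    · filter_upwards [isOpen_ball.mem_nhds hτ] with σ hσ
      exact hHc.continuousAt (isOpen_ball.mem_nhds hσ)
    · filter_upwards [isOpen_ball.mem_nhds hτ] with σ hσ
      exact (hH σ hσ).2
  have hHP : ∀ τ ∈ ball c ρ, H τ ∉ S.postSingular f := by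
    intro τ hτ hcon
    apply hP τ hτ
    rw [← (hH τ hτ).2]
    exact post_fwd_iter hf hcon (hH τ hτ).1
  have hHinj : InjOn H (ball c ρ) := by
    intro τ hτ σ hσ e
    apply chartInv_inj S z
    rw [← (hH τ hτ).2, ← (hH σ hσ).2, e]
  have hm : ∀ τ ∈ ball c (min (ρ / 2) (δ * ρ / 2)), H τ ∈ S.chartInv z '' ball c ρ := by
    intro τ hτ
    apply hth
    rw [mem_thickening_iff]
    refine ⟨S.chartInv z x, mem_image_of_mem _ (ball_subset_closedBall (hsub1 hx)), ?_⟩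
    rw [← hH0]
    apply hE ρ hρ c H (fun σ hσ => ⟨hHol σ hσ, fun h => hHP σ hσ (h ▸ ha), fun h => hHP σ hσ (h ▸ hb)⟩)
      hHinj _ (hsub1 hτ) _ (hsub1 hτ₀)
    rw [← dist_eq_norm]
    have := dist_triangle_right τ τ₀ c
    rw [mem_ball] at hτ hτ₀
    linarith
  have hψ : ∀ τ ∈ ball c (min (ρ / 2) (δ * ρ / 2)), S.chartInv z (S.chart z (H τ)) = H τ := by
    intro τ hτ
    exact chartInv_chart S (image_subset_range _ _ (hm τ hτ))
  refine ⟨S.chart z ∘ H, ⟨?_, ?_, ?_, ?_⟩, ?_⟩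
  · intro τ hτ
    exact ((hHol τ (hsub (hsub1 hτ))).chart_an (image_subset_range _ _ (hm τ hτ))).differentiableAt.differentiableWithinAt
  · intro τ hτ
    obtain ⟨y, hy, hy'⟩ := hm τ hτ
    simp only [comp_apply]
    rw [← hy', chart_chartInv]; exact hy
  · intro τ hτ
    simp only [comp_apply]
    rw [hψ τ hτ]; exact (hH τ (hsub (hsub1 hτ))).1
  · intro τ hτ
    simp only [comp_apply]
    rw [hψ τ hτ]; exact (hH τ (hsub (hsub1 hτ))).2
  · simp only [comp_apply]
    rw [hH0, chart_chartInv]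

lemma ψc (S : SphereModel 𝕊) (z : 𝕊) : S.chartInv z (ctr S z) = z := chartInv_chart_self S z

lemma RB.an (h : RB S f z R ρ m G) {τ : ℂ} (hτ : τ ∈ ball (ctr S z) R) : AnalyticAt ℂ G τ :=
  h.diff.analyticAt (isOpen_ball.mem_nhds hτ)

lemma RB.inj (h : RB S f z R ρ m G) : InjOn G (ball (ctr S z) R) := by
  intro τ hτ σ hσ e
  apply chartInv_inj S z
  rw [← h.sec τ hτ, ← h.sec σ hσ, e]

/-- local inverse analyticity -/
lemma RB.phi_an (h : RB S f z R ρ m G) {τ : ℂ} (hτ : τ ∈ ball (ctr S z) R) :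
    AnalyticAt ℂ (S.chart z ∘ f^[m] ∘ S.chartInv z) (G τ) := by
  apply HolC.chart_an (h := f^[m] ∘ S.chartInv z) (holC_of_holAt (holAt_iter (h.dfd τ hτ)))
  simp only [comp_apply]
  rw [h.sec τ hτ]
  exact mem_range_self _

lemma RB.phi_eq (h : RB S f z R ρ m G) {τ : ℂ} (hτ : τ ∈ ball (ctr S z) R) :
    (S.chart z ∘ f^[m] ∘ S.chartInv z) (G τ) = τ := by
  simp only [comp_apply]
  rw [h.sec τ hτ, chart_chartInv]

lemma RB.deriv_ne (h : RB S f z R ρ m G) {τ : ℂ} (hτ : τ ∈ ball (ctr S z) R) : deriv G τ ≠ 0 := by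
  refine (section_analytic (h.phi_an hτ) ?_ ?_).2.2
  · filter_upwards [isOpen_ball.mem_nhds hτ] with σ hσ
    exact (h.an hσ).continuousAt
  · filter_upwards [isOpen_ball.mem_nhds hτ] with σ hσ
    exact h.phi_eq hσ

lemma RB.deriv_mul (h : RB S f z R ρ m G) {τ : ℂ} (hτ : τ ∈ ball (ctr S z) R) :
    deriv (S.chart z ∘ f^[m] ∘ S.chartInv z) (G τ) * deriv G τ = 1 := by
  have h1 := (h.phi_an hτ).differentiableAt.hasDerivAt.comp τ (h.an hτ).differentiableAt.hasDerivAt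
  have e : (S.chart z ∘ f^[m] ∘ S.chartInv z) ∘ G =ᶠ[𝓝 τ] id := by
    filter_upwards [isOpen_ball.mem_nhds hτ] with σ hσ
    exact h.phi_eq hσ
  have h2 := (hasDerivAt_id τ).congr_of_eventuallyEq e
  exact h1.unique h2

lemma RB.unique {G' : ℂ → ℂ} (h : RB S f z R ρ m G) (h' : RB S f z R ρ m G') {τ σ : ℂ}
    (hτ : τ ∈ ball (ctr S z) R) (hσ : σ ∈ ball (ctr S z) R) (e : G τ = G' σ) :
    τ = σ ∧ EqOn G G' (ball (ctr S z) R) := by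
  have e1 : τ = σ := by
    apply chartInv_inj S z
    rw [← h.sec τ hτ, ← h'.sec σ hσ, e]
  subst e1
  refine ⟨rfl, ?_⟩
  have key : EqOn (S.chartInv z ∘ G) (S.chartInv z ∘ G') (ball (ctr S z) R) := by
    apply sec_unique (F := f^[m]) (convex_ball _ _).isPreconnected
      ((chartInv_cont S z).comp_continuousOn h.diff.continuousOn)
      ((chartInv_cont S z).comp_continuousOn h'.diff.continuousOn) _ _ hτ
    · simp only [comp_apply]; rw [e]
    · intro a ha
      simp only [comp_apply]
      rw [h.sec a ha, h'.sec a ha]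
    · intro a ha
      refine (section_holC (F := f^[m]) (b := z) (t := a) (h := S.chartInv z ∘ G)
        (holAt_iter (h.dfd a ha)) ?_ ?_).2
      · filter_upwards [isOpen_ball.mem_nhds ha] with σ hσ
        exact (chartInv_cont S z).continuousAt.comp (h.an hσ).continuousAt
      · filter_upwards [isOpen_ball.mem_nhds ha] with σ hσ
        exact h.sec σ hσ
  intro a ha
  exact chartInv_inj S z (key ha)

/-- uniform constants -/
lemma Setup.consts (hS : Setup S f z ρ R) : ∃ C > 0, ∀ m G, RB S f z R ρ m G →
    ∀ w ∈ ball (ctr S z) (R / 2), ‖deriv G w‖ ≤ C ∧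
      ‖deriv G w - deriv G (ctr S z)‖ ≤ C * ‖w - ctr S z‖ := by
  have hR := hS.Rpos
  have hρ := hS.ρpos
  set c := ctr S z with hc
  set A := 4 * ρ / R with hA
  have hA0 : 0 < A := by positivity
  have key : ∀ m G, RB S f z R ρ m G → ∀ w ∈ ball c (R / 2), ‖deriv G w‖ ≤ A := by
    intro m G h w hw
    have hs : ball w (R / 2) ⊆ ball c R := by
      apply ball_subset_ball'
      rw [mem_ball] at hw; linarith
    have := Complex.norm_deriv_le_div_of_mapsTo_ball (f := G) (c := w) (R₁ := R / 2) (R₂ := 2 * ρ)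
      (h.diff.mono hs) ?_ (by positivity)
    · calc _ ≤ _ := this
        _ = A := by rw [hA]; field_simp; norm_num
    · intro v hv
      have h1 := h.maps (hs hv)
      have h2 := h.maps (ball_subset_ball (by linarith) hw : w ∈ ball c R)
      rw [mem_ball] at h1 h2
      rw [mem_closedBall]
      linarith [dist_triangle_right (G v) (G w) c]
  refine ⟨max A (2 * A / (R / 2)), by positivity, ?_⟩
  intro m G h w hw
  refine ⟨(key m G h w hw).trans (le_max_left _ _), ?_⟩
  have hcR : c ∈ ball c (R / 2) := mem_ball_self (by positivity)
  have hd : DifferentiableOn ℂ (deriv G) (ball c (R / 2)) := by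
    intro v hv
    exact ((h.an (ball_subset_ball (by linarith) hv)).deriv).differentiableAt.differentiableWithinAt
  have := Complex.dist_le_div_mul_dist_of_mapsTo_ball (f := deriv G) (c := c) (R₁ := R / 2) (R₂ := 2 * A)
    (z := w) hd ?_ hw
  · rw [dist_eq_norm, dist_eq_norm] at this
    calc _ ≤ _ := this
      _ ≤ _ := by gcongr; exact le_max_right _ _
  · intro v hv
    rw [mem_closedBall, dist_eq_norm]
    have h1 := key m G h v hv
    have h2 := key m G h c hcR
    calc _ ≤ ‖deriv G v‖ + ‖deriv G c‖ := norm_sub_le _ _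
      _ ≤ _ := by linarith

end rb
end NiceSet

namespace NiceSet
section star
variable {𝕊 : Type} [MetricSpace 𝕊] [CompactSpace 𝕊]
variable {S : SphereModel 𝕊} {f : 𝕊 → 𝕊} {z : 𝕊} {R ρ : ℝ} {m : ℕ} {G : ℂ → ℂ}

lemma fatou_fwd (hf : S.MeroOrRat f) {x : 𝕊} (hx : x ∈ S.fatou f) (m : ℕ) : f^[m] x ∈ S.fatou f := by
  obtain ⟨U, hU, hd, he⟩ := hx
  have hxU : x ∈ interior U := mem_interior_iff_mem_nhds.mpr hU
  refine ⟨f^[m] '' interior U, iter_nhds hf (hd x (mem_of_mem_nhds hU) m)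
    (image_mem_map (isOpen_interior.mem_nhds hxU)), ?_, ?_⟩
  · rintro _ ⟨y, hy, rfl⟩ n
    exact ((defined_add (m := m) (k := n)).mp (hd y (interior_subset hy) (m + n))).2
  · rintro _ ⟨y, hy, rfl⟩ V hV
    have h1 := he y (interior_subset hy) V hV
    have h2 : ∀ᶠ v in 𝓝 y, ∀ i : ℕ, (f^[i] y, f^[i] v) ∈ V := by
      rwa [nhdsWithin_eq_nhds.mpr (mem_interior_iff_mem_nhds.mp hy)] at h1
    apply Filter.Eventually.filter_mono nhdsWithin_le_nhds
    have h3 := iter_nhds hf (hd y (interior_subset hy) m) (image_mem_map (m := f^[m]) h2)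
    filter_upwards [h3]
    rintro _ ⟨v, hv, rfl⟩ i
    rw [← iterate_add_apply, ← iterate_add_apply]
    exact hv (i + m)

lemma fatou_of_ball (hf : S.MeroOrRat f) {p : ℂ} {κ : ℝ} (hκ : 0 < κ)
    (h1 : ∀ y ∈ ball p κ, ∀ n, S.DefinedUpTo f (S.chartInv z y) n ∧ f^[n] (S.chartInv z y) ∉ S.postSingular f)
    (h2 : ∀ n, InjOn (f^[n] ∘ S.chartInv z) (ball p κ)) : S.chartInv z p ∈ S.fatou f := by
  obtain ⟨a, ha, b, hb, hab⟩ := two_post hf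
  have hsub : ball p (κ / 2) ⊆ ball p κ := ball_subset_ball (by linarith)
  refine ⟨S.chartInv z '' ball p (κ / 2), ?_, ?_, ?_⟩
  · exact (chartInv_open S z _ isOpen_ball).mem_nhds (mem_image_of_mem _ (mem_ball_self (by positivity)))
  · rintro _ ⟨y, hy, rfl⟩ n
    exact (h1 y (hsub hy) n).1
  · rintro _ ⟨y, hy, rfl⟩ V hV
    obtain ⟨ε, hε, hεV⟩ := Metric.mem_uniformity_dist.mp hV
    obtain ⟨δ, hδ, hE⟩ := EQ (S := S) hab ε hε
    apply Filter.Eventually.filter_mono nhdsWithin_le_nhds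
    rw [← map_chartInv_nhds, eventually_map]
    filter_upwards [isOpen_ball.mem_nhds hy, ball_mem_nhds y (show 0 < δ * κ by positivity)] with w hw hw' i
    apply hεV
    apply hE κ hκ p (f^[i] ∘ S.chartInv z) _ (h2 i) y hy w hw
    · rw [mem_ball, dist_comm, dist_eq_norm] at hw'
      exact hw'.le
    · intro τ hτ
      refine ⟨holC_of_holAt (holAt_iter (h1 τ hτ i).1), ?_, ?_⟩
      · intro h; exact (h1 τ hτ i).2 (by rw [comp_apply] at h; rw [h]; exact ha)
      · intro h; exact (h1 τ hτ i).2 (by rw [comp_apply] at h; rw [h]; exact hb)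

lemma Setup.koeR (hS : Setup S f z ρ R) {δ : ℝ} (hδ : 0 < δ) : ∃ s₁ > 0, s₁ ≤ R / 2 ∧ ∀ m G, RB S f z R ρ m G →
    δ ≤ ‖deriv G (ctr S z)‖ → ∀ r, 0 < r → r < s₁ →
      ball (G (ctr S z)) (δ * r / 4) ⊆ G '' closedBall (ctr S z) r := by
  obtain ⟨C, hC, hCb⟩ := hS.consts
  have hR := hS.Rpos
  refine ⟨min (R / 2) (δ / (2 * C)), by positivity, min_le_left _ _, ?_⟩
  intro m G h hδG r hr hrs
  have hs1 : min (R / 2) (δ / (2 * C)) ≤ R / 2 := min_le_left _ _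
  have hs2 : min (R / 2) (δ / (2 * C)) ≤ δ / (2 * C) := min_le_right _ _
  refine Subset.trans (ball_subset_ball ?_) (koe (F := G) (c := ctr S z) (k := deriv G (ctr S z))
    (s := min (R / 2) (δ / (2 * C))) (h.deriv_ne (mem_ball_self hR)) (h.diff.mono (ball_subset_ball (by linarith)))
    ?_ hr hrs)
  · gcongr
  · intro w hw
    have := (hCb m G h w (ball_subset_ball hs1 hw)).2
    rw [mem_ball, dist_eq_norm] at hw
    calc _ ≤ _ := this
      _ ≤ C * (δ / (2 * C)) := by gcongr; linarith
      _ = δ / 2 := by field_simp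
      _ ≤ _ := by linarith

lemma Setup.K (hS : Setup S f z ρ R) : ∀ δ > 0, ∃ N, ∀ m ≥ N, ∀ G, RB S f z R ρ m G →
    ‖deriv G (ctr S z)‖ < δ := by
  intro δ hδ
  by_contra hcon
  push Not at hcon
  choose m hm G hG hd using hcon
  have hR := hS.Rpos
  obtain ⟨s, hs, hsR, hk⟩ := hS.koeR hδ
  have hmem : ∀ j, G j (ctr S z) ∈ closedBall (ctr S z) ρ := fun j =>
    ball_subset_closedBall ((hG j).maps (mem_ball_self hR))
  obtain ⟨p, -, φ, hφ, hlim⟩ := (isCompact_closedBall (ctr S z) ρ).tendsto_subseq hmem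
  set κ := δ * (s / 2) / 8 with hκ
  have hκ0 : 0 < κ := by positivity
  obtain ⟨J, hJ⟩ := Metric.tendsto_atTop.mp hlim κ hκ0
  have hcov : ∀ n, ∃ j, n ≤ m j ∧ ball p κ ⊆ G j '' ball (ctr S z) R := by
    intro n
    refine ⟨φ (max J n), ?_, ?_⟩
    · calc n ≤ max J n := le_max_right _ _
        _ ≤ φ (max J n) := hφ.id_le _
        _ ≤ _ := hm _
    · have h1 := hJ (max J n) (le_max_left _ _)
      have h2 := hk _ _ (hG (φ (max J n))) (hd _) (s / 2) (by positivity) (by linarith)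
      refine Subset.trans (ball_subset_ball' ?_) (h2.trans (image_mono (closedBall_subset_ball (by linarith))))
      rw [dist_comm]
      simp only [comp_apply] at h1
      have : δ * (s / 2) / 4 = 2 * κ := by rw [hκ]; ring
      linarith
  have h1 : ∀ y ∈ ball p κ, ∀ n, S.DefinedUpTo f (S.chartInv z y) n ∧
      f^[n] (S.chartInv z y) ∉ S.postSingular f := by
    intro y hy n
    obtain ⟨j, hj, hc⟩ := hcov n
    obtain ⟨τ, hτ, rfl⟩ := hc hy
    have hd1 := (hG j).dfd τ hτ
    refine ⟨defined_mono hd1 hj, fun hP => ?_⟩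
    obtain ⟨k, hk⟩ := Nat.exists_eq_add_of_le hj
    rw [hk] at hd1
    have h3 := post_fwd_iter hS.hf hP (defined_add.mp hd1).2
    rw [← iterate_add_apply, add_comm k n, ← hk, (hG j).sec τ hτ] at h3
    exact hS.hP τ (ball_subset_ball (by linarith [hS.Rle]) hτ) h3
  have h2 : ∀ n, InjOn (f^[n] ∘ S.chartInv z) (ball p κ) := by
    intro n y hy y' hy' e
    obtain ⟨j, hj, hc⟩ := hcov n
    obtain ⟨τ, hτ, rfl⟩ := hc hy
    obtain ⟨τ', hτ', rfl⟩ := hc hy'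
    obtain ⟨k, hk⟩ := Nat.exists_eq_add_of_le hj
    simp only [comp_apply] at e
    have h3 := congrArg (f^[k]) e
    rw [← iterate_add_apply, ← iterate_add_apply, add_comm k n, ← hk, (hG j).sec τ hτ,
      (hG j).sec τ' hτ'] at h3
    rw [chartInv_inj S z h3]
  have hJ1 : dist (G (φ J) (ctr S z)) p < κ := hJ J le_rfl
  have hsub : ball (G (φ J) (ctr S z)) (κ - dist (G (φ J) (ctr S z)) p) ⊆ ball p κ :=
    ball_subset_ball' (by linarith)
  have h3 := fatou_of_ball (z := z) hS.hf (p := G (φ J) (ctr S z)) (by linarith)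
    (fun y hy => h1 y (hsub hy)) (fun n => (h2 n).mono hsub)
  have h4 := fatou_fwd hS.hf h3 (m (φ J))
  rw [(hG (φ J)).sec _ (mem_ball_self hR), ψc] at h4
  exact hS.hz h4

lemma Setup.rep (hS : Setup S f z ρ R) (hm : 1 ≤ m) (h : RB S f z R ρ m G) (hc : G (ctr S z) = ctr S z) :
    ‖deriv G (ctr S z)‖ < 1 := by
  by_contra hcon
  push Not at hcon
  have hcR : ctr S z ∈ ball (ctr S z) R := mem_ball_self hS.Rpos
  have hd := h.dfd _ hcR
  have he := h.sec _ hcR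
  rw [hc, ψc] at hd he
  have key : ∀ j, S.DefinedUpTo f z (m * j) ∧ f^[m * j] z = z := by
    intro j
    induction j with
    | zero => exact ⟨fun i hi => by simp at hi, rfl⟩
    | succ j ih =>
      have e : m * (j + 1) = m + m * j := by ring
      rw [e]
      refine ⟨defined_add.mpr ⟨hd, by rw [he]; exact ih.1⟩, ?_⟩
      rw [add_comm, iterate_add_apply, he, ih.2]
  set Φ := S.chart z ∘ f^[m] ∘ S.chartInv z with hΦ
  have hev : ∀ j, Φ^[j] =ᶠ[𝓝 (ctr S z)] S.chart z ∘ f^[m * j] ∘ S.chartInv z := by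
    intro j
    induction j with
    | zero => 
      apply Eventually.of_forall
      intro x
      simp [chart_chartInv]
    | succ j ih =>
      have hcont : ContinuousAt (f^[m * j] ∘ S.chartInv z) (ctr S z) := by
        apply ContinuousAt.comp _ (chartInv_cont S z).continuousAt
        rw [ψc]; exact (holAt_iter (key j).1).1
      have hev2 : ∀ᶠ x in 𝓝 (ctr S z), (f^[m * j] ∘ S.chartInv z) x ∈ range (S.chartInv z) := by
        apply hcont.eventually (p := fun y => y ∈ range (S.chartInv z))
        simp only [comp_apply]
        rw [ψc, (key j).2]
        exact (isOpen_range_chartInv S z).mem_nhds (mem_range_chartInv S z)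
      filter_upwards [ih, hev2] with x hx hx2
      rw [iterate_succ_apply', hx]
      simp only [hΦ, comp_apply] at hx2 ⊢
      rw [chartInv_chart S hx2, ← iterate_add_apply, show m + m * j = m * (j + 1) by ring]
  have hΦc : Φ (ctr S z) = ctr S z := by
    have := h.phi_eq hcR
    rwa [hc] at this
  have hΦd : HasDerivAt Φ (deriv Φ (ctr S z)) (ctr S z) := by
    have := h.phi_an hcR
    rw [hc] at this
    exact this.differentiableAt.hasDerivAt
  have hmul := h.deriv_mul hcR
  rw [hc] at hmul
  obtain ⟨N, hN⟩ := hS.K 1 one_pos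
  obtain ⟨H, hH, hHc⟩ := hS.rbex (m * N) _ hcR _ hcR (by rw [ψc]; exact (key N).1)
    (by rw [ψc]; exact (key N).2)
  have hlt := hN (m * N) (Nat.le_mul_of_pos_left N hm) H hH
  have hmul2 := hH.deriv_mul hcR
  rw [hHc, ← (hev N).deriv_eq, (HasDerivAt.iterate _ hΦd hΦc N).deriv] at hmul2
  have n1 : ‖deriv Φ (ctr S z)‖ ≤ 1 := by
    have := congrArg norm hmul
    rw [norm_mul, norm_one] at this
    nlinarith [norm_nonneg (deriv Φ (ctr S z))]
  have n2 := congrArg norm hmul2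
  rw [norm_mul, norm_pow, norm_one] at n2
  have n3 : ‖deriv Φ (ctr S z)‖ ^ N ≤ 1 := pow_le_one₀ (norm_nonneg _) n1
  have n4 : 0 ≤ ‖deriv Φ (ctr S z)‖ ^ N := by positivity
  nlinarith [norm_nonneg (deriv H (ctr S z))]

lemma unif_of_mono {P : ℕ → ℝ → Prop} (hmono : ∀ m e e', 0 < e' → e' ≤ e → P m e → P m e')
    (h : ∀ m, ∃ e > 0, P m e) (N : ℕ) : ∃ e > 0, ∀ m < N, P m e := by
  induction N with
  | zero => exact ⟨1, one_pos, fun m hm => by omega⟩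
  | succ N ih =>
    obtain ⟨e, he, h1⟩ := ih
    obtain ⟨e', he', h2⟩ := h N
    refine ⟨min e e', by positivity, fun m hm => ?_⟩
    rcases Nat.lt_succ_iff_lt_or_eq.mp hm with h3 | rfl
    · exact hmono m e _ (by positivity) (min_le_left _ _) (h1 m h3)
    · exact hmono m e' _ (by positivity) (min_le_right _ _) h2

lemma Setup.star (hS : Setup S f z ρ R) : ∃ r₀ > 0, 2 * r₀ < R / 2 ∧ ∀ s, 0 < s → s < r₀ → ∀ m ≥ 1, ∀ G,
    RB S f z R ρ m G → (∃ τ ∈ ball (ctr S z) (2 * s), G τ ∈ closedBall (ctr S z) s) →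
    MapsTo G (ball (ctr S z) (2 * s)) (ball (ctr S z) (2 * s)) ∧
    (G (ctr S z) = ctr S z ∨ ∀ τ ∈ ball (ctr S z) (2 * s), ∀ σ ∈ ball (ctr S z) (2 * s), ‖G τ - G σ‖ < s) := by
  have hR := hS.Rpos
  set c := ctr S z with hc
  have hcR : c ∈ ball c R := mem_ball_self hR
  obtain ⟨C, hC, hCb⟩ := hS.consts
  set K := Real.exp 2049 with hK
  have hK0 : 0 < K := Real.exp_pos _
  set δ := 1 / (8 * K) with hδ
  have hδ0 : 0 < δ := by positivity
  obtain ⟨N, hN⟩ := hS.K δ hδ0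
  obtain ⟨s₁, hs₁, hs₁R, hk⟩ := hS.koeR hδ0
  obtain ⟨e, he, hP⟩ := unif_of_mono (P := fun m e => (∀ t, f^[m] z = S.chartInv z t → t ≠ c → e ≤ ‖t - c‖) ∧
    (1 ≤ m → ∀ G, RB S f z R ρ m G → G c = c → ‖deriv G c‖ ≤ 1 - e)) (by
      rintro m e e' he' hle ⟨h1, h2⟩
      exact ⟨fun t h3 h4 => hle.trans (h1 t h3 h4), fun hm G hG hGc => (h2 hm G hG hGc).trans (by linarith)⟩) (by
      intro m
      have A : ∃ e > 0, ∀ t, f^[m] z = S.chartInv z t → t ≠ c → e ≤ ‖t - c‖ := by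
        by_cases h : ∃ t, f^[m] z = S.chartInv z t ∧ t ≠ c
        · obtain ⟨t, ht, htc⟩ := h
          refine ⟨‖t - c‖, norm_pos_iff.mpr (sub_ne_zero.mpr htc), fun t' ht' _ => ?_⟩
          rw [chartInv_inj S z (ht'.symm.trans ht)]
        · push Not at h
          exact ⟨1, one_pos, fun t ht htc => absurd (h t ht) htc⟩
      have B : ∃ e > 0, 1 ≤ m → ∀ G, RB S f z R ρ m G → G c = c → ‖deriv G c‖ ≤ 1 - e := by
        by_cases h : 1 ≤ m ∧ ∃ G, RB S f z R ρ m G ∧ G c = c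
        · obtain ⟨hm, G, hG, hGc⟩ := h
          refine ⟨1 - ‖deriv G c‖, by linarith [hS.rep hm hG hGc], fun _ G' hG' hGc' => ?_⟩
          have h1 := (hG'.unique hG hcR hcR (hGc'.trans hGc.symm)).2
          have h2 : G' =ᶠ[𝓝 c] G := h1.eventuallyEq_of_mem (isOpen_ball.mem_nhds hcR)
          rw [h2.deriv_eq]; linarith
        · push Not at h
          exact ⟨1, one_pos, fun hm G hG hGc => absurd hGc (h hm G hG)⟩
      obtain ⟨e, he, h1⟩ := A
      obtain ⟨e', he', h2⟩ := B
      exact ⟨min e e', by positivity, fun t h3 h4 => (min_le_left _ _).trans (h1 t h3 h4),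
        fun hm G hG hGc => (h2 hm G hG hGc).trans (by linarith [min_le_right e e'])⟩) N
  set D := 8 * (C + 1) / δ with hD
  have hD0 : 0 < D := by positivity
  refine ⟨min (min (R / 8) (s₁ / D)) (min (e / D) (e / (2 * C))), by positivity, ?_, ?_⟩
  · have : min (min (R / 8) (s₁ / D)) (min (e / D) (e / (2 * C))) ≤ R / 8 :=
      (min_le_left _ _).trans (min_le_left _ _)
    linarith
  intro s hs hsr m hm G hG hex
  obtain ⟨τ, hτ, hGτ⟩ := hex
  simp only [lt_min_iff] at hsr
  obtain ⟨⟨hr1, hr2⟩, hr3, hr4⟩ := hsr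
  rw [lt_div_iff₀ hD0] at hr2 hr3
  rw [lt_div_iff₀ (by positivity)] at hr4
  have hsub : ball c (2 * s) ⊆ ball c (R / 2) := ball_subset_ball (by linarith)
  have hsub' : ball c (R / 2) ⊆ ball c R := ball_subset_ball (by linarith)
  rw [mem_closedBall, dist_eq_norm] at hGτ
  rcases lt_or_ge ‖deriv G c‖ δ with hsmall | hbig
  · have hg : ∀ w ∈ ball c (2 * s), ‖G w - G c‖ ≤ s / 4 := by
      intro w hw
      have := growth hR hG.diff hG.inj (hG.deriv_ne hcR) w (hsub hw)
      rw [mem_ball, dist_eq_norm] at hw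
      calc _ ≤ _ := this
        _ ≤ K * δ * (2 * s) := by gcongr
        _ = s / 4 := by rw [hδ]; field_simp; norm_num
    have hg2 : ∀ τ ∈ ball c (2 * s), ∀ σ ∈ ball c (2 * s), ‖G τ - G σ‖ < s := by
      intro τ hτ σ hσ
      have := norm_sub_le_norm_sub_add_norm_sub (G τ) (G c) (G σ)
      have h1 := hg τ hτ
      have h2 := hg σ hσ
      rw [norm_sub_rev] at h2
      linarith
    refine ⟨fun w hw => ?_, Or.inr hg2⟩
    rw [mem_ball, dist_eq_norm]
    have := norm_sub_le_norm_sub_add_norm_sub (G w) (G τ) c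
    linarith [hg2 w hw τ hτ]
  · have hmN : m < N := by
      by_contra hcon
      push Not at hcon
      linarith [hN m hcon G hG]
    obtain ⟨hP1, hP2⟩ := hP m hmN
    have hder : ∀ w ∈ ball c (2 * s), HasDerivWithinAt G (deriv G w) (ball c (2 * s)) w := fun w hw =>
      (hG.an (hsub' (hsub hw))).differentiableAt.hasDerivAt.hasDerivWithinAt
    have hcs : c ∈ ball c (2 * s) := mem_ball_self (by positivity)
    have h1 : ‖G c - G τ‖ ≤ C * (2 * s) := by
      have := (convex_ball c (2 * s)).norm_image_sub_le_of_norm_hasDerivWithin_le hder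
        (fun w hw => (hCb m G hG w (hsub hw)).1) hτ hcs
      rw [mem_ball, dist_comm, dist_eq_norm] at hτ
      calc _ ≤ _ := this
        _ ≤ _ := by gcongr
    have h2 : ‖G c - c‖ < δ * (D * s) / 4 := by
      have := norm_sub_le_norm_sub_add_norm_sub (G c) (G τ) c
      have e1 : δ * (D * s) / 4 = 2 * (C + 1) * s := by rw [hD]; field_simp; norm_num
      rw [e1]; nlinarith
    obtain ⟨t, ht, hGt⟩ := hk m G hG hbig (D * s) (by positivity) (by linarith) (show c ∈ _ by
      rw [mem_ball, dist_comm, dist_eq_norm]; exact h2)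
    rw [mem_closedBall, dist_eq_norm] at ht
    have htR : t ∈ ball c R := by
      rw [mem_ball, dist_eq_norm]; linarith
    have htc : t = c := by
      by_contra hne
      have h3 := hG.sec t htR
      rw [hGt, hc, ψc] at h3
      linarith [hP1 t h3 hne]
    rw [htc] at hGt
    refine ⟨fun w hw => ?_, Or.inl hGt⟩
    have h4 := (convex_ball c (2 * s)).norm_image_sub_le_of_norm_hasDerivWithin_le (C := 1) hder (by
      intro v hv
      have h5 := (hCb m G hG v (hsub hv)).2
      have h6 := hP2 hm G hG hGt
      rw [mem_ball, dist_eq_norm] at hv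
      have h7 := norm_sub_norm_le (deriv G v) (deriv G c)
      nlinarith) hcs hw
    rw [hGt, one_mul] at h4
    rw [mem_ball, dist_eq_norm] at hw ⊢
    linarith

end star
end NiceSet

namespace NiceSet
section constr
variable {𝕊 : Type} [MetricSpace 𝕊] [CompactSpace 𝕊]

/-- Points entering the small disk in at most `n` steps. -/
def An (S : SphereModel 𝕊) (f : 𝕊 → 𝕊) (z : 𝕊) (s : ℝ) (n : ℕ) : Set 𝕊 :=
  {x | ∃ i ≤ n, S.DefinedUpTo f x i ∧ f^[i] x ∈ S.chartInv z '' ball (ctr S z) s}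

/-- The component of the base point. -/
def Wn (S : SphereModel 𝕊) (f : 𝕊 → 𝕊) (z : 𝕊) (R s : ℝ) (n : ℕ) : Set ℂ :=
  connectedComponentIn (S.chartInv z ⁻¹' An S f z s n ∩ ball (ctr S z) R) (ctr S z)

/-- The union of the components. -/
def Wi (S : SphereModel 𝕊) (f : 𝕊 → 𝕊) (z : 𝕊) (R s : ℝ) : Set ℂ := ⋃ n, Wn S f z R s n

/-- Setting together with a good radius. -/
structure Good (S : SphereModel 𝕊) (f : 𝕊 → 𝕊) (z : 𝕊) (ρ R s : ℝ) : Prop where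
  set : Setup S f z ρ R
  spos : 0 < s
  sle : 2 * s < R / 2
  star : ∀ m ≥ 1, ∀ G, RB S f z R ρ m G → (∃ τ ∈ ball (ctr S z) (2 * s), G τ ∈ closedBall (ctr S z) s) →
    MapsTo G (ball (ctr S z) (2 * s)) (ball (ctr S z) (2 * s)) ∧
    (G (ctr S z) = ctr S z ∨ ∀ τ ∈ ball (ctr S z) (2 * s), ∀ σ ∈ ball (ctr S z) (2 * s), ‖G τ - G σ‖ < s)

variable {S : SphereModel 𝕊} {f : 𝕊 → 𝕊} {z : 𝕊} {R ρ s : ℝ} {m n : ℕ} {G : ℂ → ℂ}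

lemma An_open (hf : S.MeroOrRat f) : IsOpen (An S f z s n) := by
  rw [isOpen_iff_mem_nhds]
  rintro x ⟨i, hi, hd, hx⟩
  have h1 : ∀ᶠ y in 𝓝 x, f^[i] y ∈ S.chartInv z '' ball (ctr S z) s :=
    (holAt_iter hd).1.eventually (p := fun y => y ∈ S.chartInv z '' ball (ctr S z) s)
      ((chartInv_open S z _ isOpen_ball).mem_nhds hx)
  filter_upwards [defined_nhds hf hd, h1] with y hy1 hy2
  exact ⟨i, hi, hy1, hy2⟩

lemma An_mono {k : ℕ} (h : n ≤ k) : An S f z s n ⊆ An S f z s k := by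
  rintro x ⟨i, hi, h2⟩
  exact ⟨i, hi.trans h, h2⟩

lemma An_pull {x : 𝕊} (hd : S.DefinedUpTo f x m) (hx : f^[m] x ∈ An S f z s n) : x ∈ An S f z s (n + m) := by
  obtain ⟨i, hi, h1, h2⟩ := hx
  refine ⟨m + i, by omega, defined_add.mpr ⟨hd, h1⟩, ?_⟩
  rw [add_comm, iterate_add_apply]; exact h2

lemma Good.base_open (h : Good S f z ρ R s) (n : ℕ) :
    IsOpen (S.chartInv z ⁻¹' An S f z s n ∩ ball (ctr S z) R) :=
  ((An_open h.set.hf).preimage (chartInv_cont S z)).inter isOpen_ball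

lemma Good.ball_base (h : Good S f z ρ R s) (n : ℕ) :
    ball (ctr S z) s ⊆ S.chartInv z ⁻¹' An S f z s n ∩ ball (ctr S z) R := by
  intro x hx
  refine ⟨⟨0, Nat.zero_le _, fun i hi => by omega, mem_image_of_mem _ hx⟩, ?_⟩
  exact ball_subset_ball (by linarith [h.sle, h.spos]) hx

lemma Good.ball_Wn (h : Good S f z ρ R s) (n : ℕ) : ball (ctr S z) s ⊆ Wn S f z R s n :=
  (convex_ball _ _).isPreconnected.subset_connectedComponentIn (mem_ball_self h.spos) (h.ball_base n)

lemma Good.c_Wn (h : Good S f z ρ R s) (n : ℕ) : ctr S z ∈ Wn S f z R s n :=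
  h.ball_Wn n (mem_ball_self h.spos)

lemma Good.Wn_open (h : Good S f z ρ R s) (n : ℕ) : IsOpen (Wn S f z R s n) :=
  (h.base_open n).connectedComponentIn

lemma Wn_sub (n : ℕ) : Wn S f z R s n ⊆ S.chartInv z ⁻¹' An S f z s n ∩ ball (ctr S z) R :=
  connectedComponentIn_subset _ _

lemma Good.Wn_conn (h : Good S f z ρ R s) (n : ℕ) : IsConnected (Wn S f z R s n) :=
  ⟨⟨_, h.c_Wn n⟩, isPreconnected_connectedComponentIn⟩

lemma Wn_mono {k : ℕ} (hk : n ≤ k) : Wn S f z R s n ⊆ Wn S f z R s k :=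
  connectedComponentIn_mono _ (inter_subset_inter_left _ (preimage_mono (An_mono hk)))

/-- connected subsets of the sphere staying in `An` -/
lemma Good.comp_lem (h : Good S f z ρ R s) (hW : Wn S f z R s n ⊆ ball (ctr S z) (2 * s))
    {Y : Set 𝕊} (hY : IsPreconnected Y) (hYA : Y ⊆ An S f z s n)
    (hm : (Y ∩ S.chartInv z '' Wn S f z R s n).Nonempty) : Y ⊆ S.chartInv z '' Wn S f z R s n := by
  have hcl : closure (S.chartInv z '' Wn S f z R s n) ⊆ S.chartInv z '' (closedBall (ctr S z) (2 * s) ∩ closure (Wn S f z R s n)) := by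
    apply closure_minimal
    · apply image_mono
      exact subset_inter (hW.trans ball_subset_closedBall) subset_closure
    · apply IsCompact.isClosed
      exact ((isCompact_closedBall _ _).inter_right isClosed_closure).image (chartInv_cont S z)
  have hcover : Y ⊆ S.chartInv z '' Wn S f z R s n ∪ (closure (S.chartInv z '' Wn S f z R s n))ᶜ := by
    intro y hy
    by_cases hyc : y ∈ closure (S.chartInv z '' Wn S f z R s n)
    · left
      obtain ⟨x, ⟨hx1, hx2⟩, rfl⟩ := hcl hyc
      refine mem_image_of_mem _ ?_
      have hxb : x ∈ S.chartInv z ⁻¹' An S f z s n ∩ ball (ctr S z) R :=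
        ⟨hYA hy, closedBall_subset_ball (by linarith [h.sle, h.set.Rpos]) hx1⟩
      have ho : IsOpen (connectedComponentIn (S.chartInv z ⁻¹' An S f z s n ∩ ball (ctr S z) R) x) :=
        (h.base_open n).connectedComponentIn
      obtain ⟨w, hw1, hw2⟩ := mem_closure_iff.mp hx2 _ ho (mem_connectedComponentIn hxb)
      have e1 := connectedComponentIn_eq hw1
      have e2 := connectedComponentIn_eq hw2
      have := mem_connectedComponentIn hxb
      rw [e1, ← e2] at this
      exact this
    · right; exact hyc
  refine hY.subset_left_of_subset_union (chartInv_open S z _ (h.Wn_open n)) isClosed_closure.isOpen_compl ?_ hcover hm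
  exact disjoint_compl_right.mono_left subset_closure

/-- A final arm of a path. -/
lemma tail_arm {V : Set ℂ} (hV : IsPathConnected V) {c x : ℂ} {s : ℝ} (hs : 0 ≤ s) (hc : c ∈ V) (hx : x ∈ V)
    (hxs : s < dist x c) : ∃ X ⊆ V, IsPreconnected X ∧ x ∈ X ∧ (∃ x₀ ∈ X, dist x₀ c = s) ∧
      ∀ y ∈ X, s ≤ dist y c := by
  obtain ⟨γ, hγ⟩ := hV.joinedIn c hc x hx
  set T : Set unitInterval := {t | dist (γ t) c ≤ s} with hT
  have hTc : IsCompact T := (isClosed_le (by fun_prop) continuous_const).isCompact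
  have hTn : T.Nonempty := ⟨0, by simp [hT, hs]⟩
  obtain ⟨t₀, ht₀⟩ := hTc.exists_isGreatest hTn
  have hlt : ∀ t, t₀ < t → s < dist (γ t) c := by
    intro t ht
    by_contra hcon
    push Not at hcon
    exact absurd (ht₀.2 hcon) (not_le.mpr ht)
  have ht1 : t₀ < 1 := by
    rcases lt_or_eq_of_le (unitInterval.le_one' : t₀ ≤ 1) with h | h
    · exact h
    · have := ht₀.1
      rw [h] at this
      simp only [hT, mem_ofPred_eq, Path.target] at this
      linarith
  have heq : dist (γ t₀) c = s := by
    apply le_antisymm ht₀.1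
    have hcont : ContinuousWithinAt (fun t => dist (γ t) c) (Ioi t₀) t₀ := by fun_prop
    have hne : (𝓝[>] t₀).NeBot := by
      exact nhdsGT_neBot_of_exists_gt ⟨1, ht1⟩
    apply ge_of_tendsto hcont
    filter_upwards [self_mem_nhdsWithin] with t ht
    exact (hlt t ht).le
  refine ⟨γ '' Icc t₀ 1, ?_, ?_, ?_, ?_, ?_⟩
  · rintro _ ⟨t, -, rfl⟩; exact hγ t
  · exact isPreconnected_Icc.image _ (by fun_prop)
  · exact ⟨1, ⟨ht1.le, le_rfl⟩, by simp⟩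
  · exact ⟨γ t₀, mem_image_of_mem _ ⟨le_rfl, ht1.le⟩, heq⟩
  · rintro _ ⟨t, ht, rfl⟩
    rcases lt_or_eq_of_le ht.1 with h | h
    · exact (hlt t h).le
    · rw [← h, heq]

lemma RB.locinj (h : RB S f z R ρ m G) {a : ℂ} (ha : a ∈ ball (ctr S z) R) :
    ∃ V ∈ 𝓝 (S.chartInv z (G a)), InjOn (f^[m]) V := by
  refine (section_holC (F := f^[m]) (b := z) (t := a) (h := S.chartInv z ∘ G)
        (holAt_iter (h.dfd a ha)) ?_ ?_).2
  · filter_upwards [isOpen_ball.mem_nhds ha] with σ hσ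
    exact (chartInv_cont S z).continuousAt.comp (h.an hσ).continuousAt
  · filter_upwards [isOpen_ball.mem_nhds ha] with σ hσ
    exact h.sec σ hσ

/-- pulling back connected sets along branches -/
lemma RB.pull (h : RB S f z R ρ m G) {X B : Set ℂ} (hX : IsPreconnected X) (hB : B ⊆ ball (ctr S z) R)
    (hd : ∀ x ∈ X, S.DefinedUpTo f (S.chartInv z x) m)
    (hm : ∀ x ∈ X, f^[m] (S.chartInv z x) ∈ S.chartInv z '' B) {τ : ℂ} (hτ : τ ∈ ball (ctr S z) R)
    (hGτ : G τ ∈ X) : X ⊆ G '' B := by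
  set θ := S.chart z ∘ f^[m] ∘ S.chartInv z with hθ
  have hθB : ∀ x ∈ X, θ x ∈ B ∧ S.chartInv z (θ x) = f^[m] (S.chartInv z x) := by
    intro x hx
    obtain ⟨b, hb, e⟩ := hm x hx
    have : θ x = b := by
      simp only [hθ, comp_apply]; rw [← e, chart_chartInv]
    rw [this]; exact ⟨hb, e⟩
  have hθc : ContinuousOn θ X := by
    intro x hx
    have h1 : ContinuousAt (f^[m] ∘ S.chartInv z) x :=
      ContinuousAt.comp (holAt_iter (hd x hx)).1 (chartInv_cont S z).continuousAt
    have h2 : ContinuousAt (S.chart z) ((f^[m] ∘ S.chartInv z) x) := by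
      apply chart_continuousAt
      exact image_subset_range _ _ (hm x hx)
    exact (ContinuousAt.comp h2 h1).continuousWithinAt
  have key : EqOn (S.chartInv z ∘ G ∘ θ) (S.chartInv z) X := by
    apply sec_unique (F := f^[m]) hX _ (chartInv_cont S z).continuousOn _ _ hGτ
    · simp only [comp_apply]
      rw [show θ (G τ) = τ from h.phi_eq hτ]
    · exact (chartInv_cont S z).comp_continuousOn
        (h.diff.continuousOn.comp hθc (fun x hx => hB (hθB x hx).1))
    · intro a ha
      simp only [comp_apply]
      rw [h.sec _ (hB (hθB a ha).1), (hθB a ha).2]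
    · intro a ha
      exact h.locinj (hB (hθB a ha).1)
  intro x hx
  exact ⟨θ x, (hθB x hx).1, chartInv_inj S z (key hx)⟩

lemma Good.arm (h : Good S f z ρ R s) (ih : ∀ k < n, Wn S f z R s k ⊆ ball (ctr S z) (2 * s))
    {y : ℂ} (hy : y ∈ Wn S f z R s n) (hys : s < dist y (ctr S z)) :
    ∃ m ≥ 1, ∃ G, RB S f z R ρ m G ∧ ∃ k, Wn S f z R s k ⊆ ball (ctr S z) (2 * s) ∧
      y ∈ G '' Wn S f z R s k ∧ ∃ τ ∈ Wn S f z R s k, dist (G τ) (ctr S z) = s := by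
  have hpc : IsPathConnected (Wn S f z R s n) := (h.Wn_open n).isConnected_iff_isPathConnected.mp (h.Wn_conn n)
  obtain ⟨X, hXW, hX, hyX, ⟨x₀, hx₀, hx₀s⟩, hXs⟩ := tail_arm hpc h.spos.le (h.c_Wn n) hy hys
  classical
  have hidx : ∃ m, ∃ x ∈ X, m ≤ n ∧ S.DefinedUpTo f (S.chartInv z x) m ∧
      f^[m] (S.chartInv z x) ∈ S.chartInv z '' ball (ctr S z) s := by
    obtain ⟨i, hi, h1⟩ := (Wn_sub n (hXW hyX)).1
    exact ⟨i, y, hyX, hi, h1⟩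
  set m := Nat.find hidx with hm
  obtain ⟨x₁, hx₁, hmn, hd₁, he₁⟩ := Nat.find_spec hidx
  rw [← hm] at hmn hd₁ he₁
  have hmin : ∀ x ∈ X, ∀ i ≤ n, S.DefinedUpTo f (S.chartInv z x) i →
      f^[i] (S.chartInv z x) ∈ S.chartInv z '' ball (ctr S z) s → m ≤ i := by
    intro x hx i hi h1 h2
    exact Nat.find_min' hidx ⟨x, hx, hi, h1, h2⟩
  have hm1 : 1 ≤ m := by
    by_contra hcon
    have h0 : m = 0 := by omega
    rw [h0] at he₁
    obtain ⟨b, hb, e⟩ := he₁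
    simp only [iterate_zero, id_eq] at e
    rw [chartInv_inj S z e, mem_ball] at hb
    linarith [hXs x₁ hx₁]
  have hXd : ∀ x ∈ X, S.DefinedUpTo f (S.chartInv z x) m ∧ f^[m] (S.chartInv z x) ∈ An S f z s (n - m) := by
    intro x hx
    obtain ⟨i, hi, h1, h2⟩ := (Wn_sub n (hXW hx)).1
    have hmi := hmin x hx i hi h1 h2
    obtain ⟨k, rfl⟩ := Nat.exists_eq_add_of_le hmi
    refine ⟨defined_mono h1 hmi, k, by omega, (defined_add.mp h1).2, ?_⟩
    rw [← iterate_add_apply, add_comm]; exact h2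
  have hY : IsPreconnected ((f^[m] ∘ S.chartInv z) '' X) := by
    apply hX.image
    intro x hx
    exact (ContinuousAt.comp (holAt_iter (hXd x hx).1).1 (chartInv_cont S z).continuousAt).continuousWithinAt
  have hYW := h.comp_lem (ih (n - m) (by omega)) hY (by rintro _ ⟨x, hx, rfl⟩; exact (hXd x hx).2)
    ⟨_, mem_image_of_mem _ hx₁, image_mono (h.ball_Wn _) he₁⟩
  have hWR : Wn S f z R s (n - m) ⊆ ball (ctr S z) R := fun x hx => (Wn_sub _ hx).2
  obtain ⟨τ, hτ, hτe⟩ := hYW (mem_image_of_mem _ hx₀)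
  obtain ⟨G, hG, hGτ⟩ := h.set.rbex m x₀ (Wn_sub n (hXW hx₀)).2 τ (hWR hτ) (hXd x₀ hx₀).1 hτe.symm
  refine ⟨m, hm1, G, hG, n - m, ih _ (by omega), ?_, τ, hτ, by rw [hGτ]; exact hx₀s⟩
  exact hG.pull hX hWR (fun x hx => (hXd x hx).1) (fun x hx => hYW (mem_image_of_mem _ hx)) (hWR hτ)
    (by rw [hGτ]; exact hx₀) hyX

lemma Good.Wn_ball (h : Good S f z ρ R s) (n : ℕ) : Wn S f z R s n ⊆ ball (ctr S z) (2 * s) := by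
  induction n using Nat.strong_induction_on with
  | _ n ih =>
    intro y hy
    by_cases hys : s < dist y (ctr S z)
    · obtain ⟨m, hm, G, hG, k, hk, ⟨τ, hτ, rfl⟩, σ, hσ, hσe⟩ := h.arm ih hy hys
      exact (h.star m hm G hG ⟨σ, hk hσ, by rw [mem_closedBall, hσe]⟩).1 (hk hτ)
    · rw [mem_ball]; linarith [h.spos]

lemma Good.Wi_ball (h : Good S f z ρ R s) : Wi S f z R s ⊆ ball (ctr S z) (2 * s) :=
  iUnion_subset h.Wn_ball

lemma Good.ball_Wi (h : Good S f z ρ R s) : ball (ctr S z) s ⊆ Wi S f z R s :=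
  (h.ball_Wn 0).trans (subset_iUnion _ 0)

lemma Good.Wi_open (h : Good S f z ρ R s) : IsOpen (Wi S f z R s) := isOpen_iUnion h.Wn_open

lemma Good.Wi_preconn (h : Good S f z ρ R s) : IsPreconnected (Wi S f z R s) :=
  isPreconnected_iUnion ⟨ctr S z, mem_iInter.mpr h.c_Wn⟩ fun n => (h.Wn_conn n).isPreconnected

lemma Good.ball_R (h : Good S f z ρ R s) : ball (ctr S z) (2 * s) ⊆ ball (ctr S z) R :=
  ball_subset_ball (by linarith [h.sle, h.set.Rpos])

lemma Good.arm' (h : Good S f z ρ R s) {y : ℂ} (hy : y ∈ Wi S f z R s) (hys : s < dist y (ctr S z)) :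
    ∃ m ≥ 1, ∃ G, RB S f z R ρ m G ∧ y ∈ G '' Wi S f z R s ∧
      ∃ τ ∈ Wi S f z R s, dist (G τ) (ctr S z) = s := by
  obtain ⟨n, hn⟩ := mem_iUnion.mp hy
  obtain ⟨m, hm, G, hG, k, hk, h1, σ, hσ, hσe⟩ := h.arm (fun k _ => h.Wn_ball k) hn hys
  exact ⟨m, hm, G, hG, image_mono (subset_iUnion _ k) h1, σ, mem_iUnion.mpr ⟨k, hσ⟩, hσe⟩

lemma Good.dicho (h : Good S f z ρ R s) (hG : RB S f z R ρ m G) :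
    MapsTo G (Wi S f z R s) (Wi S f z R s) ∨ Disjoint (G '' Wi S f z R s) (Wi S f z R s) := by
  by_cases hd : Disjoint (G '' Wi S f z R s) (Wi S f z R s)
  · right; exact hd
  left
  obtain ⟨_, ⟨w, hw, rfl⟩, hGw⟩ := not_disjoint_iff.mp hd
  obtain ⟨n, hn⟩ := mem_iUnion.mp hw
  obtain ⟨k, hk⟩ := mem_iUnion.mp hGw
  intro v hv
  obtain ⟨j, hj⟩ := mem_iUnion.mp hv
  set a := max n j with ha
  set b := max (a + m) k with hb
  have hWR : Wn S f z R s a ⊆ ball (ctr S z) R := fun x hx => (Wn_sub _ hx).2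
  have hY : IsPreconnected ((S.chartInv z ∘ G) '' Wn S f z R s a) :=
    (h.Wn_conn a).isPreconnected.image _
      ((chartInv_cont S z).comp_continuousOn (hG.diff.continuousOn.mono hWR))
  have := h.comp_lem (n := b) (h.Wn_ball b) hY (by
    rintro _ ⟨x, hx, rfl⟩
    apply An_mono (le_max_left _ _)
    apply An_pull (hG.dfd x (hWR hx))
    rw [hG.sec x (hWR hx)]
    exact (Wn_sub a hx).1)
    ⟨_, mem_image_of_mem _ (Wn_mono (le_max_left _ _) hn), mem_image_of_mem _ (Wn_mono (le_max_right _ _) hk)⟩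
  obtain ⟨u, hu, hue⟩ := this (mem_image_of_mem _ (Wn_mono (le_max_right n j) hj))
  rw [comp_apply] at hue
  rw [← chartInv_inj S z hue]
  exact mem_iUnion.mpr ⟨b, hu⟩

end constr
end NiceSet

namespace NiceSet
section hull

/-- The filled hull of a planar set. -/
def hull (W : Set ℂ) : Set ℂ := ⋃₀ {O | IsOpen O ∧ Bornology.IsBounded O ∧ frontier O ⊆ W}

variable {W : Set ℂ} {c : ℂ} {r : ℝ}

lemma ray {O : Set ℂ} (hO : IsOpen O) (hb : Bornology.IsBounded O) {x v : ℂ} (hx : x ∈ O) (hv : v ≠ 0) :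
    ∃ t : ℝ, 0 ≤ t ∧ x + t * v ∈ frontier O ∧ ∀ t' : ℝ, 0 ≤ t' → t' < t → x + t' * v ∈ O := by
  have hcont : Continuous (fun t : ℝ => x + t * v) := by fun_prop
  set T : Set ℝ := {t | 0 ≤ t ∧ x + t * v ∉ O} with hT
  have hTc : IsClosed T := by
    apply IsClosed.inter isClosed_Ici
    exact (hO.preimage hcont).isClosed_compl
  have hTn : T.Nonempty := by
    obtain ⟨M, hM0, hM⟩ := hb.exists_pos_norm_le
    refine ⟨(M + ‖x‖ + 1) / ‖v‖, by positivity, fun h => ?_⟩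
    have h1 := hM _ h
    have hv' : 0 < ‖v‖ := norm_pos_iff.mpr hv
    have h2 : ‖(((M + ‖x‖ + 1) / ‖v‖ : ℝ) : ℂ) * v‖ = M + ‖x‖ + 1 := by
      rw [norm_mul, Complex.norm_real, Real.norm_of_nonneg (by positivity)]
      field_simp
    have h3 := norm_sub_le (x + (((M + ‖x‖ + 1) / ‖v‖ : ℝ) : ℂ) * v) x
    rw [add_sub_cancel_left, h2] at h3
    linarith
  have hbd : BddBelow T := ⟨0, fun t ht => ht.1⟩
  have hmem := hTc.csInf_mem hTn hbd
  set t := sInf T with ht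
  have hlt : ∀ t' : ℝ, 0 ≤ t' → t' < t → x + t' * v ∈ O := by
    intro t' h0 h1
    by_contra hcon
    exact absurd (csInf_le hbd (show t' ∈ T from ⟨h0, hcon⟩)) (not_le.mpr h1)
  refine ⟨t, hmem.1, ?_, hlt⟩
  rw [hO.frontier_eq]
  refine ⟨?_, hmem.2⟩
  have htpos : 0 < t := by
    rcases lt_or_eq_of_le hmem.1 with h | h
    · exact h
    · exfalso; apply hmem.2; rw [← h]; simpa using hx
  have h1 : t ∈ closure (Ico 0 t) := by
    rw [closure_Ico htpos.ne]; exact ⟨htpos.le, le_rfl⟩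
  exact map_mem_closure (f := fun t : ℝ => x + t * v) hcont h1 fun t' h' => hlt t' h'.1 h'.2

lemma sub_ball_of_frontier {O : Set ℂ} (hO : IsOpen O) (hb : Bornology.IsBounded O) (hr : 0 < r)
    (hfr : frontier O ⊆ ball c r) : O ⊆ ball c r := by
  intro x hx
  by_contra hcon
  rw [mem_ball, not_lt, dist_eq_norm] at hcon
  have hv : x - c ≠ 0 := by rw [← norm_pos_iff]; linarith
  obtain ⟨t, ht, h1, -⟩ := ray hO hb hx hv
  have h2 := hfr h1
  rw [mem_ball, dist_eq_norm] at h2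
  have e : x + t * (x - c) - c = ((1 + t : ℝ) : ℂ) * (x - c) := by push_cast; ring
  rw [e, norm_mul, Complex.norm_real, Real.norm_of_nonneg (by positivity)] at h2
  nlinarith

lemma hull_open : IsOpen (hull W) := isOpen_sUnion fun _ h => h.1

lemma sub_hull (hW : IsOpen W) : W ⊆ hull W := by
  intro x hx
  obtain ⟨ε, hε, hb⟩ := Metric.nhds_basis_closedBall.mem_iff.mp (hW.mem_nhds hx)
  exact ⟨ball x ε, ⟨isOpen_ball, isBounded_ball,
    (frontier_subset_closure.trans closure_ball_subset_closedBall).trans hb⟩, mem_ball_self hε⟩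

lemma hull_sub_ball (hr : 0 < r) (hWr : W ⊆ ball c r) : hull W ⊆ ball c r :=
  sUnion_subset fun _ h => sub_ball_of_frontier h.1 h.2.1 hr (h.2.2.trans hWr)

lemma hull_preconn (hW : IsOpen W) (hWc : IsPreconnected W) (hcW : c ∈ W) : IsPreconnected (hull W) := by
  apply isPreconnected_of_forall c
  rintro x ⟨O, ⟨hO, hOb, hfr⟩, hx⟩
  obtain ⟨t, ht, h1, h2⟩ := ray hO hOb hx one_ne_zero
  set L : Set ℂ := (fun t' : ℝ => x + t' * 1) '' Icc 0 t with hL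
  have hLc : IsPreconnected L := isPreconnected_Icc.image _ (by fun_prop)
  refine ⟨L ∪ W, union_subset ?_ (sub_hull hW), Or.inr hcW, Or.inl ⟨0, ⟨le_rfl, ht⟩, by simp⟩, ?_⟩
  · rintro _ ⟨t', ht', rfl⟩
    rcases lt_or_eq_of_le ht'.2 with h | h
    · exact ⟨O, ⟨hO, hOb, hfr⟩, h2 t' ht'.1 h⟩
    · rw [h]; exact sub_hull hW (hfr h1)
  · exact IsPreconnected.union _ (⟨t, ⟨ht, le_rfl⟩, rfl⟩) (hfr h1) hLc hWc

lemma hull_H {O : Set ℂ} (hO : IsOpen O) (hb : Bornology.IsBounded O) (hfr : frontier O ⊆ hull W) :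
    O ⊆ hull W := by
  have hcomp : IsCompact (frontier O) :=
    Metric.isCompact_of_isClosed_isBounded isClosed_frontier (hb.closure.subset frontier_subset_closure)
  obtain ⟨F, hF1, hF2, hF3⟩ := hcomp.elim_finite_subcover_image
    (b := {O | IsOpen O ∧ Bornology.IsBounded O ∧ frontier O ⊆ W}) (c := id) (fun _ h => h.1)
    (by rw [hull, sUnion_eq_biUnion] at hfr; exact hfr)
  have hF3 : frontier O ⊆ ⋃₀ F := by rw [sUnion_eq_biUnion]; exact hF3
  have hFo : IsOpen (⋃₀ F) := isOpen_sUnion fun _ h => (hF1 h).1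
  have hFfr : frontier (⋃₀ F) ⊆ W := by
    rw [hFo.frontier_eq, hF2.closure_sUnion]
    rintro x ⟨hx, hxn⟩
    simp only [mem_iUnion] at hx
    obtain ⟨A, hA, hxA⟩ := hx
    apply (hF1 hA).2.2
    rw [(hF1 hA).1.frontier_eq]
    exact ⟨hxA, fun h => hxn ⟨A, hA, h⟩⟩
  intro x hx
  refine ⟨O ∪ ⋃₀ F, ⟨hO.union hFo, hb.union ?_, ?_⟩, Or.inl hx⟩
  · rw [Bornology.isBounded_sUnion hF2]
    exact fun A hA => (hF1 hA).2.1
  · rw [(hO.union hFo).frontier_eq, closure_union]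
    rintro y ⟨hy | hy, hyn⟩
    · exfalso
      apply hyn
      right
      apply hF3
      rw [hO.frontier_eq]
      exact ⟨hy, fun h => hyn (Or.inl h)⟩
    · apply hFfr
      rw [hFo.frontier_eq]
      exact ⟨hy, fun h => hyn (Or.inr h)⟩

lemma preconn_frontier {Y O : Set ℂ} (hY : IsPreconnected Y) (hO : IsOpen O) (hd : Disjoint Y (frontier O)) :
    Y ⊆ O ∨ Disjoint Y O := by
  by_cases h : (Y ∩ O).Nonempty
  · left
    refine hY.subset_left_of_subset_union hO (isClosed_closure (s := O)).isOpen_compl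
      (disjoint_compl_right.mono_left subset_closure) ?_ h
    intro y hy
    by_cases hyc : y ∈ closure O
    · left
      by_contra hn
      exact disjoint_left.mp hd hy (by rw [hO.frontier_eq]; exact ⟨hyc, hn⟩)
    · right; exact hyc
  · right
    rw [disjoint_iff_inter_eq_empty]
    exact not_nonempty_iff_eq_empty.mp h

lemma frontier_hull (hW : IsOpen W) : frontier (hull W) ⊆ closure W \ W := by
  rw [hull_open.frontier_eq]
  rintro x ⟨hx, hxn⟩
  refine ⟨?_, fun h => hxn (sub_hull hW h)⟩
  by_contra hcon
  obtain ⟨ε, hε, hb⟩ := Metric.isOpen_iff.mp (isClosed_closure (s := W)).isOpen_compl x hcon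
  obtain ⟨y, hy1, O, hO, hyO⟩ := mem_closure_iff.mp hx (ball x ε) isOpen_ball (mem_ball_self hε)
  have hdis : Disjoint (ball x ε) (frontier O) := by
    rw [disjoint_left]
    intro w hw hw2
    exact hb hw (subset_closure (hO.2.2 hw2))
  rcases preconn_frontier (convex_ball x ε).isPreconnected hO.1 hdis with h | h
  · exact hxn ⟨O, hO, h (mem_ball_self hε)⟩
  · exact disjoint_left.mp h hy1 hyO

/-- The combinatorial heart: images of hulls. -/
lemma hull_image {G : ℂ → ℂ} {R s : ℝ} (hs : 0 < s) (hsR : 2 * s < R) (hW : IsOpen W) (hWc : IsPreconnected W)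
    (hB : ball c s ⊆ W) (hWB : W ⊆ ball c (2 * s)) (hGc : ContinuousOn G (ball c R))
    (hGo : ∀ O ⊆ ball c R, IsOpen O → IsOpen (G '' O)) (hGi : InjOn G (ball c R))
    (hdic : MapsTo G W W ∨ Disjoint (G '' W) W)
    (hstar : (∃ τ ∈ ball c (2 * s), G τ ∈ closedBall c s) → G c = c ∨
      ∀ τ ∈ ball c (2 * s), ∀ σ ∈ ball c (2 * s), ‖G τ - G σ‖ < s)
    (hne : (G '' hull W ∩ hull W).Nonempty) : MapsTo G (hull W) (hull W) := by
  have hBR : ball c (2 * s) ⊆ ball c R := ball_subset_ball hsR.le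
  have hcW : c ∈ W := hB (mem_ball_self hs)
  have hOB : ∀ O, IsOpen O → Bornology.IsBounded O → frontier O ⊆ W → closure O ⊆ ball c (2 * s) := by
    intro O h1 h2 h3
    rw [closure_eq_self_union_frontier]
    exact union_subset (sub_ball_of_frontier h1 h2 (by positivity) (h3.trans hWB)) (h3.trans hWB)
  have hGO : ∀ O, IsOpen O → Bornology.IsBounded O → frontier O ⊆ W →
      IsOpen (G '' O) ∧ Bornology.IsBounded (G '' O) ∧ frontier (G '' O) ⊆ G '' W := by
    intro O h1 h2 h3
    have hcl := (hOB O h1 h2 h3).trans hBR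
    have hco : IsCompact (closure O) := h2.isCompact_closure
    have hco' : IsCompact (G '' closure O) := hco.image_of_continuousOn (hGc.mono hcl)
    have ho : IsOpen (G '' O) := hGo O (subset_closure.trans hcl) h1
    refine ⟨ho, hco'.isBounded.subset (image_mono subset_closure), ?_⟩
    rw [ho.frontier_eq]
    rintro y ⟨hy, hyn⟩
    obtain ⟨x, hx, rfl⟩ := closure_minimal (image_mono subset_closure) hco'.isClosed hy
    refine mem_image_of_mem _ (h3 ?_)
    rw [h1.frontier_eq]
    exact ⟨hx, fun h => hyn (mem_image_of_mem _ h)⟩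
  rcases hdic with hA | hA
  · rintro x ⟨O, ⟨h1, h2, h3⟩, hx⟩
    obtain ⟨k1, k2, k3⟩ := hGO O h1 h2 h3
    exact ⟨G '' O, ⟨k1, k2, k3.trans hA.image_subset⟩, mem_image_of_mem _ hx⟩
  obtain ⟨_, ⟨x₂, ⟨O₂, ⟨a1, a2, a3⟩, hx₂⟩, rfl⟩, ⟨O₁, ⟨b1, b2, b3⟩, hx₁⟩⟩ := hne
  obtain ⟨k1, k2, k3⟩ := hGO O₂ a1 a2 a3
  have hGW : IsPreconnected (G '' W) := hWc.image _ (hGc.mono (hWB.trans hBR))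
  rcases preconn_frontier hGW b1 (hA.mono_right b3) with hB1 | hB2
  · rintro x ⟨O, ⟨h1, h2, h3⟩, hx⟩
    obtain ⟨l1, l2, l3⟩ := hGO O h1 h2 h3
    refine ⟨O₁ ∪ G '' O, ⟨b1.union l1, b2.union l2, ?_⟩, Or.inr (mem_image_of_mem _ hx)⟩
    rw [(b1.union l1).frontier_eq, closure_union]
    rintro y ⟨hy | hy, hyn⟩
    · apply b3
      rw [b1.frontier_eq]
      exact ⟨hy, fun h => hyn (Or.inl h)⟩
    · exfalso
      apply hyn
      left
      apply hB1
      apply l3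
      rw [l1.frontier_eq]
      exact ⟨hy, fun h => hyn (Or.inr h)⟩
  · exfalso
    rcases preconn_frontier hWc k1 ((hA.mono_left k3).symm) with hC1 | hC2
    · obtain ⟨τ, hτ, hτe⟩ := hC1 hcW
      have hτB : τ ∈ ball c (2 * s) := hOB O₂ a1 a2 a3 (subset_closure hτ)
      rcases hstar ⟨τ, hτB, by rw [hτe]; exact mem_closedBall_self hs.le⟩ with h | h
      · exact disjoint_left.mp hA (mem_image_of_mem _ hcW) (by rw [h]; exact hcW)
      · have hp : ∀ ε : ℝ, |ε| < s → c + ε ∈ W := by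
          intro ε hε
          apply hB
          rw [mem_ball, dist_eq_norm, add_sub_cancel_left, Complex.norm_real]; exact hε
        obtain ⟨u, hu, hue⟩ := hC1 (hp (3 * s / 4) (by rw [abs_of_pos (by positivity)]; linarith))
        obtain ⟨v, hv, hve⟩ := hC1 (hp (-(3 * s / 4)) (by rw [abs_neg, abs_of_pos (by positivity)]; linarith))
        have h1 := h u (hOB O₂ a1 a2 a3 (subset_closure hu)) v (hOB O₂ a1 a2 a3 (subset_closure hv))
        rw [hue, hve] at h1
        have e : c + ((3 * s / 4 : ℝ) : ℂ) - (c + ((-(3 * s / 4) : ℝ) : ℂ)) = ((3 * s / 2 : ℝ) : ℂ) := by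
          push_cast; ring
        rw [e, Complex.norm_real, Real.norm_of_nonneg (by positivity)] at h1
        linarith
    · set Q := O₁ ∩ G '' O₂ with hQ
      have hQo : IsOpen Q := b1.inter k1
      have hQc : IsClosed Q := by
        rw [← closure_subset_iff_isClosed]
        intro y hy
        have y1 : y ∈ closure O₁ := closure_mono inter_subset_left hy
        have y2 : y ∈ closure (G '' O₂) := closure_mono inter_subset_right hy
        rw [closure_eq_self_union_frontier] at y1 y2
        rcases y1 with y1 | y1 <;> rcases y2 with y2 | y2
        · exact ⟨y1, y2⟩
        · exact absurd y1 (disjoint_left.mp hB2 (k3 y2))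
        · exact absurd y2 (disjoint_left.mp hC2 (b3 y1))
        · exact absurd (b3 y1) (disjoint_left.mp hA (k3 y2))
      have hclopen : IsClopen Q := ⟨hQc, hQo⟩
      rcases isClopen_iff.mp hclopen with h | h
      · have : G x₂ ∈ Q := ⟨hx₁, mem_image_of_mem _ hx₂⟩
        rw [h] at this; exact this
      · have hbd : Bornology.IsBounded Q := b2.subset inter_subset_left
        rw [h] at hbd
        exact NormedSpace.unbounded_univ ℝ ℂ hbd

end hull
end NiceSet

namespace NiceSet
section final
variable {𝕊 : Type} [MetricSpace 𝕊] [CompactSpace 𝕊]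

/-- Points whose orbit leaves the domain after exactly `k` steps. -/
def prepole (S : SphereModel 𝕊) (f : 𝕊 → 𝕊) (k : ℕ) : Set 𝕊 :=
  {x | S.DefinedUpTo f x k ∧ f^[k] x ∉ S.dom f}

variable {S : SphereModel 𝕊} {f : 𝕊 → 𝕊} {z : 𝕊} {R ρ s : ℝ} {m n : ℕ} {G : ℂ → ℂ}

lemma fibre_countable (hf : S.MeroOrRat f) (q : 𝕊) : (S.dom f ∩ f ⁻¹' {q}).Countable := by
  have hd : DiscreteTopology ↥(S.dom f ∩ f ⁻¹' {q}) := by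
    rw [discreteTopology_subtype_iff]
    rintro x ⟨hx, hxq⟩
    rw [← disjoint_iff, disjoint_principal_right]
    filter_upwards [f_isolated hf hx] with y hy
    rintro ⟨-, hyq⟩
    exact hy (by rw [show f y = q from hyq, show f x = q from hxq])
  exact countable_coe_iff.mp (TopologicalSpace.separableSpace_iff_countable.mp inferInstance)

lemma prepole_countable (hf : S.MeroOrRat f) (k : ℕ) : (prepole S f k).Countable := by
  induction k with
  | zero =>
    refine (countable_singleton S.infty).mono ?_
    rintro x ⟨-, hx⟩
    rcases dom_cases hf with h | ⟨h, -⟩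
    · rw [h] at hx; exact absurd (mem_univ _) hx
    · rw [h] at hx
      simpa using hx
  | succ k ih =>
    have := ih.biUnion (t := fun q _ => S.dom f ∩ f ⁻¹' {q}) (fun q _ => fibre_countable hf q)
    refine this.mono ?_
    rintro x ⟨h1, h2⟩
    obtain ⟨h3, h4⟩ := defined_succ h1
    rw [iterate_succ_apply] at h2
    exact mem_biUnion (show f x ∈ prepole S f k from ⟨h4, h2⟩) ⟨h3, rfl⟩

lemma exists_radius (hf : S.MeroOrRat f) {r : ℝ} (hr : 0 < r) : ∃ s, 0 < s ∧ s < r ∧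
    ∀ k x, dist x (ctr S z) = s → S.chartInv z x ∉ prepole S f k := by
  have hc : ((fun x => dist x (ctr S z)) '' (S.chartInv z ⁻¹' (⋃ k, prepole S f k))).Countable :=
    ((countable_iUnion (prepole_countable hf)).preimage (chartInv_inj S z)).image _
  obtain ⟨s, hs, hs1, hs2⟩ := (hc.dense_compl ℝ).exists_between hr
  refine ⟨s, hs1, hs2, fun k x hx hp => hs ⟨x, mem_iUnion.mpr ⟨k, hp⟩, hx⟩⟩

lemma Good.noprepole (h : Good S f z ρ R s)
    (hs : ∀ k x, dist x (ctr S z) = s → S.chartInv z x ∉ prepole S f k) (k : ℕ) :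
    ∀ x ∈ closure (Wi S f z R s) \ Wi S f z R s, S.chartInv z x ∉ prepole S f k := by
  induction k using Nat.strong_induction_on with
  | _ k ih =>
  rintro x ⟨hxc, hxn⟩ hxp
  set c := ctr S z with hc
  have hR := h.set.Rpos
  have hs0 := h.spos
  have hsle := h.sle
  have hxs : s < dist x c := by
    rcases lt_trichotomy (dist x c) s with h1 | h1 | h1
    · exact absurd (h.ball_Wi h1) hxn
    · exact absurd hxp (hs k x h1)
    · exact h1
  obtain ⟨u, hu, hux⟩ := mem_closure_iff_seq_limit.mp hxc
  set η := dist x c - s with hη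
  have hη0 : 0 < η := by rw [hη]; linarith
  have hev : ∀ᶠ j in atTop, s + η / 2 < dist (u j) c :=
    (hux.dist tendsto_const_nhds).eventually (lt_mem_nhds (by rw [hη]; linarith))
  obtain ⟨j₀, hj₀⟩ := eventually_atTop.mp hev
  set y : ℕ → ℂ := fun j => u (j + j₀) with hy
  have hyx : Tendsto y atTop (𝓝 x) := hux.comp (tendsto_add_atTop_nat j₀)
  have hyd : ∀ j, s + η / 2 < dist (y j) c := fun j => hj₀ _ (Nat.le_add_left _ _)
  have hyW : ∀ j, y j ∈ Wi S f z R s := fun j => hu _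
  have harm := fun j => h.arm' (hyW j) (by linarith [hyd j] : s < dist (y j) c)
  choose M hM Gs hG hyG τ hτ hτs using harm
  set E := Real.exp 2049 with hE
  have hE0 : 0 < E := Real.exp_pos _
  set δ := η / (8 * E * s) with hδ
  have hδ0 : 0 < δ := by positivity
  have hcR : c ∈ ball c R := mem_ball_self hR
  have hder : ∀ j, δ ≤ ‖deriv (Gs j) c‖ := by
    intro j
    obtain ⟨σ, hσ, hσy⟩ := hyG j
    have gr : ∀ w ∈ Wi S f z R s, ‖Gs j w - Gs j c‖ ≤ E * ‖deriv (Gs j) c‖ * (2 * s) := by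
      intro w hw
      have hw2 := h.Wi_ball hw
      rw [mem_ball, dist_eq_norm] at hw2
      refine (growth hR (hG j).diff (hG j).inj ((hG j).deriv_ne hcR) w ?_).trans ?_
      · rw [mem_ball, dist_eq_norm]; linarith
      · gcongr
    have g1 := gr σ hσ
    have g2 := gr (τ j) (hτ j)
    have g3 : dist (y j) c ≤ dist (y j) (Gs j (τ j)) + s := by
      rw [← hτs j]; exact dist_triangle _ _ _
    have g4 : dist (y j) (Gs j (τ j)) ≤ E * ‖deriv (Gs j) c‖ * (2 * s) + E * ‖deriv (Gs j) c‖ * (2 * s) := by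
      rw [← hσy]
      refine (dist_triangle_right _ _ (Gs j c)).trans ?_
      rw [dist_eq_norm, dist_eq_norm]
      exact add_le_add g1 g2
    rw [hδ, div_le_iff₀ (by positivity)]
    nlinarith [hyd j]
  obtain ⟨N, hN⟩ := h.set.K δ hδ0
  have hMN : ∀ j, M j < N := by
    intro j
    by_contra hcon
    push Not at hcon
    exact absurd (hN _ hcon _ (hG j)) (not_lt.mpr (hder j))
  have hmem : ∀ j, (M j, Gs j c) ∈ (Iio N) ×ˢ (closedBall c ρ) := fun j =>
    ⟨hMN j, ball_subset_closedBall ((hG j).maps hcR)⟩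
  obtain ⟨⟨m', p⟩, -, φ, hφ, hlim⟩ :=
    (((finite_Iio N).isCompact).prod (isCompact_closedBall c ρ)).tendsto_subseq hmem
  obtain ⟨s₁, hs₁, hs₁R, hk⟩ := h.set.koeR hδ0
  set κ := δ * (s₁ / 2) / 4 with hκ
  have hκ0 : 0 < κ := by positivity
  have l1 : ∀ᶠ j in atTop, M (φ j) = m' := by
    have := (continuous_fst.tendsto (m', p)).comp hlim
    rw [nhds_discrete, tendsto_pure] at this
    exact this
  have l2 : ∀ᶠ j in atTop, dist (Gs (φ j) c) p < κ / 2 :=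
    ((continuous_snd.tendsto (m', p)).comp hlim).eventually (ball_mem_nhds _ (by positivity))
  obtain ⟨J, hJ⟩ := eventually_atTop.mp (l1.and l2)
  set g := Gs (φ J) with hg
  have hgR : RB S f z R ρ m' g := by
    have := hG (φ J); rwa [(hJ J le_rfl).1] at this
  have heq : ∀ j ≥ J, EqOn (Gs (φ j)) g (ball c R) := by
    intro j hj
    have hGj : RB S f z R ρ m' (Gs (φ j)) := by
      have := hG (φ j); rwa [(hJ j hj).1] at this
    have hd : Gs (φ j) c ∈ ball (g c) κ := by
      rw [mem_ball]
      refine (dist_triangle_right _ _ p).trans_lt ?_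
      linarith [(hJ j hj).2, (hJ J le_rfl).2]
    obtain ⟨w, hw, hwe⟩ := hk m' g hgR (hder (φ J)) (s₁ / 2) (by positivity) (by linarith) hd
    have hwR : w ∈ ball c R := closedBall_subset_ball (by linarith) hw
    exact (hGj.unique hgR hcR hwR hwe.symm).2
  have hWR : Wi S f z R s ⊆ ball c R := h.Wi_ball.trans h.ball_R
  have hyg : ∀ j ≥ J, y (φ j) ∈ g '' Wi S f z R s := by
    intro j hj
    obtain ⟨σ, hσ, e⟩ := hyG (φ j)
    exact ⟨σ, hσ, by rw [← heq j hj (hWR hσ), e]⟩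
  have hclW : closure (Wi S f z R s) ⊆ closedBall c (2 * s) :=
    closure_minimal (h.Wi_ball.trans ball_subset_closedBall) isClosed_closedBall
  have hclR : closure (Wi S f z R s) ⊆ ball c R :=
    hclW.trans (closedBall_subset_ball (by linarith))
  have hcpt : IsCompact (g '' closure (Wi S f z R s)) :=
    ((isCompact_closedBall c (2 * s)).of_isClosed_subset isClosed_closure hclW).image_of_continuousOn
      (hgR.diff.continuousOn.mono hclR)
  have hxg : x ∈ g '' closure (Wi S f z R s) := by
    refine hcpt.isClosed.mem_of_tendsto (hyx.comp hφ.tendsto_atTop) ?_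
    filter_upwards [eventually_ge_atTop J] with j hj
    exact image_mono subset_closure (hyg j hj)
  obtain ⟨w, hw, hwx⟩ := hxg
  have hwR := hclR hw
  have hwn : w ∉ Wi S f z R s := by
    intro hwW
    rcases h.dicho hgR with h1 | h1
    · exact hxn (hwx ▸ h1 hwW)
    · exact disjoint_left.mp h1 (hyg J le_rfl) (hyW _)
  have hm1 : 1 ≤ m' := by
    rw [← (hJ J le_rfl).1]; exact hM _
  have hdx : S.DefinedUpTo f (S.chartInv z x) m' := hwx ▸ hgR.dfd w hwR
  have hsx : f^[m'] (S.chartInv z x) = S.chartInv z w := hwx ▸ hgR.sec w hwR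
  have hkm : m' ≤ k := by
    by_contra hcon
    push Not at hcon
    exact hxp.2 (hdx k hcon)
  obtain ⟨l, rfl⟩ := Nat.exists_eq_add_of_le hkm
  refine ih l (by omega) w ⟨hw, hwn⟩ ⟨?_, ?_⟩
  · rw [← hsx]; exact (defined_add.mp hxp.1).2
  · have := hxp.2
    rwa [add_comm, iterate_add_apply, hsx] at this

lemma RB.isOpen (h : RB S f z R ρ m G) {O : Set ℂ} (hO : O ⊆ ball (ctr S z) R) (ho : IsOpen O) :
    IsOpen (G '' O) := by
  rw [isOpen_iff_mem_nhds]
  rintro _ ⟨τ, hτ, rfl⟩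
  rw [← (h.an (hO hτ)).hasStrictDerivAt.map_nhds_eq (h.deriv_ne (hO hτ))]
  exact image_mem_map (ho.mem_nhds hτ)

theorem main (hf : S.MeroOrRat f) (hz : z ∈ S.julia f \ S.postSingular f) :
    ∀ ε > 0, ∃ U : Set 𝕊,
      z ∈ U ∧ IsNice f U ∧ SimplyConnectedSpace U ∧ Metric.diam U < ε ∧
      ∃ d > 0, ∀ x ∈ U, ∀ y ∈ S.postSingular f, d ≤ dist x y := by
  intro ε hε
  obtain ⟨ρ, R, hS⟩ := exists_setup hf hz.1 hz.2
  set c := ctr S z with hc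
  have hψc : S.chartInv z c = z := chartInv_chart_self S z
  obtain ⟨r₀, hr₀, hr₀R, hst⟩ := hS.star
  obtain ⟨t, ht, htb⟩ := Metric.eventually_nhds_iff_ball.mp
    ((chartInv_cont S z).continuousAt.eventually (p := fun x => x ∈ ball z (ε / 3))
      (by rw [hψc]; exact ball_mem_nhds _ (by positivity)) : ∀ᶠ τ in 𝓝 c, S.chartInv z τ ∈ ball z (ε / 3))
  obtain ⟨s, hs0, hsr, hsp⟩ := exists_radius (S := S) (z := z) hf (lt_min hr₀ (half_pos ht))
  have hs1 : s < r₀ := hsr.trans_le (min_le_left _ _)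
  have hs2 : s < t / 2 := hsr.trans_le (min_le_right _ _)
  have hgood : Good S f z ρ R s := ⟨hS, hs0, by linarith, hst s hs0 hs1⟩
  have hRρ := hS.Rle
  have hR := hS.Rpos
  set W := Wi S f z R s with hW
  have hWo : IsOpen W := hgood.Wi_open
  have hWc : IsPreconnected W := hgood.Wi_preconn
  have hcW : c ∈ W := hgood.ball_Wi (mem_ball_self hs0)
  have hHB : hull W ⊆ ball c (2 * s) := hull_sub_ball (by positivity) hgood.Wi_ball
  have hHR : hull W ⊆ ball c R := hHB.trans hgood.ball_R
  have hcH : c ∈ hull W := sub_hull hWo hcW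
  have hclH : closure (hull W) ⊆ closedBall c (2 * s) :=
    closure_minimal (hHB.trans ball_subset_closedBall) isClosed_closedBall
  have hUo : IsOpen (S.chartInv z '' hull W) := chartInv_open S z _ hull_open
  have hfrU : frontier (S.chartInv z '' hull W) ⊆ S.chartInv z '' frontier (hull W) := by
    rw [hUo.frontier_eq, hull_open.frontier_eq]
    rintro x ⟨hx, hxn⟩
    have hcl : closure (S.chartInv z '' hull W) ⊆ S.chartInv z '' closure (hull W) :=
      closure_minimal (image_mono subset_closure)
        (((isCompact_closedBall c (2 * s)).of_isClosed_subset isClosed_closure hclH).image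
          (chartInv_cont S z)).isClosed
    obtain ⟨x', hx', rfl⟩ := hcl hx
    exact ⟨x', ⟨hx', fun h => hxn (mem_image_of_mem _ h)⟩, rfl⟩
  refine ⟨S.chartInv z '' hull W, ⟨c, hcH, hψc⟩, ⟨hUo, ?_⟩, ?_, ?_, ?_⟩
  · intro n hn
    rw [eq_empty_iff_forall_notMem]
    rintro _ ⟨⟨x, hx, rfl⟩, τ, hτ, hτe⟩
    obtain ⟨x', hx', rfl⟩ := hfrU hx
    by_cases hd : S.DefinedUpTo f (S.chartInv z x') n
    · have hx'R : x' ∈ ball c R :=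
        closedBall_subset_ball (by linarith) (hclH (frontier_subset_closure hx'))
      obtain ⟨G, hG, hGx⟩ := hS.rbex n x' hx'R τ (hHR hτ) hd hτe.symm
      have hmaps : MapsTo G (hull W) (hull W) := by
        refine hull_image hs0 (by linarith) hWo hWc hgood.ball_Wi hgood.Wi_ball hG.diff.continuousOn
          (fun O hO ho => hG.isOpen hO ho) hG.inj (hgood.dicho hG)
          (fun hex => (hgood.star n hn G hG hex).2) ?_
        exact mem_closure_iff.mp (frontier_subset_closure hx') _ (hG.isOpen hHR hull_open) ⟨τ, hτ, hGx⟩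
      have := hmaps hτ
      rw [hGx] at this
      rw [hull_open.frontier_eq] at hx'
      exact hx'.2 this
    · have hex : ∃ i, i < n ∧ f^[i] (S.chartInv z x') ∉ S.dom f := by
        by_contra hcon
        push Not at hcon
        exact hd hcon
      classical
      refine hgood.noprepole hsp (Nat.find hex) x' (frontier_hull hWo hx') ⟨?_, (Nat.find_spec hex).2⟩
      intro i hi
      by_contra hcon
      exact Nat.find_min hex hi ⟨hi.trans (Nat.find_spec hex).1, hcon⟩
  · have h1 : SimplyConnectedSpace (hull W) :=
      simplyConnected_of_H _ hull_open ⟨⟨c, hcH⟩, hull_preconn hWo hWc hcW⟩ fun O => hull_H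
    exact ((chartInv_emb S z).isEmbedding.homeomorphImage (hull W)).symm.toHomotopyEquiv.simplyConnectedSpace
  · have : diam (S.chartInv z '' hull W) ≤ 2 * (ε / 3) := by
      refine diam_le_of_subset_closedBall (by positivity) (x := z) ?_
      rintro _ ⟨x, hx, rfl⟩
      apply ball_subset_closedBall
      exact htb x (ball_subset_ball (by linarith) (hHB hx))
    linarith
  · have hK : IsCompact (S.chartInv z '' closedBall c (2 * s)) :=
      (isCompact_closedBall _ _).image (chartInv_cont S z)
    have hKP : S.chartInv z '' closedBall c (2 * s) ⊆ (S.postSingular f)ᶜ := by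
      rintro _ ⟨x, hx, rfl⟩
      exact hS.hP x (closedBall_subset_ball (by linarith) hx)
    obtain ⟨d, hd, hdK⟩ := hK.exists_thickening_subset_open (post_closed (S := S) (f := f)).isOpen_compl hKP
    refine ⟨d, hd, ?_⟩
    rintro _ ⟨x, hx, rfl⟩ y hy
    by_contra hcon
    push Not at hcon
    refine hdK (mem_thickening_iff.mpr ⟨S.chartInv z x,
      mem_image_of_mem _ (ball_subset_closedBall (hHB hx)), ?_⟩) hy
    rwa [dist_comm]

end final
end NiceSet

/-- **Proposition 1.1 (nice sets).** If `f` is a transcendental meromorphic function or a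
rational map of degree at least two and `z ∈ J(f) \ P(f)`, then `z` is contained in a
simply connected nice open set of arbitrarily small diameter lying at positive distance
from the post-singular set. -/
theorem exists_nice_set {𝕊 : Type} [MetricSpace 𝕊] [CompactSpace 𝕊]
    (S : SphereModel 𝕊) (f : 𝕊 → 𝕊) (hf : S.MeroOrRat f)
    (z : 𝕊) (hz : z ∈ S.julia f \ S.postSingular f) :
    ∀ ε > 0, ∃ U : Set 𝕊,
      z ∈ U ∧ IsNice f U ∧ SimplyConnectedSpace U ∧ Metric.diam U < ε ∧
      ∃ d > 0, ∀ x ∈ U, ∀ y ∈ S.postSingular f, d ≤ dist x y := by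
  exact NiceSet.main hf hz
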